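/- Let n ≥ 1 and δ > (n-1)/2. Let p(·) : ℝ^n → (0,1] be globally log-Hölder continuous and assume p_- := essinf p ≥ 2n/(n+1+2δ). Then there exists a constant C > 0 such that for every Schwartz function f on ℝ^n and every ε > 0, ‖B^δ_{1/ε}(f)‖_{WL^{p(·)}} ≤ C ‖M(f,Φ)‖_{L^{p(·)}}; that is, the Bochner–Riesz means of order δ is bounded from the variable Hardy space H^{p(·)}(ℝ^n) to the weak variable Lebesgue space WL^{p(·)}(ℝ^n), uniformly in ε. -/

import Mathlib

noncomputable section

open MeasureTheory Real Set
open scoped ENNReal NNReal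

abbrev En (n : ℕ) : Type := EuclideanSpace ℝ (Fin n)

/-- The Bochner–Riesz kernel of order `δ`: the Fourier transform of `ξ ↦ ((1-|ξ|²)⁺)^δ`. -/
def brKernel (n : ℕ) (δ : ℝ) (x : En n) : ℂ :=
  ∫ ξ : En n, (((max (1 - ‖ξ‖ ^ 2) 0) ^ δ : ℝ) : ℂ) *
    Complex.exp (-(2 * Real.pi) * Complex.I * ((∑ i, x i * ξ i : ℝ) : ℂ))

/-- The dilated kernel `φ_ε(x) = ε^{-n} φ(x/ε)`. -/
def brKernelDil (n : ℕ) (δ ε : ℝ) (x : En n) : ℂ :=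
  (ε ^ n)⁻¹ • brKernel n δ (ε⁻¹ • x)

/-- The Bochner–Riesz means `B^δ_{1/ε} f = f * φ_ε`. -/
def brMeans (n : ℕ) (δ ε : ℝ) (f : En n → ℂ) (x : En n) : ℂ :=
  ∫ y, f y * brKernelDil n δ ε (x - y)

/-- The maximal Bochner–Riesz means `B^δ_* f`. -/
def brMax (n : ℕ) (δ : ℝ) (f : En n → ℂ) (x : En n) : ℝ≥0∞ :=
  ⨆ (ε : ℝ) (_ : 0 < ε), (‖brMeans n δ ε f x‖₊ : ℝ≥0∞)

/-- The radial maximal function `M(f,Φ)(x) = sup_{t>0} |(Φ_t * f)(x)|`. -/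
def radMax (n : ℕ) (Φ : En n → ℂ) (f : En n → ℂ) (x : En n) : ℝ≥0∞ :=
  ⨆ (t : ℝ) (_ : 0 < t), (‖∫ y, (t ^ n)⁻¹ • Φ (t⁻¹ • (x - y)) * f y‖₊ : ℝ≥0∞)

/-- The variable Lebesgue norm `‖g‖_{L^{p(·)}}` of a nonnegative function. -/
def vlQ (n : ℕ) (p : En n → ℝ) (g : En n → ℝ≥0∞) : ℝ≥0∞ :=
  sInf {lam : ℝ≥0∞ | 0 < lam ∧ lam < ⊤ ∧ (∫⁻ x, (g x / lam) ^ (p x)) ≤ 1}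

/-- The weak variable Lebesgue quasinorm `‖g‖_{WL^{p(·)}}`. -/
def vlWQ (n : ℕ) (p : En n → ℝ) (g : En n → ℝ≥0∞) : ℝ≥0∞ :=
  ⨆ (β : ℝ≥0) (_ : 0 < β),
    (β : ℝ≥0∞) * vlQ n p ({x | (β : ℝ≥0∞) < g x}.indicator 1)

/-- `p(·)` is globally log-Hölder continuous. -/
def GlobalLogHolder (n : ℕ) (p : En n → ℝ) : Prop :=
  ∃ (C₀ pinf : ℝ), 0 < C₀ ∧
    (∀ x y : En n, x ≠ y →
      |p x - p y| ≤ C₀ / Real.log (Real.exp 1 + 1 / ‖x - y‖)) ∧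
    (∀ x : En n, |p x - pinf| ≤ C₀ / Real.log (Real.exp 1 + ‖x‖))

noncomputable section
open MeasureTheory Real Set
open scoped ENNReal NNReal

/-- lattice point -/
def lat {n : ℕ} (j : Fin n → ℤ) : En n := WithLp.toLp 2 (fun i => (j i : ℝ))

/-- unit cube -/
def cube {n : ℕ} (j : Fin n → ℤ) : Set (En n) := {x | ∀ i, ⌊x i⌋ = j i}

/-- polynomial weight -/
def wt {n : ℕ} (γ : ℝ) (x : En n) : ℝ≥0∞ := ENNReal.ofReal ((1 + ‖x‖) ^ (-γ))

lemma measurableSet_cube {n : ℕ} (j : Fin n → ℤ) : MeasurableSet (cube j) := by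
  unfold cube
  rw [Set.ofPred_forall]
  refine MeasurableSet.iInter fun i => ?_
  have : Measurable fun x : En n => ⌊x i⌋ := Int.measurable_floor.comp (by fun_prop)
  exact this (measurableSet_singleton _)

lemma cube_disj {n : ℕ} : Pairwise (Function.onFun Disjoint (cube (n := n))) := by
  intro i j hij
  rw [Function.onFun, Set.disjoint_left]
  intro x hx hy
  exact hij (funext fun k => (hx k).symm.trans (hy k))

lemma cube_iUnion {n : ℕ} : (⋃ j, cube (n := n) j) = univ := by
  ext x; simp only [mem_iUnion, mem_univ, iff_true]
  exact ⟨fun i => ⌊x i⌋, fun i => rfl⟩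

lemma tsum_cube {n : ℕ} (f : En n → ℝ≥0∞) :
    ∑' j, ∫⁻ x in cube j, f x = ∫⁻ x, f x := by
  rw [← lintegral_iUnion measurableSet_cube cube_disj, cube_iUnion, setLIntegral_univ]

lemma volume_cube {n : ℕ} (j : Fin n → ℤ) : volume (cube j) = 1 := by
  have h : cube j = (MeasurableEquiv.toLp 2 (Fin n → ℝ)).symm ⁻¹'
      (Set.pi univ fun i => Ico (j i : ℝ) (j i + 1)) := by
    ext x
    simp only [cube, mem_ofPred_eq, mem_preimage, Set.mem_pi, mem_univ, forall_true_left, mem_Ico]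
    refine forall_congr' fun i => ?_
    rw [Int.floor_eq_iff]; rfl
  rw [h, (EuclideanSpace.volume_preserving_symm_measurableEquiv_toLp (Fin n)).measure_preimage
    (MeasurableSet.univ_pi fun i => measurableSet_Ico).nullMeasurableSet]
  rw [volume_pi_pi]; simp

lemma norm_cube {n : ℕ} {j : Fin n → ℤ} {x : En n} (hx : x ∈ cube j) : ‖x - lat j‖ ≤ n := by
  rw [EuclideanSpace.norm_eq]
  rw [Real.sqrt_le_left (by positivity)]
  have : ∀ i, ‖(x - lat j) i‖ ^ 2 ≤ 1 := by
    intro i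
    have h1 : (x - lat j) i = x i - j i := rfl
    rw [h1, ← hx i]
    have h2 := Int.floor_le (x i)
    have h3 := Int.lt_floor_add_one (x i)
    rw [Real.norm_eq_abs, sq_abs]; nlinarith
  calc _ ≤ ∑ i : Fin n, (1:ℝ) := Finset.sum_le_sum fun i _ => this i
    _ = n := by simp
    _ ≤ (n:ℝ)^2 := by
      rcases Nat.eq_zero_or_pos n with h | h
      · simp [h]
      · have : (1:ℝ) ≤ n := by exact_mod_cast h
        nlinarith

lemma wt_lt_top {n : ℕ} (γ : ℝ) (x : En n) : wt γ x < ⊤ := ENNReal.ofReal_lt_top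

lemma measurable_wt {n : ℕ} (γ : ℝ) : Measurable (wt (n := n) γ) := by
  unfold wt; fun_prop

lemma lintegral_wt_lt_top {n : ℕ} {γ : ℝ} (h : (n : ℝ) < γ) :
    ∫⁻ x : En n, wt γ x < ⊤ := by
  have := finite_integral_one_add_norm (E := En n) (μ := volume) (r := γ) (by simpa using h)
  exact this

lemma wt_neg {n : ℕ} (γ : ℝ) (x : En n) : wt γ (-x) = wt γ x := by simp [wt]

lemma wt_sub_comm {n : ℕ} (γ : ℝ) (x y : En n) : wt γ (x - y) = wt γ (y - x) := by
  rw [← wt_neg, neg_sub]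

lemma wt_mul {n : ℕ} (a b : ℝ) (x : En n) : wt a x * wt b x = wt (a + b) x := by
  unfold wt
  have : (0:ℝ) < 1 + ‖x‖ := by positivity
  rw [← ENNReal.ofReal_mul (by positivity), ← Real.rpow_add this]; congr 2; ring

lemma wt_rpow {n : ℕ} (a : ℝ) {b : ℝ} (hb : 0 ≤ b) (x : En n) : wt a x ^ b = wt (a * b) x := by
  unfold wt
  have : (0:ℝ) < 1 + ‖x‖ := by positivity
  rw [ENNReal.ofReal_rpow_of_nonneg (by positivity) hb, ← Real.rpow_mul this.le]; congr 2; ring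

lemma wt_anti {n : ℕ} {a b : ℝ} (h : a ≤ b) (x : En n) : wt b x ≤ wt a x := by
  unfold wt
  apply ENNReal.ofReal_le_ofReal
  exact Real.rpow_le_rpow_of_exponent_le (by linarith [norm_nonneg x]) (by linarith)

lemma wt_le_of {n : ℕ} {γ : ℝ} (hγ : 0 ≤ γ) {x y : En n} {K : ℝ} (hK : 0 < K)
    (h : 1 + ‖y‖ ≤ K * (1 + ‖x‖)) :
    wt γ x ≤ ENNReal.ofReal (K ^ γ) * wt γ y := by
  unfold wt
  rw [← ENNReal.ofReal_mul (by positivity)]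
  apply ENNReal.ofReal_le_ofReal
  have hx : (0:ℝ) < 1 + ‖x‖ := by positivity
  have hy : (0:ℝ) < 1 + ‖y‖ := by positivity
  rw [Real.rpow_neg hx.le, Real.rpow_neg hy.le, ← div_eq_mul_inv, ← one_div,
    div_le_div_iff₀ (by positivity) (by positivity), one_mul, ← Real.mul_rpow hK.le hx.le]
  exact Real.rpow_le_rpow hy.le h hγ

/-- Peetre's inequality -/
lemma wt_peetre {n : ℕ} {γ : ℝ} (hγ : 0 ≤ γ) (x y : En n) :
    wt γ x * wt γ y ≤ wt γ (x + y) := by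
  unfold wt
  rw [← ENNReal.ofReal_mul (by positivity)]
  apply ENNReal.ofReal_le_ofReal
  rw [← Real.mul_rpow (by positivity) (by positivity)]
  apply Real.rpow_le_rpow_of_nonpos (by positivity) _ (by linarith)
  nlinarith [norm_nonneg x, norm_nonneg y, norm_add_le x y, mul_nonneg (norm_nonneg x) (norm_nonneg y)]

lemma lintegral_smul {n : ℕ} {f : En n → ℝ≥0∞} {η : ℝ} (hη : 0 < η) :
    ENNReal.ofReal (η ^ n) * ∫⁻ x, f (η • x) = ∫⁻ x, f x := by
  have h := Measure.map_addHaar_smul (volume : Measure (En n)) hη.ne'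
  have h2 : ∫⁻ x, f (η • x) = ∫⁻ x, f x ∂(Measure.map (η • ·) volume) := by
    have := lintegral_map_equiv (μ := (volume : Measure (En n))) f
      (Homeomorph.smulOfNeZero η hη.ne' : En n ≃ₜ En n).toMeasurableEquiv
    exact this.symm
  rw [h2, h, lintegral_smul_measure, smul_eq_mul, ← mul_assoc, ← ENNReal.ofReal_mul (by positivity)]
  rw [finrank_euclideanSpace_fin, abs_of_nonneg (by positivity), mul_inv_cancel₀ (by positivity)]
  simp

lemma lintegral_wt_smul {n : ℕ} {γ : ℝ} {η : ℝ} (hη : 0 < η) (z : En n) :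
    ENNReal.ofReal (η ^ n) * ∫⁻ x : En n, wt γ (η • (x - z)) = ∫⁻ x : En n, wt γ x := by
  rw [lintegral_sub_right_eq_self (fun x => wt γ (η • x)) z]
  exact lintegral_smul (f := wt γ) hη

lemma wt_cube {n : ℕ} {γ : ℝ} (hγ : 0 ≤ γ) {η : ℝ} (hη : 0 < η) (hη1 : η ≤ 1) {j : Fin n → ℤ}
    {x y : En n} (hy : y ∈ cube j) :
    wt γ (η • (x - lat j)) ≤ ENNReal.ofReal ((1 + n) ^ γ) * wt γ (η • (x - y)) := by
  apply wt_le_of hγ (by positivity)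
  have h1 : ‖η • (x - y)‖ ≤ ‖η • (x - lat j)‖ + n := by
    have e : η • (x - y) = η • (x - lat j) - η • (y - lat j) := by
      rw [← smul_sub]; congr 1; abel
    rw [e]
    refine (norm_sub_le _ _).trans ?_
    gcongr
    rw [norm_smul, Real.norm_eq_abs, abs_of_pos hη]
    have := norm_cube hy
    nlinarith [norm_nonneg (y - lat j)]
  nlinarith [norm_nonneg (η • (x - lat j)), (Nat.cast_nonneg n : (0:ℝ) ≤ n),
    mul_nonneg (Nat.cast_nonneg n : (0:ℝ) ≤ n) (norm_nonneg (η • (x - lat j)))]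

lemma wt_cube' {n : ℕ} {γ : ℝ} (hγ : 0 ≤ γ) {j : Fin n → ℤ}
    {x y : En n} (hy : y ∈ cube j) :
    wt γ (x - y) ≤ ENNReal.ofReal ((1 + n) ^ γ) * wt γ (x - lat j) := by
  apply wt_le_of hγ (by positivity)
  have h1 : ‖x - lat j‖ ≤ ‖x - y‖ + n := by
    have e : x - lat j = (x - y) + (y - lat j) := by abel
    rw [e]
    refine (norm_add_le _ _).trans ?_
    gcongr
    exact norm_cube hy
  nlinarith [norm_nonneg (x - y), (Nat.cast_nonneg n : (0:ℝ) ≤ n),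
    mul_nonneg (Nat.cast_nonneg n : (0:ℝ) ≤ n) (norm_nonneg (x - y))]

lemma tsum_wt_le {n : ℕ} {γ : ℝ} (hγ : 0 ≤ γ) {η : ℝ} (hη : 0 < η) (hη1 : η ≤ 1) (x : En n) :
    ∑' j : Fin n → ℤ, ENNReal.ofReal (η ^ n) * wt γ (η • (x - lat j)) ≤
      ENNReal.ofReal ((1 + n) ^ γ) * ∫⁻ x : En n, wt γ x := by
  have h1 : ∀ j : Fin n → ℤ, ENNReal.ofReal (η ^ n) * wt γ (η • (x - lat j)) ≤
      ∫⁻ y in cube j, ENNReal.ofReal ((1 + n) ^ γ) *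
        (ENNReal.ofReal (η ^ n) * wt γ (η • (y - x))) := by
    intro j
    calc ENNReal.ofReal (η ^ n) * wt γ (η • (x - lat j)) 
        = ∫⁻ y in cube j, ENNReal.ofReal (η ^ n) * wt γ (η • (x - lat j)) := by
          rw [setLIntegral_const, volume_cube, mul_one]
      _ ≤ _ := by
          apply setLIntegral_mono' (measurableSet_cube j)
          intro y hy
          rw [mul_left_comm]
          gcongr
          refine (wt_cube hγ hη hη1 hy).trans ?_
          rw [← wt_neg _ (η • (x - y)), ← smul_neg, neg_sub]
  refine (ENNReal.tsum_le_tsum h1).trans ?_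
  rw [tsum_cube]
  rw [lintegral_const_mul' _ _ ENNReal.ofReal_ne_top, lintegral_const_mul' _ _ ENNReal.ofReal_ne_top,
    lintegral_wt_smul hη]

end

noncomputable section
open MeasureTheory Real Set
open scoped ENNReal NNReal

/-- Scaled log-Hölder class. -/
structure LH (n : ℕ) (C0 pinf p0 ε : ℝ) (P : En n → ℝ) : Prop where
  lo : ∀ x, p0 ≤ P x
  hi : ∀ x, P x ≤ 1
  loc : ∀ x y : En n, x ≠ y → |P x - P y| ≤ C0 / Real.log (Real.exp 1 + 1 / (ε * ‖x - y‖))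
  inf : ∀ x : En n, |P x - pinf| ≤ C0 / Real.log (Real.exp 1 + ε * ‖x‖)

/-- decaying error function -/
def ell {n : ℕ} (ε : ℝ) (x : En n) : ℝ := (Real.exp 1 + ε * ‖x‖) ^ (-((n : ℝ) + 1))

lemma one_le_e : (1:ℝ) ≤ Real.exp 1 := by
  have := Real.add_one_le_exp (1:ℝ); linarith

lemma one_le_base {n : ℕ} {ε : ℝ} (hε : 0 < ε) (x : En n) : 1 ≤ Real.exp 1 + ε * ‖x‖ := by
  have := one_le_e
  have : 0 ≤ ε * ‖x‖ := by positivity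
  linarith

lemma log_base {n : ℕ} {ε : ℝ} (hε : 0 < ε) (x : En n) :
    1 ≤ Real.log (Real.exp 1 + ε * ‖x‖) := by
  rw [Real.le_log_iff_exp_le (by have := one_le_base hε x; linarith)]
  have : 0 ≤ ε * ‖x‖ := by positivity
  linarith

lemma ell_pos {n : ℕ} {ε : ℝ} (hε : 0 < ε) (x : En n) : 0 < ell ε x := by
  have := one_le_base hε x
  unfold ell; positivity

lemma ell_le_one {n : ℕ} {ε : ℝ} (hε : 0 < ε) (x : En n) : ell ε x ≤ 1 :=
  Real.rpow_le_one_of_one_le_of_nonpos (one_le_base hε x)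
    (by have : (0:ℝ) ≤ n := Nat.cast_nonneg n
        linarith)

lemma exists_V1 {n : ℕ} {C0 pinf p0 : ℝ} (hC0 : 0 < C0) (hp0 : 0 < p0) :
    ∃ C : ℝ, 1 ≤ C ∧ ∀ (ε : ℝ) (P : En n → ℝ), 0 < ε → LH n C0 pinf p0 ε P →
      ∀ (x y : En n) (u : ℝ), 0 ≤ u → u ≤ 1 →
        u ^ P x ≤ C * (u ^ P y + ell ε y) + ell ε x * u ^ (p0 / 2) := by
  set m : ℝ := 2 * ((n:ℝ) + 1) / p0 with hm
  have hn : (0:ℝ) ≤ n := Nat.cast_nonneg n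
  have hm0 : 0 < m := by positivity
  refine ⟨Real.exp (2 * m * C0), ?_, ?_⟩
  · exact Real.one_le_exp (by positivity)
  intro ε P hε hP x y u hu0 hu1
  have hC1 : 1 ≤ Real.exp (2 * m * C0) := Real.one_le_exp (by positivity)
  have hly := ell_pos hε y
  have hlx := ell_pos hε x
  rcases hu0.eq_or_lt with h0 | hu
  · rw [← h0, Real.zero_rpow (by have := hP.lo x; linarith)]
    have : (0:ℝ) ≤ 0 ^ P y := by positivity
    have : (0:ℝ) ≤ 0 ^ (p0/2) := by positivity
    positivity
  have hup : u ^ P x ≤ u ^ (p0/2) * u ^ (p0/2) := by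
    rw [← Real.rpow_add hu]
    exact Real.rpow_le_rpow_of_exponent_ge hu hu1 (by linarith [hP.lo x])
  have half : ∀ z : En n, u < (Real.exp 1 + ε * ‖z‖) ^ (-m) → u ^ (p0/2) ≤ ell ε z := by
    intro z hz
    have hb := one_le_base hε z
    calc u ^ (p0/2) ≤ ((Real.exp 1 + ε * ‖z‖) ^ (-m)) ^ (p0/2) :=
          Real.rpow_le_rpow hu.le hz.le (by positivity)
      _ = ell ε z := by
          unfold ell
          rw [← Real.rpow_mul (by linarith)]
          congr 1
          rw [hm]; field_simp
  have pw : 0 < u ^ (p0/2) := by positivity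
  have pw1 : u ^ (p0/2) ≤ 1 := Real.rpow_le_one hu.le hu1 (by positivity)
  have pwy : 0 < u ^ (P y) := by positivity
  by_cases h1 : u < (Real.exp 1 + ε * ‖y‖) ^ (-m)
  · have := half y h1
    have e1 : u ^ P x ≤ ell ε y := by nlinarith
    have e2 : ell ε y ≤ Real.exp (2 * m * C0) * (u ^ P y + ell ε y) := by nlinarith
    have e3 : 0 ≤ ell ε x * u ^ (p0/2) := by positivity
    linarith
  by_cases h2 : u < (Real.exp 1 + ε * ‖x‖) ^ (-m)
  · have := half x h2
    have e1 : u ^ P x ≤ ell ε x * u ^ (p0/2) := by nlinarith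
    have e3 : 0 ≤ Real.exp (2 * m * C0) * (u ^ P y + ell ε y) := by positivity
    linarith
  push Not at h1 h2
  have lg : ∀ z : En n, (Real.exp 1 + ε * ‖z‖) ^ (-m) ≤ u →
      -Real.log u * |P z - pinf| ≤ m * C0 := by
    intro z hz
    have hb := one_le_base hε z
    have hl := log_base hε z
    have := Real.log_le_log (by positivity) hz
    rw [Real.log_rpow (by linarith)] at this
    have hh := hP.inf z
    rw [le_div_iff₀ (by linarith)] at hh
    have hlu : 0 ≤ -Real.log u := by have := Real.log_nonpos hu.le hu1; linarith
    calc -Real.log u * |P z - pinf| ≤ (m * Real.log (Real.exp 1 + ε * ‖z‖)) * |P z - pinf| := by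
          apply mul_le_mul_of_nonneg_right _ (abs_nonneg _); linarith
      _ = m * (|P z - pinf| * Real.log (Real.exp 1 + ε * ‖z‖)) := by ring
      _ ≤ m * C0 := by gcongr
  have key : u ^ P x ≤ Real.exp (2 * m * C0) * u ^ P y := by
    rw [Real.rpow_def_of_pos hu, Real.rpow_def_of_pos hu, ← Real.exp_add]
    apply Real.exp_le_exp.2
    have a1 := lg x h2
    have a2 := lg y h1
    have hlu : 0 ≤ -Real.log u := by have := Real.log_nonpos hu.le hu1; linarith
    have b1 : -Real.log u * (pinf - P x) ≤ -Real.log u * |P x - pinf| := by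
      apply mul_le_mul_of_nonneg_left _ hlu
      rw [abs_sub_comm]; exact le_abs_self _
    have b2 : -Real.log u * (P y - pinf) ≤ -Real.log u * |P y - pinf| := by
      apply mul_le_mul_of_nonneg_left _ hlu
      exact le_abs_self _
    nlinarith
  have e3 : 0 ≤ ell ε x * u ^ (p0/2) := by positivity
  have e4 : 0 ≤ Real.exp (2 * m * C0) * ell ε y := by positivity
  nlinarith

lemma V2 {n : ℕ} {C0 pinf p0 ε : ℝ} (hC0 : 0 < C0) {P : En n → ℝ} (hε : 0 < ε)
    (hP : LH n C0 pinf p0 ε P) (x y : En n) (τ : ℝ) (hτ : 0 < τ) (h : ε * ‖x - y‖ ≤ τ) :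
    Real.log (1 / τ) * |P x - P y| ≤ C0 := by
  by_cases hxy : x = y
  · simp [hxy, hC0.le]
  by_cases h1 : Real.log (1 / τ) ≤ 0
  · nlinarith [abs_nonneg (P x - P y)]
  push Not at h1
  have hd : 0 < ‖x - y‖ := norm_pos_iff.2 (sub_ne_zero.2 hxy)
  have hed : 0 < ε * ‖x - y‖ := by positivity
  have h2 : Real.log (1/τ) ≤ Real.log (Real.exp 1 + 1 / (ε * ‖x - y‖)) := by
    apply Real.log_le_log (by positivity)
    have : 1 / τ ≤ 1 / (ε * ‖x - y‖) := one_div_le_one_div_of_le hed h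
    have := Real.exp_pos 1
    linarith
  have h3 := hP.loc x y hxy
  rw [le_div_iff₀ (by linarith)] at h3
  nlinarith [abs_nonneg (P x - P y)]

lemma V2' {n : ℕ} {C0 pinf p0 ε : ℝ} (hC0 : 0 < C0) {P : En n → ℝ} (hε : 0 < ε)
    (hP : LH n C0 pinf p0 ε P) (x y : En n) (τ : ℝ) (hτ : 0 < τ) (h : ε * ‖x - y‖ ≤ τ) :
    (1 / τ) ^ |P x - P y| ≤ Real.exp C0 := by
  rw [Real.rpow_def_of_pos (by positivity)]
  exact Real.exp_le_exp.2 (V2 hC0 hε hP x y τ hτ h)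

lemma LH.absle {n : ℕ} {C0 pinf p0 ε : ℝ} {P : En n → ℝ} (hP : LH n C0 pinf p0 ε P) (x y : En n) :
    |P x - P y| ≤ 1 - p0 := by
  rw [abs_le]; constructor <;> linarith [hP.lo x, hP.lo y, hP.hi x, hP.hi y]

/-- pointwise bound, `lam < 1` -/
lemma exists_R1 {n : ℕ} {C0 pinf p0 : ℝ} (hC0 : 0 < C0) (hp0 : 0 < p0) :
    ∃ C : ℝ, 1 ≤ C ∧ ∀ (ε : ℝ) (P : En n → ℝ), 0 < ε → LH n C0 pinf p0 ε P →
      ∀ (x y : En n) (u lam : ℝ), 0 ≤ u → 0 < lam → lam < 1 →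
        lam ^ (P y - p0) * u ^ p0 ≤ lam ^ P y + C * (u ^ P x + ell ε x + ell ε y) := by
  obtain ⟨C, hC, hV⟩ := exists_V1 (n := n) (pinf := pinf) hC0 hp0
  refine ⟨C, hC, ?_⟩
  intro ε P hε hP x y u lam hu hl hl1
  have hly := ell_pos hε y
  have hlx := ell_pos hε x
  have h0 : 0 ≤ u ^ P x := by positivity
  have hlp : 0 < lam ^ P y := by positivity
  by_cases h1 : u ≤ lam
  · have : lam ^ (P y - p0) * u ^ p0 ≤ lam ^ P y := by
      calc _ ≤ lam ^ (P y - p0) * lam ^ p0 := by gcongr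
        _ = _ := by rw [← Real.rpow_add hl]; congr 1; ring
    have : 0 ≤ C * (u ^ P x + ell ε x + ell ε y) := by positivity
    linarith
  push Not at h1
  have hu' : 0 < u := hl.trans h1
  by_cases h2 : 1 ≤ u
  · have e1 : lam ^ (P y - p0) ≤ 1 := Real.rpow_le_one hl.le hl1.le (by linarith [hP.lo y])
    have e2 : u ^ p0 ≤ u ^ P x := Real.rpow_le_rpow_of_exponent_le h2 (hP.lo x)
    have e3 : 0 < u ^ p0 := by positivity
    have e4 : lam ^ (P y - p0) * u ^ p0 ≤ u ^ P x := by nlinarith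
    nlinarith
  push Not at h2
  have e1 : lam ^ (P y - p0) * u ^ p0 ≤ u ^ P y := by
    calc _ ≤ u ^ (P y - p0) * u ^ p0 := by
          gcongr
          linarith [hP.lo y]
      _ = _ := by rw [← Real.rpow_add hu']; congr 1; ring
  have e2 := hV ε P hε hP y x u hu h2.le
  have pw1 : u ^ (p0/2) ≤ 1 := Real.rpow_le_one hu h2.le (by positivity)
  have e3 : ell ε y * u ^ (p0/2) ≤ C * ell ε y := by nlinarith
  nlinarith

lemma exists_R2 {n : ℕ} (hn : 1 ≤ n) {C0 pinf p0 : ℝ} (hC0 : 0 < C0) (hp0 : 0 < p0) :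
    ∃ C : ℝ, 1 ≤ C ∧ ∀ (ε : ℝ) (P : En n → ℝ), 0 < ε → LH n C0 pinf p0 ε P →
      ∀ (j : Fin n → ℤ) (x y : En n), x ∈ cube j → y ∈ cube j → ∀ (u lam : ℝ), 0 ≤ u → 1 ≤ lam →
        lam ^ p0 ≤ (ε ^ n)⁻¹ →
        lam ^ (P y - p0) * u ^ p0 ≤ lam ^ P y + C * u ^ P x := by
  refine ⟨(2 * n * Real.exp C0) ^ ((n:ℝ)/p0), ?_, ?_⟩
  · apply Real.one_le_rpow
    · have : (1:ℝ) ≤ n := by exact_mod_cast hn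
      have := Real.one_le_exp hC0.le
      nlinarith
    · positivity
  intro ε P hε hP j x y hx hy u lam hu hl hle
  have hn' : (1:ℝ) ≤ n := by exact_mod_cast hn
  have h0 : 0 ≤ u ^ P x := by positivity
  have hl0 : 0 < lam := by linarith
  have hlp : 0 < lam ^ P y := by positivity
  by_cases h1 : u ≤ lam
  · have : lam ^ (P y - p0) * u ^ p0 ≤ lam ^ P y := by
      calc _ ≤ lam ^ (P y - p0) * lam ^ p0 := by gcongr
        _ = _ := by rw [← Real.rpow_add hl0]; congr 1; ring
    have : 0 ≤ (2 * n * Real.exp C0) ^ ((n:ℝ)/p0) * u ^ P x := by positivity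
    linarith
  push Not at h1
  have hu' : 0 < u := hl0.trans h1
  have hlam : lam ≤ (1/ε) ^ ((n:ℝ)/p0) := by
    have : lam = (lam ^ p0) ^ (1/p0) := by
      rw [← Real.rpow_mul hl0.le]; field_simp; simp
    rw [this]
    calc _ ≤ ((ε ^ n)⁻¹) ^ (1/p0) := by gcongr
      _ = _ := by
        rw [show (ε ^ n)⁻¹ = (1/ε) ^ (n:ℝ) by rw [Real.rpow_natCast]; simp]
        rw [← Real.rpow_mul (by positivity)]; congr 1; ring
  have hxy : ‖x - y‖ ≤ 2 * n := by
    have : x - y = (x - lat j) - (y - lat j) := by abel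
    rw [this]
    have := norm_sub_le (x - lat j) (y - lat j)
    linarith [norm_cube hx, norm_cube hy]
  set Δ := |P x - P y| with hΔ
  have hΔ0 : 0 ≤ Δ := abs_nonneg _
  have hΔ1 : Δ ≤ 1 := by have := hP.absle x y; linarith
  have e1 : (1/ε) ^ Δ ≤ 2 * n * Real.exp C0 := by
    have h2 := V2' hC0 hε hP x y (2 * n * ε) (by positivity) (by nlinarith)
    have : (1/ε) = (2 * n) * (1 / (2 * n * ε)) := by field_simp
    rw [this, Real.mul_rpow (by positivity) (by positivity)]
    have h3 : (2 * (n:ℝ)) ^ Δ ≤ 2 * n := by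
      calc (2 * (n:ℝ)) ^ Δ ≤ (2 * (n:ℝ)) ^ (1:ℝ) :=
            Real.rpow_le_rpow_of_exponent_le (by linarith) hΔ1
        _ = _ := by simp
    gcongr
  have e2 : lam ^ (P y - P x) ≤ (2 * n * Real.exp C0) ^ ((n:ℝ)/p0) := by
    calc lam ^ (P y - P x) ≤ lam ^ Δ :=
          Real.rpow_le_rpow_of_exponent_le hl (by rw [hΔ, abs_sub_comm]; exact le_abs_self _)
      _ ≤ ((1/ε) ^ ((n:ℝ)/p0)) ^ Δ := by gcongr
      _ = ((1/ε) ^ Δ) ^ ((n:ℝ)/p0) := by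
          rw [← Real.rpow_mul (by positivity), ← Real.rpow_mul (by positivity), mul_comm]
      _ ≤ _ := by gcongr
  have e3 : lam ^ (P y - p0) * u ^ p0 ≤ lam ^ (P y - P x) * u ^ P x := by
    have : (u/lam) ^ p0 ≤ (u/lam) ^ P x := 
      Real.rpow_le_rpow_of_exponent_le (by rw [le_div_iff₀ hl0]; linarith) (hP.lo x)
    rw [Real.div_rpow hu hl0.le, Real.div_rpow hu hl0.le] at this
    rw [Real.rpow_sub hl0, Real.rpow_sub hl0]
    calc _ = lam ^ P y * (u ^ p0 / lam ^ p0) := by ring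
      _ ≤ lam ^ P y * (u ^ P x / lam ^ P x) := by gcongr
      _ = _ := by ring
  nlinarith

end

noncomputable section
open MeasureTheory Real Set
open scoped ENNReal NNReal

lemma measurable_ell {n : ℕ} (ε : ℝ) : Measurable (fun x : En n => ell ε x) := by
  unfold ell; fun_prop

lemma cancel2 {X Y : ℝ≥0∞} (hX : X ≠ ⊤) (h : 2 * X ≤ X + Y) : X ≤ Y := by
  rw [two_mul] at h
  exact (ENNReal.add_le_add_iff_left hX).1 h

/-- average of `U^{p0}` on a cube -/
def bavg {n : ℕ} (p0 : ℝ) (U : En n → ℝ≥0∞) (j : Fin n → ℤ) : ℝ≥0∞ :=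
  (∫⁻ x in cube j, U x ^ p0) ^ (1 / p0)

lemma exists_B1 {n : ℕ} (hn : 1 ≤ n) {C0 pinf p0 : ℝ} (hC0 : 0 < C0) (hp0 : 0 < p0) :
    ∃ C : ℝ, 1 ≤ C ∧ ∀ (ε : ℝ) (P : En n → ℝ), 0 < ε → LH n C0 pinf p0 ε P →
      ∀ U : En n → ℝ≥0∞, ENNReal.ofReal (ε ^ n) * ∫⁻ x, U x ^ P x ≤ 1 →
      ∀ j, bavg p0 U j < ⊤ ∧ ∀ y ∈ cube j, bavg p0 U j ^ P y ≤ ENNReal.ofReal C *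
        ((∫⁻ x in cube j, U x ^ P x) + (∫⁻ x in cube j, ENNReal.ofReal (ell ε x)) +
          ENNReal.ofReal (ell ε y)) := by
  obtain ⟨C1, hC1, hR1⟩ := exists_R1 (n := n) (pinf := pinf) hC0 hp0
  obtain ⟨C2, hC2, hR2⟩ := exists_R2 hn (pinf := pinf) hC0 hp0
  set C := max C1 C2 with hCdef
  have hC : 1 ≤ C := le_max_of_le_left hC1
  refine ⟨2 ^ (1/p0) * C, ?_, ?_⟩
  · have : (1:ℝ) ≤ 2 ^ (1/p0) := Real.one_le_rpow (by norm_num) (by positivity)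
    nlinarith
  intro ε P hε hP U hU j
  set I := ∫⁻ x in cube j, U x ^ P x with hI
  set E := ∫⁻ x in cube j, ENNReal.ofReal (ell ε x) with hE
  set B := ∫⁻ x in cube j, U x ^ p0 with hB
  have hIle : I ≤ ENNReal.ofReal (ε ^ n)⁻¹ := by
    have h1 : ENNReal.ofReal (ε ^ n) * I ≤ 1 := by
      refine le_trans ?_ hU
      gcongr
      exact setLIntegral_le_lintegral _ _
    rw [ENNReal.ofReal_inv_of_pos (by positivity)]
    rw [ENNReal.le_inv_iff_mul_le, mul_comm]; exact h1
  have hItop : I ≠ ⊤ := (hIle.trans_lt ENNReal.ofReal_lt_top).ne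
  have hv : volume (cube j) = 1 := volume_cube j
  have hBle : B ≤ 1 + I := by
    calc B ≤ ∫⁻ x in cube j, (1 + U x ^ P x) := by
          apply lintegral_mono
          intro x
          by_cases h : U x ≤ 1
          · exact (ENNReal.rpow_le_one h hp0.le).trans le_self_add
          · push Not at h
            exact (ENNReal.rpow_le_rpow_of_exponent_le h.le (hP.lo x)).trans le_add_self
      _ = 1 + I := by
          rw [lintegral_add_left measurable_const]; simp [hv, hI]
  have hBtop : B ≠ ⊤ := (hBle.trans_lt (by simp [hItop.lt_top])).ne
  have hb : bavg p0 U j = B ^ (1/p0) := rfl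
  refine ⟨by rw [hb]; exact ENNReal.rpow_lt_top_of_nonneg (by positivity) hBtop, ?_⟩
  intro y hy
  have hPy : 0 < P y := hp0.trans_le (hP.lo y)
  by_cases hB0 : B = 0
  · rw [hb, hB0, ENNReal.zero_rpow_of_pos (by positivity), ENNReal.zero_rpow_of_pos hPy]
    exact zero_le
  set lam : ℝ := (B.toReal / 2) ^ (1/p0) with hlam
  have hBr : 0 < B.toReal := ENNReal.toReal_pos hB0 hBtop
  have hl0 : 0 < lam := by positivity
  have hlp : lam ^ p0 = B.toReal / 2 := by
    rw [hlam, ← Real.rpow_mul (by positivity), one_div_mul_cancel hp0.ne', Real.rpow_one]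
  have hBe : B = ENNReal.ofReal (2 * lam ^ p0) := by
    have h2 : 2 * (B.toReal / 2) = B.toReal := by ring
    rw [hlp, h2, ENNReal.ofReal_toReal hBtop]
  have hbl : bavg p0 U j ^ P y ≤ ENNReal.ofReal (2 ^ (1/p0)) * ENNReal.ofReal (lam ^ P y) := by
    rw [hb, hBe, ← ENNReal.rpow_mul, ENNReal.ofReal_rpow_of_nonneg (by positivity) (by positivity),
      ← ENNReal.ofReal_mul (by positivity)]
    apply ENNReal.ofReal_le_ofReal
    rw [Real.mul_rpow (by positivity) (by positivity), ← Real.rpow_mul hl0.le]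
    have e1 : p0 * (1 / p0 * P y) = P y := by field_simp
    rw [e1]
    gcongr
    · norm_num
    · have := hP.hi y
      calc 1/p0 * P y ≤ 1/p0 * 1 := by gcongr
        _ = _ := by ring
  have main : ENNReal.ofReal (lam ^ P y) ≤ ENNReal.ofReal C * (I + E + ENNReal.ofReal (ell ε y)) := by
    have hpm : lam ^ (P y - p0) * (2 * lam ^ p0) = 2 * lam ^ P y := by
      have : lam ^ P y = lam ^ (P y - p0) * lam ^ p0 := by
        rw [← Real.rpow_add hl0]; congr 1; ring
      rw [this]; ring
    have hlhs : ∫⁻ x in cube j, ENNReal.ofReal (lam ^ (P y - p0)) * U x ^ p0 =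
        2 * ENNReal.ofReal (lam ^ P y) := by
      rw [lintegral_const_mul' _ _ ENNReal.ofReal_ne_top, ← hB, hBe,
        ← ENNReal.ofReal_mul (by positivity), hpm, ENNReal.ofReal_mul (by norm_num)]
      simp
    apply cancel2 ENNReal.ofReal_ne_top
    rw [← hlhs]
    by_cases hl1 : lam < 1
    · calc _ ≤ ∫⁻ x in cube j, (ENNReal.ofReal (lam ^ P y) + ENNReal.ofReal C *
              (U x ^ P x + ENNReal.ofReal (ell ε x) + ENNReal.ofReal (ell ε y))) := by
            apply lintegral_mono
            intro x
            have hPx : 0 < P x := hp0.trans_le (hP.lo x)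
            have c0 : ENNReal.ofReal C ≠ 0 := by
              rw [Ne, ENNReal.ofReal_eq_zero]; linarith
            by_cases hux : U x = ⊤
            · simp [hux, ENNReal.top_rpow_of_pos hPx, ENNReal.mul_top c0]
            · have h := hR1 ε P hε hP x y (U x).toReal lam ENNReal.toReal_nonneg hl0 hl1
              have e : U x = ENNReal.ofReal (U x).toReal := (ENNReal.ofReal_toReal hux).symm
              have n1 := (ell_pos hε x).le
              have n2 := (ell_pos hε y).le
              simp only []
              rw [e, ENNReal.ofReal_rpow_of_nonneg ENNReal.toReal_nonneg hp0.le,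
                ENNReal.ofReal_rpow_of_nonneg ENNReal.toReal_nonneg hPx.le,
                ← ENNReal.ofReal_mul (by positivity), ← ENNReal.ofReal_add (by positivity) n1,
                ← ENNReal.ofReal_add (by positivity) n2, ← ENNReal.ofReal_mul (by positivity),
                ← ENNReal.ofReal_add (by positivity) (by positivity)]
              apply ENNReal.ofReal_le_ofReal
              refine h.trans ?_
              gcongr
              exact le_max_left _ _
        _ = _ := by
            rw [lintegral_add_left measurable_const,
              lintegral_const_mul' _ _ ENNReal.ofReal_ne_top,
              lintegral_add_right _ measurable_const,
              lintegral_add_right _ (measurable_ell ε).ennreal_ofReal]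
            simp [hv, hI, hE]
    · push Not at hl1
      have hle : lam ^ p0 ≤ (ε ^ n)⁻¹ := by
        have : ENNReal.ofReal (lam ^ p0) ≤ I := by
          apply cancel2 ENNReal.ofReal_ne_top
          have : 2 * ENNReal.ofReal (lam ^ p0) = B := by
            rw [hBe, ENNReal.ofReal_mul (by norm_num)]; simp
          rw [this]
          calc B ≤ ∫⁻ x in cube j, (ENNReal.ofReal (lam ^ p0) + U x ^ P x) := by
                apply lintegral_mono
                intro x
                simp only []
                by_cases h : U x ≤ ENNReal.ofReal lam
                · refine le_trans ?_ le_self_add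
                  rw [← ENNReal.ofReal_rpow_of_nonneg hl0.le hp0.le]
                  exact ENNReal.rpow_le_rpow h hp0.le
                · push Not at h
                  have : 1 ≤ U x := by
                    refine le_trans ?_ h.le
                    rw [← ENNReal.ofReal_one]
                    exact ENNReal.ofReal_le_ofReal hl1
                  exact (ENNReal.rpow_le_rpow_of_exponent_le this (hP.lo x)).trans le_add_self
            _ = _ := by
                rw [lintegral_add_left measurable_const]; simp [hv, hI]
        exact (ENNReal.ofReal_le_ofReal_iff (by positivity)).1 (this.trans hIle)
      calc _ ≤ ∫⁻ x in cube j, (ENNReal.ofReal (lam ^ P y) + ENNReal.ofReal C * U x ^ P x) := by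
            apply setLIntegral_mono' (measurableSet_cube j)
            intro x hx
            have hPx : 0 < P x := hp0.trans_le (hP.lo x)
            have c0 : ENNReal.ofReal C ≠ 0 := by
              rw [Ne, ENNReal.ofReal_eq_zero]; linarith
            by_cases hux : U x = ⊤
            · simp [hux, ENNReal.top_rpow_of_pos hPx, ENNReal.mul_top c0]
            · have h := hR2 ε P hε hP j x y hx hy (U x).toReal lam ENNReal.toReal_nonneg hl1 hle
              have e : U x = ENNReal.ofReal (U x).toReal := (ENNReal.ofReal_toReal hux).symm
              rw [e, ENNReal.ofReal_rpow_of_nonneg ENNReal.toReal_nonneg hp0.le,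
                ENNReal.ofReal_rpow_of_nonneg ENNReal.toReal_nonneg hPx.le,
                ← ENNReal.ofReal_mul (by positivity), ← ENNReal.ofReal_mul (by positivity),
                ← ENNReal.ofReal_add (by positivity) (by positivity)]
              apply ENNReal.ofReal_le_ofReal
              refine h.trans ?_
              gcongr
              exact le_max_right _ _
        _ ≤ _ := by
            rw [lintegral_add_left measurable_const,
              lintegral_const_mul' _ _ ENNReal.ofReal_ne_top, ← hI]
            simp only [setLIntegral_const, hv, mul_one]
            gcongr
            rw [add_assoc]
            exact le_self_add
  refine hbl.trans ?_
  rw [ENNReal.ofReal_mul (by positivity), mul_assoc]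
  gcongr

/-- total error mass -/
lemma lintegral_ell_le {n : ℕ} {ε : ℝ} (hε : 0 < ε) :
    ENNReal.ofReal (ε ^ n) * ∫⁻ x : En n, ENNReal.ofReal (ell ε x) ≤
      ∫⁻ x : En n, wt ((n:ℝ) + 1) x := by
  rw [← lintegral_smul (f := wt ((n:ℝ)+1)) hε]
  gcongr with x
  unfold wt ell
  apply ENNReal.ofReal_le_ofReal
  apply Real.rpow_le_rpow_of_nonpos (by positivity)
  · rw [norm_smul, Real.norm_eq_abs, abs_of_pos hε]
    linarith [one_le_e]
  · have : (0:ℝ) ≤ n := Nat.cast_nonneg n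
    linarith

lemma exists_B1sum {n : ℕ} (hn : 1 ≤ n) {C0 pinf p0 : ℝ} (hC0 : 0 < C0) (hp0 : 0 < p0) :
    ∃ C : ℝ, 1 ≤ C ∧ ∀ (ε : ℝ) (P : En n → ℝ), 0 < ε → LH n C0 pinf p0 ε P →
      ∀ U : En n → ℝ≥0∞, ENNReal.ofReal (ε ^ n) * ∫⁻ x, U x ^ P x ≤ 1 →
      (∀ j, bavg p0 U j < ⊤) ∧
      ENNReal.ofReal (ε ^ n) * ∑' j, ∫⁻ y in cube j, bavg p0 U j ^ P y ≤ ENNReal.ofReal C := by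
  obtain ⟨C, hC, h⟩ := exists_B1 hn (pinf := pinf) hC0 hp0
  set W := ∫⁻ x : En n, wt ((n:ℝ) + 1) x with hW
  have hWt : W < ⊤ := lintegral_wt_lt_top (by linarith)
  refine ⟨C * (1 + W.toReal + W.toReal), by nlinarith [ENNReal.toReal_nonneg (a := W)], ?_⟩
  intro ε P hε hP U hU
  refine ⟨fun j => (h ε P hε hP U hU j).1, ?_⟩
  have h1 : ∀ j, ∫⁻ y in cube j, bavg p0 U j ^ P y ≤ ENNReal.ofReal C *
      ((∫⁻ x in cube j, U x ^ P x) + (∫⁻ x in cube j, ENNReal.ofReal (ell ε x)) +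
       (∫⁻ x in cube j, ENNReal.ofReal (ell ε x))) := by
    intro j
    refine (setLIntegral_mono' (measurableSet_cube j) (h ε P hε hP U hU j).2).trans ?_
    rw [lintegral_const_mul' _ _ ENNReal.ofReal_ne_top, lintegral_add_left measurable_const]
    simp [volume_cube]
  calc _ ≤ ENNReal.ofReal (ε ^ n) * ∑' j, (ENNReal.ofReal C *
      ((∫⁻ x in cube j, U x ^ P x) + (∫⁻ x in cube j, ENNReal.ofReal (ell ε x)) +
       (∫⁻ x in cube j, ENNReal.ofReal (ell ε x)))) := by
        gcongr with j; exact h1 j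
    _ = ENNReal.ofReal C * (ENNReal.ofReal (ε ^ n) * (∫⁻ x, U x ^ P x) +
         ENNReal.ofReal (ε ^ n) * (∫⁻ x : En n, ENNReal.ofReal (ell ε x)) +
         ENNReal.ofReal (ε ^ n) * (∫⁻ x : En n, ENNReal.ofReal (ell ε x))) := by
        rw [ENNReal.tsum_mul_left, ENNReal.tsum_add, ENNReal.tsum_add, tsum_cube, tsum_cube]
        ring
    _ ≤ ENNReal.ofReal C * (1 + W + W) := by
        gcongr
        · exact lintegral_ell_le hε
        · exact lintegral_ell_le hε
    _ = _ := by
        rw [ENNReal.ofReal_mul (by linarith), ENNReal.ofReal_add (by positivity) (by positivity),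
          ENNReal.ofReal_add (by positivity) (by positivity), ENNReal.ofReal_toReal hWt.ne]
        simp

end

noncomputable section
open MeasureTheory Real Set
open scoped ENNReal NNReal

/-- weight with scale -/
def W1 (n : ℕ) (p0 r d : ℝ) : ℝ :=
  (r ^ (-p0)) * (1 + r ^ (-(p0 / n)) * d) ^ (-((n:ℝ) * ((1 + p0) / 2) / p0))

lemma W1_bound {n : ℕ} (hn : 1 ≤ n) {p0 : ℝ} (hp0 : 0 < p0) {r d : ℝ} (hr : 1 ≤ r)
    (hd : 0 ≤ d) :
    r ^ (-p0) * (min 1 (r * (1 + d) ^ (-((n:ℝ)/p0)))) ^ ((1 + p0)/2) ≤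
      2 ^ ((n:ℝ) * ((1 + p0) / 2) / p0) * W1 n p0 r d := by
  have hn' : (1:ℝ) ≤ n := by exact_mod_cast hn
  have hr0 : 0 < r := by linarith
  unfold W1
  set θ := (1 + p0)/2 with hθ
  set γ := (n:ℝ) * θ / p0 with hγ
  have hθ0 : 0 < θ := by positivity
  have hγ0 : 0 < γ := by positivity
  set s := r * (1 + d) ^ (-((n:ℝ)/p0)) with hs
  have hs0 : 0 < s := by positivity
  set q := r ^ (-(p0 / n)) with hq
  have hq0 : 0 < q := by positivity
  have hsq : s ^ θ = (q * (1 + d)) ^ (-γ) := by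
    rw [hs, Real.mul_rpow (by positivity) (by positivity), Real.mul_rpow (by positivity) (by positivity),
      hq, ← Real.rpow_mul (by positivity), ← Real.rpow_mul (by positivity)]
    congr 2
    · rw [hγ]; field_simp
    · rw [hγ]; field_simp
  have key : (min 1 s) ^ θ ≤ 2 ^ γ * (1 + q * d) ^ (-γ) := by
    have e : 2 ^ γ * (1 + q * d) ^ (-γ) = ((1 + q * d)/2) ^ (-γ) := by
      rw [Real.div_rpow (by positivity) (by norm_num), Real.rpow_neg (by norm_num : (0:ℝ) ≤ 2)]
      field_simp
    rw [e]
    by_cases h : q * d ≤ 1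
    · calc (min 1 s) ^ θ ≤ 1 := Real.rpow_le_one (by positivity) (min_le_left _ _) hθ0.le
        _ ≤ _ := Real.one_le_rpow_of_pos_of_le_one_of_nonpos (by positivity) (by linarith) (by linarith)
    · push Not at h
      calc (min 1 s) ^ θ ≤ s ^ θ := by
            apply Real.rpow_le_rpow (by positivity) (min_le_right _ _) hθ0.le
        _ = _ := hsq
        _ ≤ _ := by
          apply Real.rpow_le_rpow_of_nonpos (by positivity) _ (by linarith)
          nlinarith
  calc _ ≤ r ^ (-p0) * (2 ^ γ * (1 + q * d) ^ (-γ)) := by gcongr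
    _ = _ := by ring

lemma W1_bound' {n : ℕ} {p0 : ℝ} (hp0 : 0 < p0) (hp1 : p0 < 1) {r d : ℝ} (hr : 1 ≤ r)
    (hd : 0 ≤ d) :
    r ^ (-p0) * (min 1 (r * (1 + d) ^ (-((n:ℝ)/p0)))) ^ ((1 + p0)/2) ≤ ((1 + d) ^ n)⁻¹ := by
  have hr0 : 0 < r := by linarith
  set s := r * (1 + d) ^ (-((n:ℝ)/p0)) with hs
  have hs0 : 0 < s := by positivity
  calc r ^ (-p0) * (min 1 s) ^ ((1 + p0)/2) ≤ r ^ (-p0) * s ^ p0 := by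
        gcongr
        calc (min 1 s) ^ ((1 + p0)/2) ≤ (min 1 s) ^ p0 :=
              Real.rpow_le_rpow_of_exponent_ge (by positivity) (min_le_left _ _) (by linarith)
          _ ≤ s ^ p0 := Real.rpow_le_rpow (by positivity) (min_le_right _ _) hp0.le
    _ = _ := by
        rw [hs, Real.mul_rpow (by positivity) (by positivity), ← Real.rpow_mul (by positivity),
          ← mul_assoc, ← Real.rpow_add hr0]
        have : -((n:ℝ)/p0) * p0 = -(n:ℝ) := by field_simp
        rw [this, Real.rpow_neg (by positivity), Real.rpow_natCast]; simp

lemma young_simple {p0 a v : ℝ} (hp0 : 0 < p0) (hp1 : p0 < 1) (ha : 0 < a) (hv : 0 < v) :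
    a ^ (p0/2) * v ≤ a + v ^ (1/(1 - p0/2)) := by
  have h1 : 0 < 1 - p0/2 := by linarith
  set κ := 1/(1 - p0/2) with hκ
  have hκ0 : 0 < κ := by positivity
  have hvk : v = (v ^ κ) ^ (1 - p0/2) := by
    rw [← Real.rpow_mul hv.le, hκ, one_div_mul_cancel h1.ne', Real.rpow_one]
  have hk0 : 0 < v ^ κ := by positivity
  by_cases h : v ^ κ ≤ a
  · have : a ^ (p0/2) * v ≤ a := by
      calc a ^ (p0/2) * v = a ^ (p0/2) * (v ^ κ) ^ (1 - p0/2) := by rw [← hvk]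
        _ ≤ a ^ (p0/2) * a ^ (1 - p0/2) := by gcongr
        _ = a := by rw [← Real.rpow_add ha]; simp
    linarith
  · push Not at h
    have : a ^ (p0/2) * v ≤ v ^ κ := by
      calc a ^ (p0/2) * v = a ^ (p0/2) * (v ^ κ) ^ (1 - p0/2) := by rw [← hvk]
        _ ≤ (v ^ κ) ^ (p0/2) * (v ^ κ) ^ (1 - p0/2) := by gcongr
        _ = v ^ κ := by rw [← Real.rpow_add hk0]; simp
    linarith

set_option maxHeartbeats 1000000 in
/-- `a ≤ 1` case -/
lemma exists_pwA {n : ℕ} (hn : 1 ≤ n) {C0 pinf p0 : ℝ} (hC0 : 0 < C0) (hp0 : 0 < p0)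
    (hp1 : p0 < 1) :
    ∃ C : ℝ, 1 ≤ C ∧ ∀ (ε : ℝ) (P : En n → ℝ), 0 < ε → LH n C0 pinf p0 ε P →
      ∀ (j : Fin n → ℤ) (x y : En n), y ∈ cube j → ∀ (a β : ℝ), 0 < β → β ≤ a → a ≤ 1 →
        β ^ P x * min 1 (a / β * (1 + ‖x - lat j‖) ^ (-((n:ℝ)/p0))) ≤
          C * ((a ^ P y + ell ε y) * W1 n p0 (a/β) ‖x - lat j‖ +
            ell ε x * (min ε 1) ^ n * (a ^ P y +
              (1 + min ε 1 * ‖x - lat j‖) ^ (-((n:ℝ) * (1/(1 - p0/2)))))) := by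
  obtain ⟨C, hC, hV⟩ := exists_V1 (n := n) (pinf := pinf) hC0 hp0
  set G : ℝ := 2 ^ ((n:ℝ) * ((1 + p0) / 2) / p0) with hG
  have hG1 : 1 ≤ G := Real.one_le_rpow (by norm_num) (by positivity)
  set L : ℝ := (2 + (n:ℝ)) ^ ((n:ℝ) + 1) with hL
  have hL1 : 1 ≤ L := Real.one_le_rpow (by
    have : (0:ℝ) ≤ n := Nat.cast_nonneg n
    linarith) (by positivity)
  have h2n : (1:ℝ) ≤ 2 ^ n := one_le_pow₀ (by norm_num)
  refine ⟨C * G + L * G + 2 ^ n, by nlinarith, ?_⟩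
  intro ε P hε hP j x y hy a β hβ hβa ha1
  have ha : 0 < a := hβ.trans_le hβa
  set d := ‖x - lat j‖ with hd
  have hd0 : 0 ≤ d := norm_nonneg _
  set r := a/β with hr
  have hr1 : 1 ≤ r := by rw [hr, le_div_iff₀ hβ]; linarith
  have hr0 : 0 < r := by linarith
  set m := min 1 (r * (1 + d) ^ (-((n:ℝ)/p0))) with hm
  have hm0 : 0 < m := by positivity
  have hm1 : m ≤ 1 := min_le_left _ _
  set w := r ^ (-p0) * m ^ ((1 + p0)/2) with hw
  have hw0 : 0 < w := by positivity
  have hwW : w ≤ G * W1 n p0 r d := W1_bound hn hp0 hr1 hd0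
  have hwD : w ≤ ((1 + d) ^ n)⁻¹ := W1_bound' hp0 hp1 hr1 hd0
  have hW0 : 0 ≤ W1 n p0 r d := by unfold W1; positivity
  have hh : β ^ P x * m ≤ a ^ P x * w := by
    have e1 : β = a * r⁻¹ := by rw [hr]; field_simp
    have e2 : β ^ P x = a ^ P x * (r⁻¹) ^ P x := by
      conv_lhs => rw [e1]
      rw [Real.mul_rpow (by positivity) (by positivity)]
    rw [e2, hw, mul_assoc]
    gcongr
    · rw [Real.inv_rpow hr0.le, ← Real.rpow_neg hr0.le]
      exact Real.rpow_le_rpow_of_exponent_le hr1 (by linarith [hP.lo x])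
    · calc m = m ^ (1:ℝ) := by simp
        _ ≤ _ := Real.rpow_le_rpow_of_exponent_ge hm0 hm1 (by linarith)
  have hv := hV ε P hε hP x y a ha.le ha1
  have hlx := ell_pos hε x
  have hly := ell_pos hε y
  set A := a ^ P y with hA
  have hA0 : 0 < A := by positivity
  have haA : a ≤ A := by
    calc a = a ^ (1:ℝ) := by simp
      _ ≤ _ := Real.rpow_le_rpow_of_exponent_ge ha ha1 (hP.hi y)
  set ε' := min ε 1 with hε'
  have hε'0 : 0 < ε' := by positivity
  have hε'1 : ε' ≤ 1 := min_le_right _ _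
  set κ := 1/(1 - p0/2) with hκ
  set W3 := (1 + ε' * d) ^ (-((n:ℝ) * κ)) with hW3
  have hW30 : 0 < W3 := by positivity
  have hpa : a ^ (p0/2) ≤ 1 := Real.rpow_le_one ha.le ha1 (by positivity)
  have hpa0 : 0 < a ^ (p0/2) := by positivity
  have err : ell ε x * a ^ (p0/2) * w ≤ L * G * (ell ε y * W1 n p0 r d) +
      2 ^ n * (ell ε x * ε' ^ n * (A + W3)) := by
    by_cases hc : ε < 1 ∧ ε * d < 1
    · have h1 : ell ε x ≤ L * ell ε y := by
        unfold ell
        have hb := one_le_base hε x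
        have hny : ‖y‖ ≤ ‖x‖ + d + n := by
          have : y = x - (x - lat j) + (y - lat j) := by abel
          calc ‖y‖ = ‖x - (x - lat j) + (y - lat j)‖ := by rw [← this]
            _ ≤ ‖x‖ + ‖x - lat j‖ + ‖y - lat j‖ :=
              (norm_add_le _ _).trans (by gcongr; exact norm_sub_le _ _)
            _ ≤ _ := by gcongr; exact norm_cube hy
        have h2 : Real.exp 1 + ε * ‖y‖ ≤ (2 + n) * (Real.exp 1 + ε * ‖x‖) := by
          have : ε * ‖y‖ ≤ ε * ‖x‖ + ε * d + ε * n := by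
            calc _ ≤ ε * (‖x‖ + d + n) := by gcongr
              _ = _ := by ring
          have hn0 : (0:ℝ) ≤ n := Nat.cast_nonneg n
          have : ε * n ≤ n := by nlinarith [hc.1]
          nlinarith [hc.2]
        have hby := one_le_base hε y
        calc (Real.exp 1 + ε * ‖x‖) ^ (-((n:ℝ)+1)) = L * ((2 + n) * (Real.exp 1 + ε * ‖x‖)) ^ (-((n:ℝ)+1)) := by
              rw [Real.mul_rpow (by positivity) (by positivity), hL, ← mul_assoc, ← Real.rpow_add (by positivity)]
              simp
          _ ≤ _ := by
              gcongr ?_ * ?_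
              apply Real.rpow_le_rpow_of_nonpos (by linarith) h2
              have hn0 : (0:ℝ) ≤ n := Nat.cast_nonneg n
              linarith
      have e : ell ε x * a ^ (p0/2) * w ≤ L * G * (ell ε y * W1 n p0 r d) := by
        calc _ ≤ (L * ell ε y) * 1 * (G * W1 n p0 r d) := by gcongr
          _ = _ := by ring
      have : 0 ≤ 2 ^ n * (ell ε x * ε' ^ n * (A + W3)) := by positivity
      linarith
    · have hD : ((1 + d) ^ n)⁻¹ ≤ 2 ^ n * ε' ^ n * ((1 + ε' * d) ^ n)⁻¹ := by
        have hb : (1 + ε' * d) ≤ 2 * ε' * (1 + d) := by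
          by_cases h1 : ε < 1
          · have e : ε' = ε := min_eq_left h1.le
            have h2 : 1 ≤ ε * d := by
              by_contra h; push Not at h; exact hc ⟨h1, h⟩
            rw [e]; nlinarith
          · push Not at h1
            have e : ε' = 1 := min_eq_right h1
            rw [e]; linarith
        have : (1 + ε' * d) ^ n ≤ 2 ^ n * ε' ^ n * (1 + d) ^ n := by
          rw [← mul_pow, ← mul_pow]; gcongr
        rw [← div_eq_mul_inv, le_div_iff₀ (by positivity), inv_mul_le_iff₀ (by positivity)]
        linarith
      have hy1 := young_simple (p0 := p0) (a := a) (v := ((1 + ε' * d) ^ n)⁻¹) hp0 hp1 ha (by positivity)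
      have e3 : (((1 + ε' * d) ^ n)⁻¹) ^ (1/(1-p0/2)) = W3 := by
        rw [hW3, ← Real.rpow_natCast, ← Real.rpow_neg (by positivity), ← Real.rpow_mul (by positivity)]
        congr 1; ring
      rw [e3] at hy1
      have e : ell ε x * a ^ (p0/2) * w ≤ 2 ^ n * (ell ε x * ε' ^ n * (A + W3)) := by
        calc _ ≤ ell ε x * a ^ (p0/2) * (2 ^ n * ε' ^ n * ((1 + ε' * d) ^ n)⁻¹) := by
              gcongr; exact hwD.trans hD
          _ = 2 ^ n * (ell ε x * ε' ^ n * (a ^ (p0/2) * ((1 + ε' * d) ^ n)⁻¹)) := by ring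
          _ ≤ _ := by gcongr; linarith
      have : 0 ≤ L * G * (ell ε y * W1 n p0 r d) := by positivity
      linarith
  have t1 : β ^ P x * m ≤ C * (A + ell ε y) * (G * W1 n p0 r d) + ell ε x * a ^ (p0/2) * w := by
    calc _ ≤ a ^ P x * w := hh
      _ ≤ (C * (A + ell ε y) + ell ε x * a ^ (p0/2)) * w := by gcongr
      _ = C * (A + ell ε y) * w + ell ε x * a ^ (p0/2) * w := by ring
      _ ≤ _ := by gcongr
  have p1 : 0 ≤ A * W1 n p0 r d := by positivity
  have p2 : 0 ≤ ell ε y * W1 n p0 r d := by positivity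
  have p3 : 0 ≤ ell ε x * ε' ^ n * (A + W3) := by positivity
  have p4 : 0 ≤ C * G := by positivity
  have p5 : 0 ≤ L * G := by positivity
  set E := ell ε x * ε' ^ n * (A + W3) with hE
  set W := W1 n p0 r d with hWdef
  have rest : 0 ≤ C * G * E + L * G * (A * W) + L * G * E + 2 ^ n * ((A + ell ε y) * W) := by
    positivity
  have expand : (C * G + L * G + 2 ^ n) * ((A + ell ε y) * W + E) =
      C * (A + ell ε y) * (G * W) + (L * G * (ell ε y * W) + 2 ^ n * E) +
      (C * G * E + L * G * (A * W) + L * G * E + 2 ^ n * ((A + ell ε y) * W)) := by ring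
  rw [expand]
  linarith

set_option maxHeartbeats 1000000 in
/-- `1 < a` case -/
lemma exists_pwB {n : ℕ} (hn : 1 ≤ n) {C0 pinf p0 K : ℝ} (hC0 : 0 < C0) (hp0 : 0 < p0)
    (hp1 : p0 < 1) (hK : 1 ≤ K) :
    ∃ C : ℝ, 1 ≤ C ∧ ∀ (ε : ℝ) (P : En n → ℝ), 0 < ε → LH n C0 pinf p0 ε P →
      ∀ (j : Fin n → ℤ) (x y : En n), y ∈ cube j → ∀ (a β : ℝ), 0 < β → β ≤ a → 1 < a →
        ε ^ n * a ^ p0 ≤ K →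
        β ^ P x * min 1 (a / β * (1 + ‖x - lat j‖) ^ (-((n:ℝ)/p0))) ≤
          C * (a ^ P y * W1 n p0 (a/β) ‖x - lat j‖ +
            a ^ P y * (ε ^ n * (1 + ε * ‖x - lat j‖) ^ (-((n:ℝ)/p0)))) := by
  have hn' : (1:ℝ) ≤ n := by exact_mod_cast hn
  set G : ℝ := 2 ^ ((n:ℝ) * ((1 + p0) / 2) / p0) with hG
  have hG1 : 1 ≤ G := Real.one_le_rpow (by norm_num) (by positivity)
  set k := (n:ℝ)/p0 with hk
  have hk0 : 0 < k := by positivity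
  set K' := K ^ (1/p0) with hK'
  have hK'1 : 1 ≤ K' := Real.one_le_rpow hK (by positivity)
  set M := K' * ((1 + n) * Real.exp C0) ^ k with hM
  have hM1 : 1 ≤ M := by
    have : (1:ℝ) ≤ ((1 + n) * Real.exp C0) ^ k := Real.one_le_rpow (by
      have := Real.one_le_exp hC0.le
      nlinarith) hk0.le
    nlinarith
  set c1 := Real.exp (2 * C0 / (1 - p0)) * (1 + n) + 1 with hc1
  have hc10 : 1 ≤ c1 := by rw [hc1]; have : 0 < Real.exp (2 * C0 / (1 - p0)) * (1 + n) := by positivity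
                           linarith
  set N := K' * c1 ^ k with hN
  have hN1 : 1 ≤ N := by
    have : (1:ℝ) ≤ c1 ^ k := Real.one_le_rpow hc10 hk0.le
    nlinarith
  refine ⟨M * G + N, by nlinarith, ?_⟩
  intro ε P hε hP j x y hy a β hβ hβa ha1 haK
  have ha : 0 < a := by linarith
  set d := ‖x - lat j‖ with hd
  have hd0 : 0 ≤ d := norm_nonneg _
  set r := a/β with hr
  have hr1 : 1 ≤ r := by rw [hr, le_div_iff₀ hβ]; linarith
  have hr0 : 0 < r := by linarith
  set s := r * (1 + d) ^ (-k) with hs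
  have hs0 : 0 < s := by positivity
  set m := min 1 s with hm
  have hm0 : 0 < m := by positivity
  have hm1 : m ≤ 1 := min_le_left _ _
  have hms : m ≤ s := min_le_right _ _
  set θ := (1 + p0)/2 with hθ
  set w := r ^ (-p0) * m ^ θ with hw
  have hw0 : 0 < w := by positivity
  have hwW : w ≤ G * W1 n p0 r d := W1_bound hn hp0 hr1 hd0
  have hW0 : 0 ≤ W1 n p0 r d := by unfold W1; positivity
  set A := a ^ P y with hA
  have hA0 : 0 < A := by positivity
  set W2 := ε ^ n * (1 + ε * d) ^ (-k) with hW2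
  have hW20 : 0 < W2 := by positivity
  have hmθ : m ≤ m ^ θ := by
    calc m = m ^ (1:ℝ) := by simp
        _ ≤ _ := Real.rpow_le_rpow_of_exponent_ge hm0 hm1 (by linarith)
  have hβq : ∀ q, p0 ≤ q → β ^ q ≤ a ^ q * r ^ (-p0) := by
    intro q hq
    have e1 : β = a * r⁻¹ := by rw [hr]; field_simp
    have e2 : β ^ q = a ^ q * (r⁻¹) ^ q := by
      conv_lhs => rw [e1]
      rw [Real.mul_rpow (by positivity) (by positivity)]
    rw [e2]
    gcongr
    rw [Real.inv_rpow hr0.le, ← Real.rpow_neg hr0.le]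
    exact Real.rpow_le_rpow_of_exponent_le hr1 (by linarith)
  have aK : a ≤ K' * ε ^ (-k) := by
    have : a = (a ^ p0) ^ (1/p0) := by
      rw [← Real.rpow_mul ha.le]; field_simp; simp
    rw [this]
    have h1 : a ^ p0 ≤ K * ε ^ (-(n:ℝ)) := by
      rw [Real.rpow_neg hε.le, Real.rpow_natCast, ← div_eq_mul_inv, le_div_iff₀ (by positivity)]
      linarith
    calc _ ≤ (K * ε ^ (-(n:ℝ))) ^ (1/p0) := by gcongr
      _ = _ := by
        rw [Real.mul_rpow (by positivity) (by positivity), ← Real.rpow_mul hε.le]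
        congr 2; rw [hk]; ring
  have hxy : ε * ‖x - y‖ ≤ (1 + n) * (ε * (1 + d)) := by
    have h1 : ‖x - y‖ ≤ d + n := by
      have : x - y = (x - lat j) - (y - lat j) := by abel
      rw [this]
      have := norm_sub_le (x - lat j) (y - lat j)
      linarith [norm_cube hy]
    calc _ ≤ ε * (d + n) := by gcongr
      _ ≤ ε * ((1 + n) * (1 + d)) := by gcongr; nlinarith
      _ = _ := by ring
  have case1 : β ^ P x * m ≤ M * (A * w) → β ^ P x * m ≤ (M * G + N) * (A * W1 n p0 r d + A * W2) := by
    intro h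
    have p1 : 0 ≤ A * W1 n p0 r d := by positivity
    have p2 : 0 ≤ A * W2 := by positivity
    have : M * (A * w) ≤ M * G * (A * W1 n p0 r d) := by
      calc M * (A * w) ≤ M * (A * (G * W1 n p0 r d)) := by gcongr
        _ = _ := by ring
    have p3 : 0 ≤ M * G * (A * W2) := by positivity
    have p4 : 0 ≤ N * (A * W1 n p0 r d) := by positivity
    have p5 : 0 ≤ N * (A * W2) := by positivity
    have expand : (M * G + N) * (A * W1 n p0 r d + A * W2) = M * G * (A * W1 n p0 r d) +
      M * G * (A * W2) + N * (A * W1 n p0 r d) + N * (A * W2) := by ring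
    rw [expand]
    linarith
  by_cases hPP : P x ≤ P y
  · apply case1
    have : β ^ P x * m ≤ A * w := by
      calc _ ≤ (a ^ P x * r ^ (-p0)) * m ^ θ := by gcongr; exact hβq _ (hP.lo x)
        _ ≤ (a ^ P y * r ^ (-p0)) * m ^ θ := by gcongr; exact ha1.le
        _ = _ := by rw [hA, hw]; ring
    exact this.trans (le_mul_of_one_le_left (by positivity) hM1)
  push Not at hPP
  by_cases hβ1 : β ≤ 1
  · apply case1
    have : β ^ P x * m ≤ A * w := by
      calc _ ≤ β ^ P y * m ^ θ := by
            gcongr ?_ * ?_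
            · exact Real.rpow_le_rpow_of_exponent_ge hβ hβ1 hPP.le
        _ ≤ (a ^ P y * r ^ (-p0)) * m ^ θ := by gcongr; exact hβq _ (hP.lo y)
        _ = _ := by rw [hA, hw]; ring
    exact this.trans (le_mul_of_one_le_left (by positivity) hM1)
  push Not at hβ1
  set Δ := P x - P y with hΔ
  have hΔ0 : 0 < Δ := by rw [hΔ]; linarith
  have hΔ1 : Δ ≤ 1 := by rw [hΔ]; linarith [hP.hi x, hP.lo y]
  have habs : |P x - P y| = Δ := abs_of_pos hΔ0
  have hDp : 0 < ε * (1 + d) := by positivity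
  have has : a * (1 + d) ^ (-k) ≤ K' * (1/(ε * (1 + d))) ^ k := by
    calc _ ≤ (K' * ε ^ (-k)) * (1 + d) ^ (-k) := by gcongr
      _ = _ := by
        rw [one_div, Real.inv_rpow hDp.le, ← Real.rpow_neg hDp.le, Real.mul_rpow hε.le (by positivity)]
        ring
  have hτ := V2' hC0 hε hP x y ((1 + n) * (ε * (1 + d))) (by positivity) hxy
  rw [habs] at hτ
  by_cases hΔs : Δ ≤ (1 - p0)/2
  · apply case1
    have e1 : (a * (1 + d) ^ (-k)) ^ Δ ≤ M := by
      have h3 : (1/(ε * (1 + d))) ^ Δ ≤ (1 + n) * Real.exp C0 := by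
        have : (1/(ε * (1 + d))) = (1 + n) * (1 / ((1 + n) * (ε * (1 + d)))) := by field_simp
        rw [this, Real.mul_rpow (by positivity) (by positivity)]
        have h3 : (1 + (n:ℝ)) ^ Δ ≤ 1 + n := by
          calc (1 + (n:ℝ)) ^ Δ ≤ (1 + (n:ℝ)) ^ (1:ℝ) :=
                Real.rpow_le_rpow_of_exponent_le (by linarith) hΔ1
            _ = _ := by simp
        gcongr
      calc _ ≤ (K' * (1/(ε * (1 + d))) ^ k) ^ Δ := by gcongr
        _ = K' ^ Δ * ((1/(ε * (1 + d))) ^ Δ) ^ k := by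
          rw [Real.mul_rpow (by positivity) (by positivity), ← Real.rpow_mul (by positivity) k Δ,
            ← Real.rpow_mul (by positivity) Δ k, mul_comm k]
        _ ≤ K' * ((1 + n) * Real.exp C0) ^ k := by
          gcongr
          calc K' ^ Δ ≤ K' ^ (1:ℝ) := Real.rpow_le_rpow_of_exponent_le hK'1 hΔ1
            _ = _ := by simp
        _ = _ := rfl
    have e2 : m ≤ s ^ Δ * m ^ θ := by
      calc m = m ^ Δ * m ^ (1 - Δ) := by rw [← Real.rpow_add hm0]; simp
        _ ≤ s ^ Δ * m ^ θ := by
          gcongr ?_ * ?_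
          · exact Real.rpow_le_rpow hm0.le hms hΔ0.le
          · exact Real.rpow_le_rpow_of_exponent_ge hm0 hm1 (by linarith)
    have e3 : β ^ P x = β ^ P y * β ^ Δ := by rw [← Real.rpow_add hβ]; congr 1; rw [hΔ]; ring
    have e4 : β * s = a * (1 + d) ^ (-k) := by rw [hs, hr]; field_simp
    calc β ^ P x * m ≤ (β ^ P y * β ^ Δ) * (s ^ Δ * m ^ θ) := by rw [e3]; gcongr
      _ = β ^ P y * (β * s) ^ Δ * m ^ θ := by
        rw [Real.mul_rpow hβ.le hs0.le]; ring
      _ ≤ (a ^ P y * r ^ (-p0)) * M * m ^ θ := by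
        rw [e4]; gcongr; exact hβq _ (hP.lo y)
      _ = _ := by rw [hA, hw]; ring
  · push Not at hΔs
    have h1 : β ^ P x * m ≤ a * (1 + d) ^ (-k) := by
      calc _ ≤ β ^ (1:ℝ) * s := by
            gcongr ?_ * ?_
            exact Real.rpow_le_rpow_of_exponent_le hβ1.le (hP.hi x)
        _ = _ := by rw [hs, hr, Real.rpow_one]; field_simp
    have h2 : a ≤ A * (K' * ε ^ (n:ℝ) * ε ^ (-k)) := by
      have : a = A * a ^ (1 - P y) := by rw [hA, ← Real.rpow_add ha]; simp
      rw [this]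
      gcongr
      calc a ^ (1 - P y) ≤ a ^ (1 - p0) := Real.rpow_le_rpow_of_exponent_le ha1.le (by linarith [hP.lo y])
        _ ≤ (K' * ε ^ (-k)) ^ (1 - p0) := by gcongr
        _ = K' ^ (1 - p0) * (ε ^ (n:ℝ) * ε ^ (-k)) := by
          rw [Real.mul_rpow (by positivity) (by positivity), ← Real.rpow_mul hε.le, ← Real.rpow_add hε]
          congr 2; rw [hk]; field_simp; try ring
        _ ≤ K' * (ε ^ (n:ℝ) * ε ^ (-k)) := by
          gcongr
          calc K' ^ (1 - p0) ≤ K' ^ (1:ℝ) := Real.rpow_le_rpow_of_exponent_le hK'1 (by linarith)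
            _ = _ := by simp
        _ = _ := by ring
    have h3 := V2 hC0 hε hP x y ((1 + n) * (ε * (1 + d))) (by positivity) hxy
    rw [habs] at h3
    have h4 : Real.log (1/((1 + n) * (ε * (1 + d)))) ≤ 2 * C0/(1 - p0) := by
      rw [le_div_iff₀ (by linarith)]
      by_cases hneg : Real.log (1/((1 + n) * (ε * (1 + d)))) ≤ 0
      · nlinarith
      · push Not at hneg
        nlinarith
    rw [Real.log_le_iff_le_exp (by positivity)] at h4
    have h5 : 1 ≤ Real.exp (2 * C0 / (1 - p0)) * (1 + n) * (ε * (1 + d)) := by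
      rw [div_le_iff₀ (by positivity)] at h4
      linarith
    have h6 : 1 + ε * d ≤ c1 * (ε * (1 + d)) := by rw [hc1]; nlinarith
    have h7 : (ε * (1 + d)) ^ (-k) ≤ c1 ^ k * (1 + ε * d) ^ (-k) := by
      calc (ε * (1 + d)) ^ (-k) = c1 ^ k * (c1 * (ε * (1 + d))) ^ (-k) := by
            rw [Real.mul_rpow (by positivity) hDp.le, ← mul_assoc, ← Real.rpow_add (by positivity)]; simp
        _ ≤ _ := by
            gcongr ?_ * ?_
            exact Real.rpow_le_rpow_of_nonpos (by positivity) h6 (by linarith)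
    have h8 : β ^ P x * m ≤ N * (A * W2) := by
      calc _ ≤ (A * (K' * ε ^ (n:ℝ) * ε ^ (-k))) * (1 + d) ^ (-k) := by
            refine h1.trans ?_; gcongr
        _ = A * K' * ε ^ n * (ε * (1 + d)) ^ (-k) := by
            rw [Real.mul_rpow hε.le (by positivity), Real.rpow_natCast]; ring
        _ ≤ A * K' * ε ^ n * (c1 ^ k * (1 + ε * d) ^ (-k)) := by gcongr
        _ = _ := by rw [hN, hW2]; ring
    have p1 : 0 ≤ A * W1 n p0 r d := by positivity
    have p2 : 0 ≤ A * W2 := by positivity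
    have p3 : 0 ≤ M * G * (A * W2) := by positivity
    have p4 : 0 ≤ N * (A * W1 n p0 r d) := by positivity
    have p5 : 0 ≤ M * G * (A * W1 n p0 r d) := by positivity
    have expand : (M * G + N) * (A * W1 n p0 r d + A * W2) = M * G * (A * W1 n p0 r d) +
      M * G * (A * W2) + N * (A * W1 n p0 r d) + N * (A * W2) := by ring
    rw [expand]
    linarith

end

noncomputable section
open MeasureTheory Real Set
open scoped ENNReal NNReal

lemma W1_nonneg {n : ℕ} {p0 r d : ℝ} (hr : 0 < r) (hd : 0 ≤ d) : 0 ≤ W1 n p0 r d := by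
  unfold W1; positivity

lemma lint3 {n : ℕ} {μ : Measure (En n)} {f g h : En n → ℝ≥0∞} (hf : Measurable f)
    (hg : Measurable g) :
    ∫⁻ x, (f x + g x + h x) ∂μ = (∫⁻ x, f x ∂μ) + (∫⁻ x, g x ∂μ) + ∫⁻ x, h x ∂μ := by
  rw [lintegral_add_left (f := fun x => f x + g x) (hf.add hg), lintegral_add_left hf]

/-- combined pointwise bound -/
lemma exists_pw {n : ℕ} (hn : 1 ≤ n) {C0 pinf p0 K : ℝ} (hC0 : 0 < C0) (hp0 : 0 < p0)
    (hp1 : p0 < 1) (hK : 1 ≤ K) :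
    ∃ C : ℝ, 1 ≤ C ∧ ∀ (ε : ℝ) (P : En n → ℝ), 0 < ε → LH n C0 pinf p0 ε P →
      ∀ (j : Fin n → ℤ) (a β : ℝ), 0 < β → 0 < a → (1 < a → ε ^ n * a ^ p0 ≤ K) → ∃ r : ℝ, 0 < r ∧
      ∀ (x y : En n), y ∈ cube j → 
        β ^ P x * min 1 (a / β * (1 + ‖x - lat j‖) ^ (-((n:ℝ)/p0))) ≤
          C * ((a ^ P y + ell ε y) * W1 n p0 r ‖x - lat j‖ +
            a ^ P y * (ε ^ n * (1 + ε * ‖x - lat j‖) ^ (-((n:ℝ)/p0))) +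
            ell ε x * (min ε 1) ^ n * (a ^ P y +
              (1 + min ε 1 * ‖x - lat j‖) ^ (-((n:ℝ) * (1/(1 - p0/2)))))) := by
  obtain ⟨C1, hC1, h1⟩ := exists_pwA hn (pinf := pinf) hC0 hp0 hp1
  obtain ⟨C2, hC2, h2⟩ := exists_pwB hn (pinf := pinf) hC0 hp0 hp1 hK
  refine ⟨max C1 C2, le_max_of_le_left hC1, ?_⟩
  intro ε P hε hP j a β hβ ha haK
  refine ⟨a / min β a, by positivity, ?_⟩
  intro x y hy
  have hlx := ell_pos hε x
  have hly := ell_pos hε y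
  have hd0 : 0 ≤ ‖x - lat j‖ := norm_nonneg _
  set d := ‖x - lat j‖ with hd
  set k := (n:ℝ)/p0 with hk
  have hred : β ^ P x * min 1 (a / β * (1 + d) ^ (-k)) ≤
      (min β a) ^ P x * min 1 (a / (min β a) * (1 + d) ^ (-k)) := by
    by_cases hc : β ≤ a
    · rw [min_eq_left hc]
    · push Not at hc
      rw [min_eq_right hc.le, div_self ha.ne', one_mul]
      have hD : (1 + d) ^ (-k) ≤ 1 := 
        Real.rpow_le_one_of_one_le_of_nonpos (by linarith) (by rw [hk]; simp; positivity)
      rw [min_eq_right hD]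
      have hD0 : 0 < (1 + d) ^ (-k) := by positivity
      calc _ ≤ β ^ P x * (a / β * (1 + d) ^ (-k)) := by gcongr; exact min_le_right _ _
        _ = a * β ^ (P x - 1) * (1 + d) ^ (-k) := by
          rw [Real.rpow_sub hβ, Real.rpow_one]; ring
        _ ≤ a * a ^ (P x - 1) * (1 + d) ^ (-k) := by
          gcongr ?_ * ?_ * ?_
          exact Real.rpow_le_rpow_of_nonpos ha hc.le (by linarith [hP.hi x])
        _ = _ := by
          rw [Real.rpow_sub ha, Real.rpow_one]; field_simp
  refine hred.trans ?_
  have hm0 : 0 < min β a := by positivity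
  have hma : min β a ≤ a := min_le_right _ _
  have hW : 0 ≤ W1 n p0 (a / min β a) d := W1_nonneg (by positivity) hd0
  by_cases ha1 : a ≤ 1
  · refine (h1 ε P hε hP j x y hy a (min β a) hm0 hma ha1).trans ?_
    gcongr
    · exact le_max_left _ _
    · rw [← hd]
      have : 0 ≤ a ^ P y * (ε ^ n * (1 + ε * d) ^ (-k)) := by positivity
      linarith
  · push Not at ha1
    refine (h2 ε P hε hP j x y hy a (min β a) hm0 hma ha1 (haK ha1)).trans ?_
    have hx : 0 ≤ ell ε x * (min ε 1) ^ n * (a ^ P y + (1 + min ε 1 * d) ^ (-((n:ℝ) * (1/(1 - p0/2))))) := by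
      positivity
    have hx2 : 0 ≤ ell ε y * W1 n p0 (a / min β a) d := by positivity
    have hx3 : 0 ≤ a ^ P y * W1 n p0 (a / min β a) d := by positivity
    gcongr ?_ * ?_
    · exact le_max_right _ _
    · rw [← hd]; nlinarith

/-- ENNReal form -/
lemma exists_pwE {n : ℕ} (hn : 1 ≤ n) {C0 pinf p0 K : ℝ} (hC0 : 0 < C0) (hp0 : 0 < p0)
    (hp1 : p0 < 1) (hK : 1 ≤ K) :
    ∃ C : ℝ, 1 ≤ C ∧ ∀ (ε : ℝ) (P : En n → ℝ), 0 < ε → LH n C0 pinf p0 ε P →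
      ∀ (j : Fin n → ℤ) (b : ℝ≥0∞) (β : ℝ), 0 < β → b ≠ ⊤ → b ≠ 0 →
        (1 < b → ENNReal.ofReal (ε ^ n) * b ^ p0 ≤ ENNReal.ofReal K) → ∃ η : ℝ, 0 < η ∧
      ∀ (x y : En n), y ∈ cube j → 
        ENNReal.ofReal (β ^ P x) * min 1 (b / ENNReal.ofReal β * wt ((n:ℝ)/p0) (x - lat j)) ≤
          ENNReal.ofReal C * ((b ^ P y + ENNReal.ofReal (ell ε y)) *
              (ENNReal.ofReal (η ^ n) * wt ((n:ℝ) * ((1 + p0) / 2) / p0) (η • (x - lat j))) +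
            b ^ P y * (ENNReal.ofReal (ε ^ n) * wt ((n:ℝ)/p0) (ε • (x - lat j))) +
            ENNReal.ofReal (ell ε x) * ENNReal.ofReal ((min ε 1) ^ n) * (b ^ P y +
              wt ((n:ℝ) * (1/(1 - p0/2))) (min ε 1 • (x - lat j)))) := by
  obtain ⟨C, hC, h⟩ := exists_pw hn (pinf := pinf) hC0 hp0 hp1 hK
  refine ⟨C, hC, ?_⟩
  intro ε P hε hP j b β hβ hbt hb0 hbK
  have hn' : (1:ℝ) ≤ n := by exact_mod_cast hn
  obtain ⟨a, ha, rfl⟩ : ∃ a : ℝ, 0 < a ∧ b = ENNReal.ofReal a :=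
    ⟨b.toReal, ENNReal.toReal_pos hb0 hbt, (ENNReal.ofReal_toReal hbt).symm⟩
  have haK : 1 < a → ε ^ n * a ^ p0 ≤ K := by
    intro ha1
    specialize hbK (by rw [← ENNReal.ofReal_one]; exact (ENNReal.ofReal_lt_ofReal_iff ha).2 ha1)
    rw [ENNReal.ofReal_rpow_of_pos ha, ← ENNReal.ofReal_mul (by positivity)] at hbK
    exact (ENNReal.ofReal_le_ofReal_iff (by linarith)).1 hbK
  obtain ⟨r, hr, hh⟩ := h ε P hε hP j a β hβ ha haK
  refine ⟨r ^ (-(p0/n)), by positivity, ?_⟩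
  intro x y hy
  have hlx := (ell_pos hε x).le
  have hly := (ell_pos hε y).le
  have hx := hh x y hy
  have hηn : (r ^ (-(p0/n))) ^ n = r ^ (-p0) := by
    rw [← Real.rpow_natCast, ← Real.rpow_mul hr.le]; congr 1; field_simp
  have hε' : 0 < min ε 1 := by positivity
  unfold wt
  rw [norm_smul, norm_smul, norm_smul, Real.norm_of_nonneg hε.le, Real.norm_of_nonneg hε'.le,
    Real.norm_of_nonneg (by positivity : 0 ≤ r ^ (-(p0/n))), hηn]
  rw [ENNReal.ofReal_rpow_of_pos ha, ← ENNReal.ofReal_div_of_pos hβ]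
  rw [← ENNReal.ofReal_mul (by positivity), ← ENNReal.ofReal_mul (by positivity),
    ← ENNReal.ofReal_mul (by positivity), ← ENNReal.ofReal_mul (by positivity),
    ← ENNReal.ofReal_one, ← ENNReal.ofReal_min, ← ENNReal.ofReal_mul (by positivity),
    ← ENNReal.ofReal_add (by positivity) (by positivity),
    ← ENNReal.ofReal_add (by positivity) (by positivity),
    ← ENNReal.ofReal_mul (by positivity), ← ENNReal.ofReal_mul (by positivity),
    ← ENNReal.ofReal_mul (by positivity), ← ENNReal.ofReal_add (by positivity) (by positivity),
    ← ENNReal.ofReal_add (by positivity) (by positivity), ← ENNReal.ofReal_mul (by positivity)]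
  apply ENNReal.ofReal_le_ofReal
  refine hx.trans (le_of_eq ?_)
  unfold W1
  rfl

lemma exists_B2 {n : ℕ} (hn : 1 ≤ n) {C0 pinf p0 : ℝ} (hC0 : 0 < C0) (hp0 : 0 < p0)
    (hp1 : p0 < 1) :
    ∃ C : ℝ, 1 ≤ C ∧ ∀ (ε : ℝ) (P : En n → ℝ), 0 < ε → LH n C0 pinf p0 ε P → Measurable P →
      ∀ U : En n → ℝ≥0∞, ENNReal.ofReal (ε ^ n) * ∫⁻ x, U x ^ P x ≤ 1 → ∀ β : ℝ, 0 < β →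
      ENNReal.ofReal (ε ^ n) * ∑' j, ∫⁻ x, ENNReal.ofReal (β ^ P x) *
        min 1 (bavg p0 U j / ENNReal.ofReal β * wt ((n:ℝ)/p0) (x - lat j)) ≤ ENNReal.ofReal C := by
  have hn' : (1:ℝ) ≤ n := by exact_mod_cast hn
  obtain ⟨K, hK, hB⟩ := exists_B1sum hn (pinf := pinf) hC0 hp0
  obtain ⟨C, hC, h⟩ := exists_pwE hn (pinf := pinf) hC0 hp0 hp1 hK
  set γ := (n:ℝ) * ((1 + p0) / 2) / p0 with hγ
  set k := (n:ℝ)/p0 with hk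
  set κ := (n:ℝ) * (1/(1 - p0/2)) with hκ
  have hγn : (n:ℝ) < γ := by
    rw [hγ, lt_div_iff₀ hp0]; nlinarith
  have hkn : (n:ℝ) < k := by
    rw [hk, lt_div_iff₀ hp0]; nlinarith
  have hκn : (n:ℝ) < κ := by
    rw [hκ, mul_one_div, lt_div_iff₀ (by linarith)]; nlinarith
  set I0 := ∫⁻ x : En n, wt ((n:ℝ) + 1) x with hI0
  set I1 := ∫⁻ x : En n, wt γ x with hI1
  set I2 := ∫⁻ x : En n, wt k x with hI2
  set I3 := ENNReal.ofReal ((1 + n) ^ κ) * ∫⁻ x : En n, wt κ x with hI3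
  have f0 : I0 < ⊤ := lintegral_wt_lt_top (by linarith)
  have f1 : I1 < ⊤ := lintegral_wt_lt_top hγn
  have f2 : I2 < ⊤ := lintegral_wt_lt_top hkn
  have f3 : I3 < ⊤ := ENNReal.mul_lt_top ENNReal.ofReal_lt_top (lintegral_wt_lt_top hκn)
  set T := ENNReal.ofReal C * ((ENNReal.ofReal K + I0) * I1 + ENNReal.ofReal K * I2 +
    (I0 * ENNReal.ofReal K + I0 * I3)) with hT
  have fT : T ≠ ⊤ := by
    have fK := ENNReal.ofReal_ne_top (r := K)
    rw [hT]
    refine ENNReal.mul_ne_top ENNReal.ofReal_ne_top ?_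
    simp only [ne_eq, ENNReal.add_eq_top, not_or]
    refine ⟨⟨ENNReal.mul_ne_top ?_ f1.ne, ENNReal.mul_ne_top fK f2.ne⟩,
      ENNReal.mul_ne_top f0.ne fK, ENNReal.mul_ne_top f0.ne f3.ne⟩
    simp [f0.ne]
  refine ⟨1 + T.toReal, by simp, ?_⟩
  intro ε P hε hP hPm U hU β hβ
  obtain ⟨hBt, hBs⟩ := hB ε P hε hP U hU
  set b := bavg p0 U with hb
  set ε' := min ε 1 with hε'
  have hε'0 : 0 < ε' := by positivity
  have hε'1 : ε' ≤ 1 := min_le_right _ _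
  set L := ∫⁻ x : En n, ENNReal.ofReal (ell ε x) with hL
  have hLe := lintegral_ell_le (n := n) hε
  rw [← hL, ← hI0] at hLe
  have hεε : ENNReal.ofReal (ε' ^ n) ≤ ENNReal.ofReal (ε ^ n) :=
    ENNReal.ofReal_le_ofReal (by gcongr; exact min_le_left _ _)
  have hLe' : ENNReal.ofReal (ε' ^ n) * L ≤ I0 := le_trans (by gcongr) hLe
  have hA : ∀ j, Measurable fun y => b j ^ P y := fun j => hPm.const_pow _
  have hbp : ∀ j, 1 < b j → ENNReal.ofReal (ε ^ n) * b j ^ p0 ≤ ENNReal.ofReal K := by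
    intro j hb1
    refine le_trans ?_ hBs
    gcongr
    refine le_trans ?_ (ENNReal.le_tsum j)
    calc b j ^ p0 = ∫⁻ y in cube j, b j ^ p0 := by simp [volume_cube]
      _ ≤ _ := by
        apply lintegral_mono
        intro y
        exact ENNReal.rpow_le_rpow_of_exponent_le hb1.le (hP.lo y)
  have hj : ∀ j, ∫⁻ x, ENNReal.ofReal (β ^ P x) *
        min 1 (b j / ENNReal.ofReal β * wt k (x - lat j)) ≤ ENNReal.ofReal C *
      (((∫⁻ y in cube j, b j ^ P y) + ∫⁻ y in cube j, ENNReal.ofReal (ell ε y)) * I1 +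
        (∫⁻ y in cube j, b j ^ P y) * I2 +
        (ENNReal.ofReal (ε' ^ n) * L * (∫⁻ y in cube j, b j ^ P y) +
          ∫⁻ x : En n, ENNReal.ofReal (ell ε x) * (ENNReal.ofReal (ε' ^ n) * wt κ (ε' • (x - lat j))))) := by
    intro j
    by_cases hb0 : b j = 0
    · simp [hb0]
    obtain ⟨η, hη, hxy⟩ := h ε P hε hP j (b j) β hβ (hBt j).ne hb0 (hbp j)
    set H := ∫⁻ x, ENNReal.ofReal (β ^ P x) *
        min 1 (b j / ENNReal.ofReal β * wt k (x - lat j)) with hH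
    set E3 := ∫⁻ x : En n, ENNReal.ofReal (ell ε x) * (ENNReal.ofReal (ε' ^ n) * wt κ (ε' • (x - lat j))) with hE3
    have mw : ∀ (q η : ℝ), Measurable fun x : En n => wt q (η • (x - lat j)) := by
      intro q η
      exact (measurable_wt q).comp (by fun_prop)
    have ml := (measurable_ell (n := n) ε).ennreal_ofReal
    have hy : ∀ y ∈ cube j, H ≤ ENNReal.ofReal C * ((b j ^ P y + ENNReal.ofReal (ell ε y)) * I1 +
        b j ^ P y * I2 + (ENNReal.ofReal (ε' ^ n) * L * b j ^ P y + E3)) := by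
      intro y hy
      calc H ≤ _ := lintegral_mono fun x => hxy x y hy
        _ = _ := by
          rw [lintegral_const_mul' _ _ ENNReal.ofReal_ne_top]
          congr 1
          rw [lint3 (((mw _ _).const_mul _).const_mul _) (((mw _ _).const_mul _).const_mul _),
            lintegral_const_mul _ ((mw _ _).const_mul _), lintegral_const_mul _ ((mw _ _).const_mul _),
            lintegral_const_mul _ (mw _ _), lintegral_const_mul _ (mw _ _),
            lintegral_wt_smul hη, lintegral_wt_smul hε]
          congr 1
          simp only [mul_add]
          rw [lintegral_add_left ((ml.mul_const _).mul_const _), lintegral_mul_const _ (ml.mul_const _),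
            lintegral_mul_const _ ml, hE3]
          simp only [mul_assoc]
          congr 1
          rw [← hL]; ring
    calc H = ∫⁻ y in cube j, H := by simp [volume_cube]
      _ ≤ _ := setLIntegral_mono' (measurableSet_cube j) hy
      _ = _ := by
        rw [lintegral_const_mul' _ _ ENNReal.ofReal_ne_top]
        congr 1
        have mA : Measurable fun y => b j ^ P y + ENNReal.ofReal (ell ε y) := (hA j).add ml
        rw [lint3 (mA.mul_const _) ((hA j).mul_const _),
          lintegral_mul_const _ mA, lintegral_mul_const _ (hA j),
          lintegral_add_left (hA j), lintegral_add_left ((hA j).const_mul _),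
          lintegral_const_mul _ (hA j)]
        simp [volume_cube]
  calc _ ≤ ENNReal.ofReal (ε ^ n) * ∑' j, ENNReal.ofReal C *
      (((∫⁻ y in cube j, b j ^ P y) + ∫⁻ y in cube j, ENNReal.ofReal (ell ε y)) * I1 +
        (∫⁻ y in cube j, b j ^ P y) * I2 +
        (ENNReal.ofReal (ε' ^ n) * L * (∫⁻ y in cube j, b j ^ P y) +
          ∫⁻ x : En n, ENNReal.ofReal (ell ε x) * (ENNReal.ofReal (ε' ^ n) * wt κ (ε' • (x - lat j))))) := by
        gcongr with j; exact hj j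
    _ = ENNReal.ofReal C * (((ENNReal.ofReal (ε ^ n) * ∑' j, ∫⁻ y in cube j, b j ^ P y) + 
          ENNReal.ofReal (ε ^ n) * L) * I1 +
          (ENNReal.ofReal (ε ^ n) * ∑' j, ∫⁻ y in cube j, b j ^ P y) * I2 +
          (ENNReal.ofReal (ε' ^ n) * L * (ENNReal.ofReal (ε ^ n) * ∑' j, ∫⁻ y in cube j, b j ^ P y) +
           ENNReal.ofReal (ε ^ n) * ∫⁻ x : En n, ENNReal.ofReal (ell ε x) *
            ∑' j, (ENNReal.ofReal (ε' ^ n) * wt κ (ε' • (x - lat j))))) := by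
        rw [ENNReal.tsum_mul_left, ENNReal.tsum_add, ENNReal.tsum_add, ENNReal.tsum_add,
          ENNReal.tsum_mul_right, ENNReal.tsum_mul_right, ENNReal.tsum_add, ENNReal.tsum_mul_left, tsum_cube, ← hL,
          ← lintegral_tsum]
        · simp only [ENNReal.tsum_mul_left]
          ring
        · intro j
          apply Measurable.aemeasurable
          exact (measurable_ell (n := n) ε).ennreal_ofReal.mul
            (((measurable_wt κ).comp (by fun_prop : Measurable fun x : En n => ε' • (x - lat j))).const_mul _)
    _ ≤ T := by
        rw [hT]
        have e3 : ENNReal.ofReal (ε ^ n) * ∫⁻ x : En n, ENNReal.ofReal (ell ε x) *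
            ∑' j, (ENNReal.ofReal (ε' ^ n) * wt κ (ε' • (x - lat j))) ≤ I0 * I3 := by
          calc _ ≤ ENNReal.ofReal (ε ^ n) * ∫⁻ x : En n, ENNReal.ofReal (ell ε x) * I3 := by
                gcongr with x
                exact tsum_wt_le (by linarith) hε'0 hε'1 x
            _ = ENNReal.ofReal (ε ^ n) * L * I3 := by
                rw [lintegral_mul_const' _ _ f3.ne, mul_assoc]
            _ ≤ _ := by gcongr
        gcongr
    _ ≤ _ := by
        rw [ENNReal.le_ofReal_iff_toReal_le fT (by positivity)]; linarith

end

noncomputable section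
open MeasureTheory Real Set
open scoped ENNReal NNReal

lemma add_two_rpow_le {ν : ℝ} (hν : 0 < ν) {y : ℝ} (hy : 0 ≤ y) :
    (y + 2) ^ ν ≤ ((4 * ν) ^ ν * Real.exp (1/2)) * Real.exp (y/4) := by
  have h1 : y + 2 ≤ (4 * ν) * Real.exp ((y + 2)/(4 * ν)) := by
    have := Real.add_one_le_exp ((y + 2)/(4*ν))
    have h2 : (y + 2)/(4 * ν) ≤ Real.exp ((y + 2)/(4 * ν)) := by linarith
    rw [div_le_iff₀ (by positivity)] at h2
    linarith
  calc (y + 2) ^ ν ≤ ((4 * ν) * Real.exp ((y + 2)/(4 * ν))) ^ ν := by gcongr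
    _ = (4 * ν) ^ ν * Real.exp ((y + 2)/4) := by
      rw [Real.mul_rpow (by positivity) (by positivity), ← Real.exp_mul]
      congr 2; field_simp
    _ = _ := by
      rw [mul_assoc, ← Real.exp_add]; congr 2; ring

/-- side integral -/
lemma side_bound {ν : ℝ} (hν : 0 < ν) {lam Y : ℝ} (hl : 1 ≤ lam) (hY : 0 ≤ Y) {f : ℝ → ℂ}
    (hf : ∀ y, 0 < y → ‖f y‖ ≤ (y * (y + 2)) ^ ν * Real.exp (-lam * y)) :
    ‖∫ y in (0:ℝ)..Y, f y‖ ≤ ((4 * ν) ^ ν * Real.exp (1/2)) *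
      ((1/(lam/2)) ^ (ν + 1) * Real.Gamma (ν + 1)) := by
  set K := (4 * ν) ^ ν * Real.exp (1/2) with hK
  have hK0 : 0 < K := by positivity
  set g : ℝ → ℝ := fun y => K * (y ^ ((ν + 1) - 1) * Real.exp (-(lam/2 * y))) with hg
  have hgi : IntegrableOn g (Ioi 0) := by
    have h := integrableOn_rpow_mul_exp_neg_mul_rpow (p := 1) (s := ν) (b := lam/2) (by linarith)
      (by norm_num) (by linarith)
    refine (h.const_mul K).congr ?_
    refine ae_of_all _ fun y => ?_
    simp [hg]
  have hg0 : ∀ y, 0 < y → 0 ≤ g y := fun y hy => by rw [hg]; positivity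
  have h1 : ‖∫ y in (0:ℝ)..Y, f y‖ ≤ ∫ y in (0:ℝ)..Y, g y := by
    apply intervalIntegral.norm_integral_le_of_norm_le hY
    · refine ae_of_all _ fun y hy => ?_
      refine (hf y hy.1).trans ?_
      have hy0 := hy.1
      rw [Real.mul_rpow hy0.le (by linarith)]
      calc y ^ ν * (y + 2) ^ ν * Real.exp (-lam * y) ≤
          y ^ ν * (K * Real.exp (y/4)) * Real.exp (-lam * y) := by
            gcongr; exact add_two_rpow_le hν hy0.le
        _ = K * (y ^ ν * Real.exp (y/4 + -lam * y)) := by rw [Real.exp_add]; ring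
        _ ≤ K * (y ^ ν * Real.exp (-(lam/2 * y))) := by gcongr; nlinarith
        _ = g y := by simp [hg]
    · rw [intervalIntegrable_iff_integrableOn_Ioc_of_le hY]
      exact hgi.mono_set Ioc_subset_Ioi_self
  refine h1.trans ?_
  rw [intervalIntegral.integral_of_le hY]
  calc ∫ y in Ioc 0 Y, g y ≤ ∫ y in Ioi 0, g y := by
        apply setIntegral_mono_set hgi
        · filter_upwards [ae_restrict_mem measurableSet_Ioi] with y hy using hg0 y hy
        · exact Ioc_subset_Ioi_self.eventuallyLE
    _ = _ := by
        rw [hg, integral_const_mul, Real.integral_rpow_mul_exp_neg_mul_Ioi (by linarith) (by linarith)]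

lemma re_one_sub_sq (z : ℂ) : (1 - z ^ 2).re = 1 - z.re ^ 2 + z.im ^ 2 := by
  simp [pow_two]; ring

lemma osc1d {ν : ℝ} (hν : 0 < ν) : ∃ C : ℝ, 0 ≤ C ∧ ∀ lam : ℝ, 1 ≤ lam →
    ‖∫ t in (-1:ℝ)..1, (((max (1 - t ^ 2) 0) ^ ν : ℝ) : ℂ) * Complex.exp (Complex.I * lam * t)‖ ≤
      C * lam ^ (-(ν + 1)) := by
  set K := (4 * ν) ^ ν * Real.exp (1/2) with hK
  have hK0 : 0 < K := by positivity
  set C := 2 * (K * (2 ^ (ν + 1) * Real.Gamma (ν + 1))) with hC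
  have hG : 0 < Real.Gamma (ν + 1) := Real.Gamma_pos_of_pos (by linarith)
  refine ⟨C, by positivity, ?_⟩
  intro lam hl
  have hl0 : 0 < lam := by linarith
  set g : ℂ → ℂ := fun z => (1 - z ^ 2) ^ (ν : ℂ) * Complex.exp (Complex.I * lam * z) with hg
  set F := ∫ t in (-1:ℝ)..1, (((max (1 - t ^ 2) 0) ^ ν : ℝ) : ℂ) * Complex.exp (Complex.I * lam * t) with hF
  have key : ∀ Y : ℝ, 0 < Y → ‖F‖ ≤ 2 * (K * K * Real.exp (-Y/2)) + C * lam ^ (-(ν + 1)) := by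
    intro Y hY
    have hc : ContinuousOn g (uIcc (⟨-1, 0⟩ : ℂ).re (⟨1, Y⟩ : ℂ).re ×ℂ uIcc (⟨-1,0⟩ : ℂ).im (⟨1,Y⟩ : ℂ).im) := by
      intro z hz
      rw [Complex.mem_reProdIm] at hz
      simp only at hz
      rw [uIcc_of_le (by norm_num), uIcc_of_le hY.le] at hz
      apply ContinuousAt.continuousWithinAt
      apply ContinuousAt.mul
      · have h1 : ContinuousAt (fun x : ℂ => x ^ (ν:ℂ)) (1 - z ^ 2) := by
          apply Complex.continuousAt_cpow_const_of_re_pos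
          · left; rw [re_one_sub_sq]
            have := hz.1.1
            have := hz.1.2
            nlinarith [sq_nonneg z.im]
          · simpa using hν
        exact ContinuousAt.comp (f := fun z : ℂ => 1 - z ^ 2) h1 (by fun_prop)
      · fun_prop
    have hd : DifferentiableOn ℂ g (Ioo (min (⟨-1, 0⟩ : ℂ).re (⟨1, Y⟩ : ℂ).re) (max (⟨-1, 0⟩ : ℂ).re (⟨1, Y⟩ : ℂ).re) ×ℂ
        Ioo (min (⟨-1, 0⟩ : ℂ).im (⟨1, Y⟩ : ℂ).im) (max (⟨-1, 0⟩ : ℂ).im (⟨1, Y⟩ : ℂ).im)) := by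
      intro z hz
      rw [Complex.mem_reProdIm] at hz
      simp only at hz
      rw [min_eq_left (by norm_num), max_eq_right (by norm_num)] at hz
      apply DifferentiableAt.differentiableWithinAt
      apply DifferentiableAt.mul
      · apply DifferentiableAt.cpow (by fun_prop) (by fun_prop)
        left
        rw [re_one_sub_sq]
        have := hz.1.1
        have := hz.1.2
        nlinarith [sq_nonneg z.im]
      · fun_prop
    have hrect := Complex.integral_boundary_rect_eq_zero_of_continuousOn_of_differentiableOn g
      ⟨-1, 0⟩ ⟨1, Y⟩ hc hd
    simp only at hrect
    have hbot : (∫ x in (-1:ℝ)..1, g (x + (0:ℝ) * Complex.I)) = F := by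
      rw [hF]
      apply intervalIntegral.integral_congr
      intro t ht
      rw [uIcc_of_le (by norm_num)] at ht
      have h1 : 0 ≤ 1 - t ^ 2 := by nlinarith [ht.1, ht.2]
      simp only [hg]
      rw [max_eq_left h1, Complex.ofReal_cpow h1]
      simp
    have hnorm : ∀ z : ℂ, ‖g z‖ = ‖1 - z ^ 2‖ ^ ν * Real.exp (-lam * z.im) := by
      intro z
      simp only [hg]
      rw [norm_mul, Complex.norm_cpow_real, Complex.norm_exp]
      congr 2
      simp
    have hside : ∀ s : ℝ, s ^ 2 = 1 → ‖∫ y in (0:ℝ)..Y, g (s + y * Complex.I)‖ ≤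
        K * (((1/(lam/2)) ^ (ν + 1)) * Real.Gamma (ν + 1)) := by
      intro s hs
      apply side_bound hν hl hY.le
      intro y hy
      rw [hnorm]
      have him : ((s:ℂ) + y * Complex.I).im = y := by simp
      rw [him]
      gcongr
      have : (1 - ((s:ℂ) + y * Complex.I) ^ 2) = y * (y - 2 * s * Complex.I) := by
        have hs' : (s:ℂ) ^ 2 = 1 := by exact_mod_cast hs
        have hI := Complex.I_sq
        linear_combination (-1 : ℂ) * hs' - (y:ℂ) ^ 2 * hI
      rw [this, norm_mul, Complex.norm_real, Real.norm_of_nonneg hy.le]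
      gcongr
      refine (norm_sub_le _ _).trans ?_
      have hs1 : |s| = 1 := by
        have : |s| ^ 2 = 1 := by rw [sq_abs, hs]
        nlinarith [abs_nonneg s]
      simp [hs1, abs_of_pos hy]
    have htop : ‖∫ x in (-1:ℝ)..1, g (x + Y * Complex.I)‖ ≤ (K * K * Real.exp (-Y/2)) * |1 - (-1:ℝ)| := by
      apply intervalIntegral.norm_integral_le_of_norm_le_const
      intro x hx
      rw [uIoc_of_le (by norm_num)] at hx
      rw [hnorm]
      have him : ((x:ℂ) + Y * Complex.I).im = Y := by simp
      rw [him]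
      have h1 : ‖1 - ((x:ℂ) + Y * Complex.I) ^ 2‖ ≤ (Y + 2) * (Y + 2) := by
        have h2 : ‖(x:ℂ) + Y * Complex.I‖ ≤ 1 + Y := by
          refine (norm_add_le _ _).trans ?_
          simp only [norm_mul, Complex.norm_real, Complex.norm_I, Real.norm_eq_abs, mul_one, abs_of_pos hY]
          gcongr
          rw [abs_le]; constructor <;> linarith [hx.1, hx.2]
        refine (norm_sub_le _ _).trans ?_
        rw [norm_pow, norm_one]
        nlinarith [norm_nonneg ((x:ℂ) + Y * Complex.I)]
      calc _ ≤ ((Y + 2) * (Y + 2)) ^ ν * Real.exp (-lam * Y) := by gcongr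
        _ = (Y + 2) ^ ν * (Y + 2) ^ ν * Real.exp (-lam * Y) := by rw [Real.mul_rpow (by positivity) (by positivity)]
        _ ≤ (K * Real.exp (Y/4)) * (K * Real.exp (Y/4)) * Real.exp (-lam * Y) := by
            gcongr <;> exact add_two_rpow_le hν hY.le
        _ = K * K * Real.exp (Y/4 + Y/4 + -lam * Y) := by rw [Real.exp_add, Real.exp_add]; ring
        _ ≤ _ := by gcongr; nlinarith
    rw [hbot] at hrect
    have e : F = (∫ x in (-1:ℝ)..1, g (x + Y * Complex.I)) -
        Complex.I • (∫ y in (0:ℝ)..Y, g ((1:ℝ) + y * Complex.I)) +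
        Complex.I • (∫ y in (0:ℝ)..Y, g ((-1:ℝ) + y * Complex.I)) := by
      linear_combination hrect
    have hr := hside 1 (by norm_num)
    have hle := hside (-1) (by norm_num)
    have hpow : (1/(lam/2)) ^ (ν + 1) = 2 ^ (ν + 1) * lam ^ (-(ν + 1)) := by
      rw [one_div_div, Real.div_rpow (by norm_num) hl0.le, Real.rpow_neg hl0.le]; rfl
    rw [hpow] at hr hle
    calc ‖F‖ ≤ (K * K * Real.exp (-Y/2)) * |1 - (-1:ℝ)| +
          K * (2 ^ (ν + 1) * lam ^ (-(ν + 1)) * Real.Gamma (ν + 1)) +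
          K * (2 ^ (ν + 1) * lam ^ (-(ν + 1)) * Real.Gamma (ν + 1)) := by
          rw [e]
          refine (norm_add_le _ _).trans ?_
          gcongr
          · refine (norm_sub_le _ _).trans ?_
            gcongr
            rw [norm_smul, Complex.norm_I, one_mul]; exact hr
          · rw [norm_smul, Complex.norm_I, one_mul]; exact hle
      _ = _ := by
          rw [hC, show |1 - (-1:ℝ)| = 2 by norm_num]; ring
  have hlim : Filter.Tendsto (fun Y : ℝ => 2 * (K * K * Real.exp (-Y/2)) + C * lam ^ (-(ν + 1)))
      Filter.atTop (nhds (2 * (K * K * 0) + C * lam ^ (-(ν + 1)))) := by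
    apply Filter.Tendsto.add_const
    apply Filter.Tendsto.const_mul
    apply Filter.Tendsto.const_mul
    have : Filter.Tendsto (fun Y : ℝ => -(Y/2)) Filter.atTop Filter.atBot :=
      Filter.tendsto_neg_atTop_atBot.comp (Filter.tendsto_id.atTop_div_const (by norm_num))
    have h2 := Real.tendsto_exp_atBot.comp this
    refine h2.congr fun Y => ?_
    simp [neg_div]
  have := ge_of_tendsto hlim (Filter.eventually_atTop.2 ⟨1, fun Y hY => key Y (by linarith)⟩)
  simpa using this

end

noncomputable section
open MeasureTheory Real Set
open scoped ENNReal NNReal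

def brM (n : ℕ) (δ : ℝ) (ξ : En n) : ℝ := (max (1 - ‖ξ‖ ^ 2) 0) ^ δ

lemma brM_cont {n : ℕ} {δ : ℝ} (hδ : 0 < δ) : Continuous (brM n δ) := by
  unfold brM
  exact Continuous.rpow_const (by fun_prop) (fun _ => Or.inr hδ.le)

lemma brM_zero {n : ℕ} {δ : ℝ} (hδ : 0 < δ) {ξ : En n} (h : 1 ≤ ‖ξ‖) : brM n δ ξ = 0 := by
  unfold brM
  rw [max_eq_right (by nlinarith [norm_nonneg ξ]), Real.zero_rpow hδ.ne']

lemma brM_nonneg {n : ℕ} {δ : ℝ} (ξ : En n) : 0 ≤ brM n δ ξ := by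
  unfold brM; positivity

lemma brM_supp {n : ℕ} {δ : ℝ} (hδ : 0 < δ) : HasCompactSupport (brM n δ) := by
  apply HasCompactSupport.intro (isCompact_closedBall (0 : En n) 1)
  intro x hx
  apply brM_zero hδ
  simp at hx
  exact hx.le

lemma brM_int {n : ℕ} {δ : ℝ} (hδ : 0 < δ) : Integrable (brM n δ) :=
  (brM_cont hδ).integrable_of_hasCompactSupport (brM_supp hδ)

def brE (n : ℕ) (x ξ : En n) : ℂ :=
  Complex.exp (-(2 * Real.pi) * Complex.I * ((∑ i, x i * ξ i : ℝ) : ℂ))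

lemma norm_brE {n : ℕ} (x ξ : En n) : ‖brE n x ξ‖ = 1 := by
  unfold brE
  rw [Complex.norm_exp]
  simp

lemma brE_inner {n : ℕ} (x ξ : En n) :
    brE n x ξ = Complex.exp (-(2 * Real.pi) * Complex.I * ((inner ℝ x ξ : ℝ) : ℂ)) := by
  unfold brE
  congr 3
  rw [PiLp.inner_apply]
  apply Finset.sum_congr rfl
  intro i _
  simp [mul_comm]

lemma brKernel_eq {n : ℕ} {δ : ℝ} (x : En n) :
    brKernel n δ x = ∫ ξ, ((brM n δ ξ : ℝ) : ℂ) * brE n x ξ := rfl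

lemma brE_cont {n : ℕ} : Continuous (fun q : En n × En n => brE n q.1 q.2) := by
  unfold brE
  fun_prop

lemma brE_cont' {n : ℕ} (x : En n) : Continuous (fun ξ : En n => brE n x ξ) := by
  unfold brE
  fun_prop

lemma brME_int {n : ℕ} {δ : ℝ} (hδ : 0 < δ) (x : En n) :
    Integrable (fun ξ => ((brM n δ ξ : ℝ) : ℂ) * brE n x ξ) := by
  apply (brM_int hδ).mono'
  · exact ((Complex.continuous_ofReal.comp (brM_cont hδ)).mul (brE_cont' x)).aestronglyMeasurable
  · refine Filter.Eventually.of_forall fun ξ => ?_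
    rw [norm_mul, norm_brE, mul_one, Complex.norm_real, Real.norm_of_nonneg (brM_nonneg ξ)]

lemma brKernel_bdd {n : ℕ} {δ : ℝ} (x : En n) :
    ‖brKernel n δ x‖ ≤ ∫ ξ, brM n δ ξ := by
  rw [brKernel_eq]
  refine (norm_integral_le_integral_norm _).trans (le_of_eq ?_)
  congr 1
  funext ξ
  rw [norm_mul, norm_brE, mul_one, Complex.norm_real, Real.norm_of_nonneg (brM_nonneg ξ)]

lemma brKernel_rot {n : ℕ} {δ : ℝ} {x y : En n} (h : ‖x‖ = ‖y‖) :
    brKernel n δ x = brKernel n δ y := by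
  set R := (ℝ ∙ (x - y))ᗮ.reflection with hR
  have hxy : R x = y := Submodule.reflection_sub h
  rw [brKernel_eq, brKernel_eq,
    ← (R.measurePreserving).integral_comp R.toHomeomorph.measurableEmbedding
      (fun ξ => ((brM n δ ξ : ℝ) : ℂ) * brE n y ξ)]
  congr 1
  funext ξ
  rw [brE_inner, brE_inner, ← hxy, LinearIsometryEquiv.inner_map_map]
  simp [brM]

lemma inner_slice {k : ℕ} {δ : ℝ} (hδ : 0 < δ) (s : ℝ) :
    ∫ η : Fin k → ℝ, (max (s - ∑ i, η i ^ 2) 0) ^ δ =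
      (∫ η : Fin k → ℝ, (max (1 - ∑ i, η i ^ 2) 0) ^ δ) * (max s 0) ^ (δ + k / 2) := by
  rcases le_or_gt s 0 with hs | hs
  · rw [max_eq_right hs, Real.zero_rpow (by positivity), mul_zero]
    rw [integral_eq_zero_of_ae]
    refine Filter.Eventually.of_forall fun η => ?_
    have : 0 ≤ ∑ i, η i ^ 2 := Finset.sum_nonneg fun i _ => sq_nonneg _
    simp only
    rw [max_eq_right (by linarith), Real.zero_rpow hδ.ne']
    rfl
  · rw [max_eq_left hs.le]
    have h := Measure.integral_comp_inv_smul (volume : Measure (Fin k → ℝ))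
      (fun η => s ^ δ * (max (1 - ∑ i, η i ^ 2) 0) ^ δ) (√s)
    have h1 : ∀ η : Fin k → ℝ, s ^ δ * (max (1 - ∑ i, ((√s)⁻¹ • η) i ^ 2) 0) ^ δ =
        (max (s - ∑ i, η i ^ 2) 0) ^ δ := by
      intro η
      rw [← Real.mul_rpow hs.le (le_max_right _ _), mul_max_of_nonneg _ _ hs.le, mul_zero, mul_sub,
        mul_one, Finset.mul_sum]
      congr 4
      funext i
      simp only [Pi.smul_apply, smul_eq_mul, mul_pow, inv_pow, Real.sq_sqrt hs.le]
      field_simp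
    simp only [h1] at h
    rw [h, integral_const_mul, smul_eq_mul, abs_of_nonneg (by positivity), Real.rpow_add hs,
      Module.finrank_fin_fun, Real.sqrt_eq_rpow, ← Real.rpow_natCast, ← Real.rpow_mul hs.le]
    rw [show (1:ℝ)/2 * (k:ℝ) = k/2 by ring]
    ring

def slE (k : ℕ) : ℝ × (Fin k → ℝ) ≃ᵐ En (k+1) :=
  (MeasurableEquiv.piFinSuccAbove (fun _ : Fin (k+1) => ℝ) 0).symm.trans (MeasurableEquiv.toLp 2 _)

lemma slE_mp (k : ℕ) : MeasurePreserving (slE k) := by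
  unfold slE
  exact (MeasurePreserving.trans (volume_preserving_piFinSuccAbove (fun _ : Fin (k+1) => ℝ) 0).symm
    (EuclideanSpace.volume_preserving_symm_measurableEquiv_toLp (Fin (k+1))).symm)

lemma slE_apply (k : ℕ) (t : ℝ) (η : Fin k → ℝ) :
    slE k (t, η) = WithLp.toLp 2 (Fin.insertNth 0 t η : Fin (k+1) → ℝ) := rfl

lemma kernel_slice {k : ℕ} {δ : ℝ} (hδ : 0 < δ) : ∃ c : ℝ, ∀ a : ℝ,
    brKernel (k+1) δ (WithLp.toLp 2 (Fin.insertNth 0 a 0 : Fin (k+1) → ℝ)) =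
    c * ∫ t in (-1:ℝ)..1, (((max (1 - t ^ 2) 0) ^ (δ + k/2) : ℝ) : ℂ) *
      Complex.exp (-(2 * Real.pi) * Complex.I * ((a * t : ℝ) : ℂ)) := by
  refine ⟨∫ η : Fin k → ℝ, (max (1 - ∑ i, η i ^ 2) 0) ^ δ, fun a => ?_⟩
  set x : En (k+1) := WithLp.toLp 2 (Fin.insertNth 0 a 0 : Fin (k+1) → ℝ)
  have hI := brME_int hδ x
  rw [brKernel_eq, ← (slE_mp k).integral_comp']
  rw [← (slE_mp k).integrable_comp_emb (slE k).measurableEmbedding] at hI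
  rw [Measure.volume_eq_prod, integral_prod _ (by rw [Measure.volume_eq_prod] at hI; exact hI)]
  have hM : ∀ t η, brM (k+1) δ (slE k (t, η)) = (max ((1 - t^2) - ∑ i, η i ^ 2) 0) ^ δ := by
    intro t η
    unfold brM
    rw [EuclideanSpace.norm_sq_eq, slE_apply]
    congr 2
    simp [Fin.sum_univ_succ, ← sub_sub]
  have hE : ∀ t η, brE (k+1) x (slE k (t, η)) =
      Complex.exp (-(2 * Real.pi) * Complex.I * ((a * t : ℝ) : ℂ)) := by
    intro t η
    unfold brE
    rw [slE_apply]
    congr 3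
    simp [Fin.sum_univ_succ, x]
  simp only [hM, hE]
  have : ∀ t : ℝ, ∫ η : Fin k → ℝ, (((max ((1 - t^2) - ∑ i, η i ^ 2) 0) ^ δ : ℝ) : ℂ) *
      Complex.exp (-(2 * Real.pi) * Complex.I * ((a * t : ℝ) : ℂ)) =
      ((∫ η : Fin k → ℝ, (max (1 - ∑ i, η i ^ 2) 0) ^ δ : ℝ) : ℂ) *
      ((((max (1 - t ^ 2) 0) ^ (δ + k/2) : ℝ) : ℂ) *
      Complex.exp (-(2 * Real.pi) * Complex.I * ((a * t : ℝ) : ℂ))) := by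
    intro t
    rw [integral_mul_const, integral_complex_ofReal, inner_slice hδ]
    push_cast
    ring
  simp only [this]
  rw [integral_const_mul, intervalIntegral.integral_of_le (by norm_num)]
  congr 1
  rw [setIntegral_eq_integral_of_forall_compl_eq_zero]
  intro t ht
  have : 1 ≤ t ^ 2 := by
    simp only [mem_Ioc, not_and_or, not_lt, not_le] at ht
    rcases ht with h | h <;> nlinarith
  rw [max_eq_right (by linarith), Real.zero_rpow (by positivity)]
  simp

lemma brKernel_decay {n : ℕ} (hn : 1 ≤ n) {δ : ℝ} (hδ : 0 < δ) : ∃ C : ℝ, 0 < C ∧ ∀ x : En n,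
    ‖brKernel n δ x‖ₑ ≤ ENNReal.ofReal C * wt ((n+1)/2 + δ) x := by
  obtain ⟨k, rfl⟩ : ∃ k, n = k + 1 := ⟨n - 1, by omega⟩
  obtain ⟨c, hc⟩ := kernel_slice (k := k) hδ
  have hν : 0 < δ + (k:ℝ)/2 := by positivity
  obtain ⟨C, hC0, hC⟩ := osc1d hν
  set κ : ℝ := ((k+1:ℕ)+1)/2 + δ with hκ
  have hκν : κ = δ + (k:ℝ)/2 + 1 := by rw [hκ]; push_cast; ring
  have hκ0 : 0 < κ := by rw [hκν]; linarith
  set I := ∫ ξ, brM (k+1) δ ξ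
  have hI : 0 ≤ I := integral_nonneg fun ξ => brM_nonneg ξ
  refine ⟨|c| * C + (I + 1) * 2 ^ κ, by positivity, fun x => ?_⟩
  suffices ‖brKernel (k+1) δ x‖ ≤ (|c| * C + (I + 1) * 2 ^ κ) * (1 + ‖x‖) ^ (-κ) by
    unfold wt
    rw [← ENNReal.ofReal_mul (by positivity), ← ofReal_norm_eq_enorm]
    exact ENNReal.ofReal_le_ofReal this
  have hx0 := norm_nonneg x
  rcases le_or_gt ‖x‖ 1 with hx | hx
  · have h2 : (1 + ‖x‖) ^ κ ≤ 2 ^ κ := Real.rpow_le_rpow (by positivity) (by linarith) hκ0.le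
    have h3 : 1 ≤ 2 ^ κ * (1 + ‖x‖) ^ (-κ) := by
      rw [Real.rpow_neg (by positivity), ← div_eq_mul_inv, le_div_iff₀ (by positivity)]
      linarith
    have h4 : 0 ≤ |c| * C * (1 + ‖x‖) ^ (-κ) := by positivity
    have h5 := brKernel_bdd (δ := δ) x
    calc ‖brKernel (k+1) δ x‖ ≤ I := h5
      _ ≤ (I + 1) * (2 ^ κ * (1 + ‖x‖) ^ (-κ)) := by nlinarith
      _ ≤ _ := by rw [add_mul (|c| * C), mul_assoc (I+1)]; linarith
  · have hnorm : ‖x‖ = ‖(WithLp.toLp 2 (Fin.insertNth 0 (-‖x‖) 0 : Fin (k+1) → ℝ) : En (k+1))‖ := by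
      generalize ‖x‖ = a at hx0
      rw [EuclideanSpace.norm_eq]
      rw [Fin.sum_univ_succ]
      simp [Real.sqrt_sq hx0]
    rw [brKernel_rot hnorm, hc, norm_mul, Complex.norm_real, Real.norm_eq_abs]
    have h6 := hC (2 * π * ‖x‖) (by nlinarith [Real.pi_gt_three])
    have h7 : ∀ t : ℝ, -(2 * (Real.pi:ℂ)) * Complex.I * ((-‖x‖ * t : ℝ) : ℂ) =
        Complex.I * ((2 * π * ‖x‖ : ℝ) : ℂ) * t := by intro t; push_cast; ring
    simp only [h7]
    have h8 : (2 * π * ‖x‖) ^ (-κ) ≤ (1 + ‖x‖) ^ (-κ) := by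
      apply Real.rpow_le_rpow_of_nonpos (by positivity) _ (by linarith)
      nlinarith [Real.pi_gt_three]
    have h9 : 0 ≤ (I + 1) * 2 ^ κ * (1 + ‖x‖) ^ (-κ) := by positivity
    rw [← hκν] at h6
    calc _ ≤ |c| * (C * (2 * π * ‖x‖) ^ (-κ)) := mul_le_mul_of_nonneg_left h6 (abs_nonneg _)
      _ ≤ |c| * (C * (1 + ‖x‖) ^ (-κ)) := by gcongr
      _ ≤ _ := by rw [add_mul]; linarith
end

noncomputable section
open MeasureTheory Real Set
open scoped ENNReal NNReal FourierTransform ContDiff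

abbrev Sw (n : ℕ) := SchwartzMap (En n) ℂ

lemma sw_decay {n : ℕ} (f : Sw n) (N : ℝ) : ∃ C : ℝ, 0 < C ∧ ∀ x, ‖f x‖ₑ ≤ ENNReal.ofReal C * wt N x := by
  set k := ⌈N⌉₊
  set S := 2 ^ k * ((Finset.Iic ((k, 0) : ℕ × ℕ)).sup fun m => SchwartzMap.seminorm ℂ m.1 m.2) f with hS
  have h : ∀ x, (1 + ‖x‖) ^ k * ‖f x‖ ≤ S := by
    intro x
    have := SchwartzMap.one_add_le_sup_seminorm_apply (𝕜 := ℂ) (m := (k, 0)) (k := k) (n := 0) le_rfl le_rfl f x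
    rwa [norm_iteratedFDeriv_zero] at this
  have hS0 : 0 ≤ S := (by positivity : (0:ℝ) ≤ (1 + ‖(0 : En n)‖) ^ k * ‖f 0‖).trans (h 0)
  refine ⟨S + 1, by linarith, fun x => ?_⟩
  unfold wt
  rw [← ENNReal.ofReal_mul (by linarith), ← ofReal_norm]
  apply ENNReal.ofReal_le_ofReal
  have hx : 1 ≤ 1 + ‖x‖ := by linarith [norm_nonneg x]
  rw [Real.rpow_neg (by positivity), ← div_eq_mul_inv, le_div_iff₀ (by positivity)]
  have h2 : (1 + ‖x‖) ^ N ≤ (1 + ‖x‖) ^ k := by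
    rw [← Real.rpow_natCast]
    exact Real.rpow_le_rpow_of_exponent_le hx (Nat.le_ceil N)
  calc ‖f x‖ * (1 + ‖x‖) ^ N ≤ ‖f x‖ * (1 + ‖x‖) ^ k := by gcongr
    _ = (1 + ‖x‖) ^ k * ‖f x‖ := mul_comm _ _
    _ ≤ S + 1 := by linarith [h x]

lemma sw_smul {n : ℕ} (f : Sw n) {a : ℝ} (ha : 0 < a) : ∃ g : Sw n, ∀ x, g x = f (a • x) := by
  refine ⟨SchwartzMap.compCLMOfContinuousLinearEquiv ℂ
    (ContinuousLinearEquiv.smulLeft (Units.mk0 a ha.ne')) f, fun x => ?_⟩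
  rw [SchwartzMap.compCLMOfContinuousLinearEquiv_apply]
  rfl

lemma sw_dil {n : ℕ} (f : Sw n) {t : ℝ} (ht : 0 < t) : ∃ g : Sw n,
    (∀ x, g x = (t ^ n)⁻¹ • f (t⁻¹ • x)) ∧ ∀ ξ, 𝓕 g ξ = 𝓕 f (t • ξ) := by
  obtain ⟨g, hg⟩ := sw_smul f (inv_pos.2 ht)
  refine ⟨(t ^ n)⁻¹ • g, fun x => by simp [hg], fun ξ => ?_⟩
  rw [SchwartzMap.fourier_coe, SchwartzMap.fourier_coe, Real.fourier_eq', Real.fourier_eq']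
  have := Measure.integral_comp_inv_smul (volume : Measure (En n))
    (fun v => Complex.exp (↑(-2 * π * inner ℝ v (t • ξ)) * Complex.I) • f v) t
  rw [finrank_euclideanSpace_fin, abs_of_pos (by positivity)] at this
  rw [← inv_smul_eq_iff₀ (by positivity)] at this
  rw [← this, ← integral_smul]
  congr 1
  funext v
  simp only [SchwartzMap.smul_apply, hg, inner_smul_left, inner_smul_right]
  rw [smul_comm]
  congr 5
  simp [ht.ne']

lemma sw_conv {n : ℕ} (f g : Sw n) : ∃ h : Sw n,
    (∀ x, h x = ∫ y, f (x - y) * g y) ∧ ∀ ξ, 𝓕 h ξ = 𝓕 f ξ * 𝓕 g ξ := by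
  refine ⟨SchwartzMap.convolution (ContinuousLinearMap.mul ℂ ℂ) f g, fun x => ?_, fun ξ => ?_⟩
  · rw [SchwartzMap.convolution_apply, convolution_def]
    rw [← integral_sub_left_eq_self _ _ x]
    simp
  · rw [SchwartzMap.fourier_convolution_apply, Real.fourier_bilin_convolution_eq _ f.integrable g.integrable]
    rfl

lemma sw_ext {n : ℕ} {f g : Sw n} (h : ∀ ξ, 𝓕 f ξ = 𝓕 g ξ) : f = g := by
  have : 𝓕 f = 𝓕 g := by ext ξ; exact h ξ
  rw [← FourierTransform.fourierInv_fourier_eq (F := Sw n) f, this,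
    FourierTransform.fourierInv_fourier_eq (F := Sw n)]

lemma sw_div {n : ℕ} {a b : En n → ℂ} (ha : ContDiff ℝ ∞ a) (hb : ContDiff ℝ ∞ b)
    (hc : HasCompactSupport a) (h0 : ∀ x ∈ tsupport a, b x ≠ 0) :
    ∃ g : Sw n, ∀ x, 𝓕 g x = a x / b x := by
  have hs : ContDiff ℝ ∞ (fun x => a x / b x) := by
    rw [contDiff_iff_contDiffAt]
    intro x
    by_cases hx : x ∈ tsupport a
    · simp only [div_eq_mul_inv]
      exact ha.contDiffAt.mul (hb.contDiffAt.inv (h0 x hx))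
    · have : (fun x => a x / b x) =ᶠ[nhds x] fun _ => 0 := by
        have := notMem_tsupport_iff_eventuallyEq.1 hx
        filter_upwards [this] with y hy
        simp [hy]
      exact contDiffAt_const.congr_of_eventuallyEq this
  have hc' : HasCompactSupport (fun x => a x / b x) := by
    simp only [div_eq_mul_inv]
    exact hc.mul_right
  refine ⟨𝓕⁻ (hc'.toSchwartzMap hs), fun x => ?_⟩
  rw [FourierTransform.fourier_fourierInv_eq]
  rfl

lemma exists_bump (n : ℕ) : ∃ χ : En n → ℂ, ContDiff ℝ ∞ χ ∧ HasCompactSupport χ ∧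
    (∀ ξ, ‖ξ‖ ≤ 1 → χ ξ = 1) ∧ (∀ ξ, 2 ≤ ‖ξ‖ → χ ξ = 0) ∧ (∀ ξ, ‖χ ξ‖ ≤ 1) ∧
    (∀ ξ ∈ tsupport χ, ‖ξ‖ ≤ 2) := by
  let b : ContDiffBump (0 : En n) := ⟨1, 2, one_pos, one_lt_two⟩
  have h1 : ContDiff ℝ ∞ (fun ξ => ((b ξ : ℝ) : ℂ)) := Complex.ofRealCLM.contDiff.comp b.contDiff
  have h2 : ∀ ξ : En n, 2 ≤ ‖ξ‖ → ((b ξ : ℝ) : ℂ) = 0 := by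
    intro ξ h
    rw [b.zero_of_le_dist (by simpa using h)]
    rfl
  have h3 : tsupport (fun ξ => ((b ξ : ℝ) : ℂ)) ⊆ Metric.closedBall 0 2 := by
    apply closure_minimal _ Metric.isClosed_closedBall
    intro ξ hξ
    by_contra h
    apply hξ
    apply h2
    simp at h
    exact h.le
  refine ⟨_, h1, ?_, ?_, h2, ?_, ?_⟩
  · exact (isCompact_closedBall (0 : En n) 2).of_isClosed_subset (isClosed_tsupport _) h3
  · intro ξ h
    rw [b.one_of_mem_closedBall (by simpa [b] using h)]
    rfl
  · intro ξ
    rw [Complex.norm_real, Real.norm_of_nonneg b.nonneg]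
    exact b.le_one
  · intro ξ h
    simpa using h3 h
end

noncomputable section
open MeasureTheory Real Set
open scoped ENNReal NNReal FourierTransform ContDiff

lemma conv_bound {n : ℕ} (A W : Sw n) {N : ℝ} (hN : 0 ≤ N) : ∃ C : ℝ, 0 < C ∧ ∀ t : ℝ, 0 < t → t ≤ 1 →
    ∀ x, ∫⁻ y, ‖A (x - y)‖ₑ * ‖(t ^ n)⁻¹ • W (t⁻¹ • y)‖ₑ ≤ ENNReal.ofReal C * wt N x := by
  obtain ⟨CA, hCA, hA⟩ := sw_decay A N
  obtain ⟨CW, hCW, hW⟩ := sw_decay W (N + (n + 1))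
  have hI : ∫⁻ x : En n, wt ((n:ℝ) + 1) x < ⊤ := lintegral_wt_lt_top (by linarith)
  set I := (∫⁻ x : En n, wt ((n:ℝ) + 1) x).toReal with hIdef
  have hI0 : 0 ≤ I := ENNReal.toReal_nonneg
  refine ⟨CA * CW * (I + 1), by positivity, fun t ht ht1 x => ?_⟩
  have h1 : ∀ y, ‖A (x - y)‖ₑ * ‖(t ^ n)⁻¹ • W (t⁻¹ • y)‖ₑ ≤
      ENNReal.ofReal CA * ENNReal.ofReal CW * wt N x *
        (ENNReal.ofReal ((t⁻¹) ^ n) * wt ((n:ℝ) + 1) (t⁻¹ • (y - 0))) := by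
    intro y
    rw [sub_zero, enorm_smul]
    have e1 : ‖(t ^ n)⁻¹‖ₑ = ENNReal.ofReal ((t⁻¹)^n) := by
      rw [Real.enorm_eq_ofReal (by positivity), inv_pow]
    have e2 : wt N (t⁻¹ • y) ≤ wt N y := by
      have := wt_le_of hN (x := t⁻¹ • y) (y := y) one_pos (by
        rw [norm_smul, Real.norm_of_nonneg (by positivity), one_mul]
        have : 1 ≤ t⁻¹ := (one_le_inv₀ ht).2 ht1
        nlinarith [norm_nonneg y])
      simpa using this
    have e3 : wt N (x - y) * wt N y ≤ wt N x := by
      have := wt_peetre hN (x - y) y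
      rwa [sub_add_cancel] at this
    rw [e1]
    calc _ ≤ (ENNReal.ofReal CA * wt N (x - y)) * (ENNReal.ofReal ((t⁻¹)^n) *
          (ENNReal.ofReal CW * (wt N y * wt ((n:ℝ)+1) (t⁻¹ • y)))) := by
          gcongr
          · exact hA _
          · refine (hW _).trans ?_
            rw [← wt_mul]
            gcongr
      _ = ENNReal.ofReal CA * ENNReal.ofReal CW * (wt N (x - y) * wt N y) *
        (ENNReal.ofReal ((t⁻¹) ^ n) * wt ((n:ℝ) + 1) (t⁻¹ • y)) := by ring
      _ ≤ _ := by gcongr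
  refine (lintegral_mono h1).trans ?_
  have hm : Measurable fun y : En n => wt ((n:ℝ) + 1) (t⁻¹ • (y - 0)) :=
    (measurable_wt _).comp (by fun_prop)
  rw [lintegral_const_mul _ (hm.const_mul _), lintegral_const_mul _ hm,
    lintegral_wt_smul (inv_pos.2 ht), ← ENNReal.ofReal_toReal hI.ne, ← hIdef,
    ENNReal.ofReal_mul (by positivity), ENNReal.ofReal_mul (by positivity)]
  calc _ = ENNReal.ofReal CA * ENNReal.ofReal CW * ENNReal.ofReal I * wt N x := by ring
    _ ≤ _ := by gcongr; linarith

lemma exists_T {n : ℕ} (Φ : Sw n) (hΦ : ∀ ξ, ‖ξ‖ ≤ 2 → 𝓕 Φ ξ ≠ 0) {χ : En n → ℂ}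
    (hχ : ContDiff ℝ ∞ χ) (hχc : HasCompactSupport χ) (hχ1 : ∀ ξ, ‖ξ‖ ≤ 1 → χ ξ = 1)
    (hχ2 : ∀ ξ, 2 ≤ ‖ξ‖ → χ ξ = 0) (M : ℕ) {N : ℝ} (hN : 0 ≤ N) :
    ∃ C : ℝ, 0 < C ∧ ∃ T : ℕ → Sw n, (∀ j x, ‖T j x‖ₑ ≤ ENNReal.ofReal C * wt N x) ∧
      ∀ J ξ, ∑ j ∈ Finset.range (J + 1), ((2:ℂ)⁻¹ ^ (2 * M * j)) * 𝓕 (T j) ξ *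
        𝓕 Φ (((2:ℝ)⁻¹ ^ j) • ξ) = χ (((2:ℝ)⁻¹ ^ J) • ξ) * 𝓕 Φ ξ := by
  set ψ : En n → ℂ := fun η => χ η - χ ((2:ℝ) • η) with hψ
  have hψs : ContDiff ℝ ∞ ψ := hχ.sub (hχ.comp (by fun_prop))
  have hψt : tsupport ψ ⊆ {η | 1/2 ≤ ‖η‖ ∧ ‖η‖ ≤ 2} := by
    apply closure_minimal
    · intro η hη
      by_contra h
      apply hη
      simp only [mem_ofPred_eq, not_and_or, not_le] at h
      simp only [hψ]
      rcases h with h | h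
      · rw [hχ1 _ (by linarith), hχ1 _ (by rw [norm_smul]; norm_num; linarith), sub_self]
      · rw [hχ2 _ h.le, hχ2 _ (by rw [norm_smul]; norm_num; linarith), sub_self]
    · exact (isClosed_le continuous_const continuous_norm).inter
        (isClosed_le continuous_norm continuous_const)
  have hψc : HasCompactSupport ψ :=
    (isCompact_closedBall (0 : En n) 2).of_isClosed_subset (isClosed_tsupport _)
      (hψt.trans fun η h => by simpa using h.2)
  set q : En n → ℂ := fun ξ => (((‖ξ‖ ^ 2 : ℝ)) : ℂ) ^ M with hq
  have hqs : ContDiff ℝ ∞ q := (Complex.ofRealCLM.contDiff.comp (contDiff_norm_sq ℝ)).pow M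
  have hqt : q.HasTemperateGrowth := by
    have : (fun ξ : En n => (((‖ξ‖ ^ 2 : ℝ)) : ℂ)).HasTemperateGrowth :=
      Function.HasTemperateGrowth.comp Function.Complex.hasTemperateGrowth_ofReal (Function.hasTemperateGrowth_norm_sq (En n))
    exact this.pow M
  have hbne : ∀ ξ ∈ tsupport ψ, q ξ * 𝓕 Φ ξ ≠ 0 := by
    intro ξ hξ
    obtain ⟨h1, h2⟩ := hψt hξ
    refine mul_ne_zero (pow_ne_zero _ ?_) (hΦ _ h2)
    exact_mod_cast (by positivity : ‖ξ‖ ^ 2 ≠ 0)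
  obtain ⟨W, hW⟩ := sw_div (a := ψ) (b := fun ξ => q ξ * 𝓕 Φ ξ) hψs
    (hqs.mul ((𝓕 Φ).smooth ⊤)) hψc hbne
  obtain ⟨X, hX⟩ := sw_div (a := χ) (b := fun _ => 1) hχ contDiff_const hχc (by simp)
  set A : Sw n := 𝓕⁻ (SchwartzMap.smulLeftCLM ℂ q (𝓕 Φ)) with hA
  have hAF : ∀ ξ, 𝓕 A ξ = q ξ * 𝓕 Φ ξ := by
    intro ξ
    rw [hA, FourierTransform.fourier_fourierInv_eq, SchwartzMap.smulLeftCLM_apply_apply hqt]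
    rfl
  have ht : ∀ j : ℕ, (0:ℝ) < 2⁻¹ ^ j := fun j => by positivity
  have hex : ∀ j : ℕ, ∃ T : Sw n, (∀ x, T x = ∫ y, A (x - y) *
      (((((2:ℝ)⁻¹ ^ j) ^ n)⁻¹) • W (((2:ℝ)⁻¹ ^ j)⁻¹ • y))) ∧
      ∀ ξ, 𝓕 T ξ = q ξ * 𝓕 Φ ξ * (ψ (((2:ℝ)⁻¹ ^ j) • ξ) / (q (((2:ℝ)⁻¹ ^ j) • ξ) *
        𝓕 Φ (((2:ℝ)⁻¹ ^ j) • ξ))) := by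
    intro j
    obtain ⟨Wj, hWj, hWjF⟩ := sw_dil W (ht j)
    obtain ⟨T, hT, hTF⟩ := sw_conv A Wj
    refine ⟨T, fun x => by rw [hT]; simp only [hWj], fun ξ => ?_⟩
    rw [hTF, hAF, hWjF, hW]
  choose T hT hTF using hex
  obtain ⟨C1, hC1, hB1⟩ := conv_bound A W hN
  obtain ⟨C2, hC2, hB2⟩ := sw_decay X N
  refine ⟨C1 + C2, by positivity, fun j => if j = 0 then X else T j, fun j x => ?_, fun J ξ => ?_⟩
  · simp only
    split_ifs with hj
    · refine (hB2 x).trans ?_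
      gcongr
      linarith
    · rw [hT]
      refine (enorm_integral_le_lintegral_enorm _).trans ?_
      simp only [enorm_mul]
      refine (hB1 _ (ht j) (pow_le_one₀ (by norm_num) (by norm_num)) x).trans ?_
      gcongr
      linarith
  · induction J with
    | zero => simp [hX]
    | succ J ih =>
      rw [Finset.sum_range_succ, ih]
      simp only [Nat.add_eq_zero_iff, one_ne_zero, and_false, if_false]
      set s : ℝ := 2⁻¹ ^ (J + 1) with hs
      have hs0 : 0 < s := ht _
      have hsJ : ((2:ℝ)⁻¹ ^ J) • ξ = (2:ℝ) • s • ξ := by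
        rw [smul_smul, hs, pow_succ]; congr 1; ring
      have hqs : q (s • ξ) = ((2:ℂ)⁻¹ ^ (2 * M * (J+1))) * q ξ := by
        simp only [hq]
        rw [norm_smul, Real.norm_of_nonneg hs0.le, mul_pow, hs]
        push_cast
        rw [mul_pow, ← pow_mul, ← pow_mul, mul_comm (J+1), mul_right_comm]
      have hkey : ((2:ℂ)⁻¹ ^ (2 * M * (J+1))) * 𝓕 (T (J+1)) ξ * 𝓕 Φ (s • ξ) =
          ψ (s • ξ) * 𝓕 Φ ξ := by
        rw [hTF, ← hs]
        by_cases h0 : s • ξ ∈ tsupport ψ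
        · have := hbne _ h0
          obtain ⟨ha, hb⟩ := mul_ne_zero_iff.1 this
          calc _ = (((2:ℂ)⁻¹ ^ (2 * M * (J+1))) * q ξ) * 𝓕 Φ ξ * ψ (s • ξ) / (q (s • ξ) * 𝓕 Φ (s • ξ)) *
                𝓕 Φ (s • ξ) := by ring
            _ = _ := by
              rw [← hqs]
              field_simp
        · rw [image_eq_zero_of_notMem_tsupport h0]
          simp
      rw [hkey, hsJ]
      simp only [hψ]
      ring
end

noncomputable section
open MeasureTheory Real Set
open scoped ENNReal NNReal FourierTransform ContDiff

def ut {n : ℕ} (Φ : Sw n) (t : ℝ) (f : Sw n) (x : En n) : ℂ :=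
  ∫ y, (t ^ n)⁻¹ • Φ (t⁻¹ • (x - y)) * f y

lemma ut_le_radMax {n : ℕ} (Φ f : Sw n) {t : ℝ} (ht : 0 < t) (x : En n) :
    ‖ut Φ t f x‖ₑ ≤ radMax n Φ f x := by
  unfold radMax ut
  exact le_iSup₂_of_le (f := fun (t : ℝ) (_ : 0 < t) =>
    (‖∫ y, (t ^ n)⁻¹ • Φ (t⁻¹ • (x - y)) * f y‖₊ : ℝ≥0∞)) t ht le_rfl

lemma ut_sw {n : ℕ} (Φ f : Sw n) {t : ℝ} (ht : 0 < t) : ∃ G : Sw n, (∀ x, G x = ut Φ t f x) ∧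
    ∀ ξ, 𝓕 G ξ = 𝓕 Φ (t • ξ) * 𝓕 f ξ := by
  obtain ⟨D, hD, hDF⟩ := sw_dil Φ ht
  obtain ⟨G, hG, hGF⟩ := sw_conv D f
  refine ⟨G, fun x => ?_, fun ξ => by rw [hGF, hDF]⟩
  rw [hG]
  simp only [hD]
  rfl

lemma sw_inv {n : ℕ} (f : Sw n) (z : En n) :
    f z = ∫ v, Complex.exp (↑(2 * π * inner ℝ v z) * Complex.I) • 𝓕 f v := by
  conv_lhs => rw [← FourierTransform.fourierInv_fourier_eq (F := Sw n) f]
  rw [SchwartzMap.fourierInv_coe, Real.fourierInv_eq']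

lemma lemS {n : ℕ} (Φ : Sw n) (hΦ : ∀ ξ, ‖ξ‖ ≤ 2 → 𝓕 Φ ξ ≠ 0) (M : ℕ) {N : ℝ} (hN : 0 ≤ N) :
    ∃ C : ℝ, 0 < C ∧ ∀ (g : Sw n) (z : En n), ‖ut Φ 1 g z‖ₑ ≤ ENNReal.ofReal C *
      ∑' j : ℕ, (2⁻¹ : ℝ≥0∞) ^ (2 * M * j) * ∫⁻ x, wt N (z - x) * ‖ut Φ ((2:ℝ)⁻¹ ^ j) g x‖ₑ := by
  obtain ⟨χ, hχ, hχc, hχ1, hχ2, hχb, -⟩ := exists_bump n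
  obtain ⟨C, hC, T, hT, hTF⟩ := exists_T Φ hΦ hχ hχc hχ1 hχ2 M hN
  refine ⟨C, hC, fun g z => ?_⟩
  have ht : ∀ j : ℕ, (0:ℝ) < 2⁻¹ ^ j := fun j => by positivity
  choose G hG hGF using fun j : ℕ => ut_sw Φ g (ht j)
  choose K hK hKF using fun j : ℕ => sw_conv (T j) (G j)
  set H : ℕ → Sw n := fun J => ∑ j ∈ Finset.range (J + 1), ((2:ℂ)⁻¹ ^ (2 * M * j)) • K j with hH
  have hHF : ∀ J ξ, 𝓕 (H J) ξ = χ (((2:ℝ)⁻¹ ^ J) • ξ) * 𝓕 (G 0) ξ := by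
    intro J ξ
    rw [hGF, pow_zero, one_smul, ← mul_assoc, ← hTF, hH]
    simp only
    rw [FourierTransform.fourier_sum, sum_apply, Finset.sum_mul]
    apply Finset.sum_congr rfl
    intro j _
    rw [FourierTransform.fourier_smul, SchwartzMap.smul_apply, hKF, hGF, smul_eq_mul]
    ring
  have hlim : Filter.Tendsto (fun J => H J z) Filter.atTop (nhds (G 0 z)) := by
    simp only [fun J => sw_inv (H J) z]
    rw [sw_inv (G 0) z]
    apply tendsto_integral_of_dominated_convergence (fun v => ‖𝓕 (G 0) v‖)
    · intro J
      have hc : Continuous fun v : En n => Complex.exp (↑(2 * π * inner ℝ v z) * Complex.I) := by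
        fun_prop
      exact (hc.smul (SchwartzMap.continuous _)).aestronglyMeasurable
    · exact (SchwartzMap.integrable _).norm
    · intro J
      refine Filter.Eventually.of_forall fun v => ?_
      rw [norm_smul, Complex.norm_exp_ofReal_mul_I, one_mul, hHF, norm_mul]
      exact mul_le_of_le_one_left (norm_nonneg _) (hχb _)
    · refine Filter.Eventually.of_forall fun v => ?_
      apply Filter.Tendsto.const_smul
      simp only [hHF]
      have h0 : Filter.Tendsto (fun J : ℕ => ((2:ℝ)⁻¹ ^ J) • v) Filter.atTop (nhds ((0:ℝ) • v)) :=
        (tendsto_pow_atTop_nhds_zero_of_lt_one (by norm_num) (by norm_num)).smul_const v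
      have h1 := (hχ.continuous.tendsto _).comp h0
      rw [zero_smul, hχ1 0 (by simp)] at h1
      simpa using h1.mul_const (𝓕 (G 0) v)
  have hb : ∀ J, ‖H J z‖ₑ ≤ ENNReal.ofReal C *
      ∑' j : ℕ, (2⁻¹ : ℝ≥0∞) ^ (2 * M * j) * ∫⁻ x, wt N (z - x) * ‖ut Φ ((2:ℝ)⁻¹ ^ j) g x‖ₑ := by
    intro J
    rw [hH]
    simp only
    rw [sum_apply]
    refine (enorm_sum_le _ _).trans ?_
    rw [← ENNReal.tsum_mul_left]
    refine le_trans (Finset.sum_le_sum fun j _ => ?_) (ENNReal.sum_le_tsum (Finset.range (J+1)))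
    rw [SchwartzMap.smul_apply, enorm_smul, enorm_pow, enorm_inv two_ne_zero, hK, mul_left_comm]
    have e2 : ‖(2:ℂ)‖ₑ = 2 := by
      rw [← ofReal_norm]; simp
    rw [e2]
    gcongr
    refine (enorm_integral_le_lintegral_enorm _).trans ?_
    rw [← lintegral_const_mul' _ _ ENNReal.ofReal_ne_top]
    apply lintegral_mono
    intro x
    simp only
    rw [enorm_mul, ← hG, ← mul_assoc]
    gcongr
    exact hT _ _
  have e0 : ut Φ 1 g z = G 0 z := by rw [hG, pow_zero]
  rw [e0]
  exact le_of_tendsto ((continuous_enorm.tendsto _).comp hlim) (Filter.Eventually.of_forall hb)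
end

noncomputable section
open MeasureTheory Real Set
open scoped ENNReal NNReal FourierTransform ContDiff

lemma ut_scale {n : ℕ} (Φ f g : Sw n) {s : ℝ} (hs : 0 < s) (hg : ∀ x, g x = f (s • x)) {t : ℝ}
    (ht : 0 < t) (x : En n) : ut Φ t g x = ut Φ (t * s) f (s • x) := by
  unfold ut
  have := Measure.integral_comp_smul (volume : Measure (En n))
    (fun y => (t ^ n)⁻¹ • Φ (t⁻¹ • (x - s⁻¹ • y)) * f y) s
  rw [finrank_euclideanSpace_fin, abs_of_pos (by positivity)] at this
  simp only [hg]
  simp only [inv_smul_smul₀ hs.ne'] at this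
  rw [this, ← integral_smul]
  congr 1
  funext y
  have e : (t * s)⁻¹ • (s • x - y) = t⁻¹ • (x - s⁻¹ • y) := by
    rw [mul_inv, ← smul_smul, smul_sub, inv_smul_smul₀ hs.ne']
  rw [e, mul_pow, mul_inv, ← smul_mul_assoc, smul_smul, mul_comm (s ^ n)⁻¹]

lemma ut_bdd {n : ℕ} (Φ f : Sw n) : ∃ C : ℝ, ∀ t : ℝ, 0 < t → t ≤ 1 → ∀ x,
    ‖ut Φ t f x‖ₑ ≤ ENNReal.ofReal C := by
  obtain ⟨C, hC, h⟩ := conv_bound f Φ (N := 0) le_rfl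
  refine ⟨C, fun t ht ht1 x => ?_⟩
  have h1 := h t ht ht1 x
  have h2 : wt (n := n) 0 x = 1 := by simp [wt]
  rw [h2, mul_one] at h1
  refine le_trans ?_ h1
  unfold ut
  rw [← integral_sub_left_eq_self _ _ x]
  refine (enorm_integral_le_lintegral_enorm _).trans (le_of_eq ?_)
  congr 1
  funext y
  rw [enorm_mul, mul_comm, sub_sub_cancel]

lemma lemSi {n : ℕ} (Φ : Sw n) (hΦ : ∀ ξ, ‖ξ‖ ≤ 2 → 𝓕 Φ ξ ≠ 0) (M : ℕ) {N : ℝ} (hN : 0 ≤ N) :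
    ∃ C : ℝ, 0 < C ∧ ∀ (f : Sw n) (i : ℕ) (z : En n), ‖ut Φ ((2:ℝ)⁻¹ ^ i) f z‖ₑ ≤ ENNReal.ofReal C *
      ∑' j : ℕ, (2⁻¹ : ℝ≥0∞) ^ (2 * M * j) * (ENNReal.ofReal (((2:ℝ) ^ i) ^ n) *
        ∫⁻ x, wt N (((2:ℝ) ^ i) • (z - x)) * ‖ut Φ ((2:ℝ)⁻¹ ^ (i + j)) f x‖ₑ) := by
  obtain ⟨C, hC, h⟩ := lemS Φ hΦ M hN
  refine ⟨C, hC, fun f i z => ?_⟩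
  have hs : (0:ℝ) < 2⁻¹ ^ i := by positivity
  obtain ⟨g, hg⟩ := sw_smul f hs
  have h1 := h g ((2:ℝ) ^ i • z)
  have e1 : ((2:ℝ)⁻¹ ^ i) • ((2:ℝ) ^ i • z) = z := by
    rw [smul_smul, inv_pow, inv_mul_cancel₀ (by positivity), one_smul]
  rw [ut_scale Φ f g hs hg one_pos, one_mul, e1] at h1
  refine h1.trans (le_of_eq ?_)
  congr 1
  apply tsum_congr
  intro j
  congr 1
  rw [← lintegral_smul (n := n) (η := (2:ℝ)^i) (by positivity)]
  congr 2
  funext x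
  rw [ut_scale Φ f g hs hg (by positivity), ← smul_sub, mul_comm, ← pow_add, smul_smul, inv_pow _ i,
    inv_mul_cancel₀ (by positivity), one_smul, mul_comm, add_comm j i]

lemma tsum_half_le (A : ℕ) (hA : 1 ≤ A) : ∑' j : ℕ, (2⁻¹ : ℝ≥0∞) ^ (A * j) ≤ 2 := by
  calc _ ≤ ∑' j : ℕ, (2⁻¹ : ℝ≥0∞) ^ j := by
        apply ENNReal.tsum_le_tsum
        intro j
        exact pow_le_pow_right_of_le_one' (by simp) (by nlinarith)
    _ = 2 := ENNReal.tsum_geometric_two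

lemma lemD_term {r : ℝ} (hr : 0 < r) (hr1 : r < 1) {n A : ℕ} (hA : (n:ℝ) ≤ A * r) (i j : ℕ)
    {a w m B : ℝ≥0∞} (h1 : a * (2⁻¹) ^ (A * (i + j)) * w ≤ m) (h2 : a ≤ B) :
    (2⁻¹ : ℝ≥0∞) ^ (A * i) * ((2⁻¹) ^ (2 * A * j) * (ENNReal.ofReal (((2:ℝ) ^ i) ^ n) * (w * a))) ≤
      (2⁻¹) ^ (A * j) * (m ^ (1 - r) * (w ^ r * B ^ r)) := by
  set d : ℝ≥0∞ := (2⁻¹) ^ (A * (i + j)) with hd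
  have e1 : (2⁻¹ : ℝ≥0∞) ^ (A * i) * (2⁻¹) ^ (2 * A * j) = (2⁻¹) ^ (A * j) * d := by
    rw [hd, ← pow_add, ← pow_add]; congr 1; ring
  have e2 : ENNReal.ofReal (((2:ℝ) ^ i) ^ n) * d ^ r ≤ 1 := by
    have : d = ENNReal.ofReal ((2⁻¹) ^ (A * (i+j))) := by
      rw [hd, ENNReal.ofReal_pow (by norm_num), ENNReal.ofReal_inv_of_pos (by norm_num)]; simp
    rw [this, ENNReal.ofReal_rpow_of_nonneg (by positivity) hr.le, ← ENNReal.ofReal_mul (by positivity)]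
    rw [ENNReal.ofReal_le_one]
    rw [inv_pow, Real.inv_rpow (by positivity), ← div_eq_mul_inv, div_le_one (by positivity), ← pow_mul,
      ← Real.rpow_natCast, ← Real.rpow_natCast, ← Real.rpow_mul (by norm_num)]
    apply Real.rpow_le_rpow_of_exponent_le (by norm_num)
    push_cast
    have hj : (0:ℝ) ≤ j := by positivity
    have hi : (0:ℝ) ≤ i := by positivity
    have hA0 : (0:ℝ) ≤ A * r := by positivity
    nlinarith [mul_le_mul_of_nonneg_left hA hi, mul_nonneg hA0 hj]
  have e3 : a * d * w ≤ m ^ (1 - r) * (B ^ r * d ^ r * w ^ r) := by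
    calc a * d * w = (a * d * w) ^ (1 - r) * (a * d * w) ^ r := by
          rw [← ENNReal.rpow_add_of_nonneg _ _ (by linarith) hr.le]; simp
      _ ≤ m ^ (1 - r) * (B * d * w) ^ r := by gcongr
      _ = _ := by rw [ENNReal.mul_rpow_of_nonneg _ _ hr.le, ENNReal.mul_rpow_of_nonneg _ _ hr.le]
  calc _ = ((2⁻¹ : ℝ≥0∞) ^ (A * i) * (2⁻¹) ^ (2 * A * j)) * (ENNReal.ofReal (((2:ℝ) ^ i) ^ n) * (w * a)) := by
        ring
    _ = (2⁻¹) ^ (A * j) * (ENNReal.ofReal (((2:ℝ) ^ i) ^ n) * (a * d * w)) := by rw [e1]; ring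
    _ ≤ (2⁻¹) ^ (A * j) * (ENNReal.ofReal (((2:ℝ) ^ i) ^ n) * (m ^ (1 - r) * (B ^ r * d ^ r * w ^ r))) := by
        gcongr
    _ = (2⁻¹) ^ (A * j) * ((ENNReal.ofReal (((2:ℝ) ^ i) ^ n) * d ^ r) * (m ^ (1 - r) * (w ^ r * B ^ r))) := by
        ring
    _ ≤ (2⁻¹) ^ (A * j) * (1 * (m ^ (1 - r) * (w ^ r * B ^ r))) := by gcongr
    _ = _ := by rw [one_mul]

lemma lemD {n : ℕ} (Φ : Sw n) (hΦ : ∀ ξ, ‖ξ‖ ≤ 2 → 𝓕 Φ ξ ≠ 0) {r : ℝ} (hr : 0 < r) (hr1 : r < 1)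
    {A : ℕ} (hA1 : 1 ≤ A) (hA : (n:ℝ) ≤ A * r) :
    ∃ C : ℝ, 0 < C ∧ ∀ (f : Sw n) (z0 : En n), ‖ut Φ 1 f z0‖ₑ ^ r ≤ ENNReal.ofReal C *
      ∫⁻ x, wt (A * r) (x - z0) * radMax n Φ f x ^ r := by
  have hAr : (0:ℝ) ≤ A := by positivity
  obtain ⟨C, hC, h⟩ := lemSi Φ hΦ A hAr
  refine ⟨C * 2, by positivity, fun f z0 => ?_⟩
  set I := ∫⁻ x, wt (A * r) (x - z0) * radMax n Φ f x ^ r with hI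
  set m : ℝ≥0∞ := ⨆ (i : ℕ) (x : En n), ‖ut Φ ((2:ℝ)⁻¹ ^ i) f x‖ₑ * (2⁻¹) ^ (A * i) * wt A (x - z0) with hm
  have hle : ∀ (i : ℕ) (x : En n), ‖ut Φ ((2:ℝ)⁻¹ ^ i) f x‖ₑ * (2⁻¹) ^ (A * i) * wt A (x - z0) ≤ m :=
    fun i x => le_iSup₂_of_le (f := fun (i : ℕ) (x : En n) =>
      ‖ut Φ ((2:ℝ)⁻¹ ^ i) f x‖ₑ * (2⁻¹) ^ (A * i) * wt A (x - z0)) i x le_rfl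
  have hmt : m < ⊤ := by
    obtain ⟨C', hC'⟩ := ut_bdd Φ f
    refine lt_of_le_of_lt (iSup₂_le fun i x => ?_) (ENNReal.ofReal_lt_top (r := C'))
    have h1 : (2⁻¹ : ℝ≥0∞) ^ (A * i) ≤ 1 := pow_le_one₀ (by simp) (by simp)
    have h2 : wt (A:ℝ) (x - z0) ≤ 1 := by
      have := wt_anti hAr (x - z0)
      simpa [wt] using this
    calc _ ≤ ENNReal.ofReal C' * 1 * 1 := by
          gcongr
          exact hC' _ (by positivity) (pow_le_one₀ (by norm_num) (by norm_num)) x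
      _ = _ := by simp
  have key : m ≤ m ^ (1 - r) * (ENNReal.ofReal (C * 2) * I) := by
    refine iSup₂_le fun i z => ?_
    have hw : wt (A:ℝ) (z - z0) < ⊤ := wt_lt_top _ _
    have hp : ∀ k : ℕ, (2⁻¹ : ℝ≥0∞) ^ k ≠ ⊤ := fun k => ENNReal.pow_ne_top (by simp)
    calc _ ≤ (ENNReal.ofReal C *
        ∑' j : ℕ, (2⁻¹ : ℝ≥0∞) ^ (2 * A * j) * (ENNReal.ofReal (((2:ℝ) ^ i) ^ n) *
        ∫⁻ x, wt A (((2:ℝ) ^ i) • (z - x)) * ‖ut Φ ((2:ℝ)⁻¹ ^ (i + j)) f x‖ₑ)) *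
          (2⁻¹) ^ (A * i) * wt A (z - z0) := by gcongr; exact h f i z
      _ = ENNReal.ofReal C * ∑' j : ℕ, (wt A (z - z0) * (2⁻¹) ^ (A * i)) *
          ((2⁻¹ : ℝ≥0∞) ^ (2 * A * j) * (ENNReal.ofReal (((2:ℝ) ^ i) ^ n) *
        ∫⁻ x, wt A (((2:ℝ) ^ i) • (z - x)) * ‖ut Φ ((2:ℝ)⁻¹ ^ (i + j)) f x‖ₑ)) := by
          rw [ENNReal.tsum_mul_left]; ring
      _ ≤ ENNReal.ofReal C * ∑' j : ℕ, (2⁻¹ : ℝ≥0∞) ^ (A * j) * (m ^ (1 - r) * I) := by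
          refine mul_le_mul_right (ENNReal.tsum_le_tsum fun j => ?_) _
          rw [← lintegral_const_mul' _ _ ENNReal.ofReal_ne_top, ← lintegral_const_mul' _ _ (hp _),
            ← lintegral_const_mul' _ _ (ENNReal.mul_ne_top hw.ne (hp _)), hI,
            ← lintegral_const_mul' _ _ (ENNReal.rpow_ne_top_of_nonneg (by linarith) hmt.ne),
            ← lintegral_const_mul' _ _ (hp _)]
          apply lintegral_mono
          intro x
          simp only
          have e1 : wt (A:ℝ) (z - z0) * wt A (((2:ℝ)^i) • (z - x)) ≤ wt A (x - z0) := by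
            have a1 : wt (A:ℝ) (((2:ℝ)^i) • (z - x)) ≤ wt A (x - z) := by
              rw [wt_sub_comm _ x z]
              have := wt_le_of hAr (x := ((2:ℝ)^i) • (z - x)) (y := z - x) one_pos (by
                rw [norm_smul, Real.norm_of_nonneg (by positivity), one_mul]
                have : (1:ℝ) ≤ 2 ^ i := one_le_pow₀ (by norm_num)
                nlinarith [norm_nonneg (z - x)])
              simpa using this
            have a2 := wt_peetre hAr (x - z) (z - z0)
            rw [sub_add_sub_cancel] at a2
            refine le_trans ?_ a2
            rw [mul_comm]
            gcongr
          have e2 := lemD_term hr hr1 hA i j (hle (i + j) x) (ut_le_radMax Φ f (by positivity) x)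
          rw [← wt_rpow _ hr.le]
          refine le_trans ?_ e2
          calc _ = (2⁻¹ : ℝ≥0∞) ^ (A * i) * ((2⁻¹) ^ (2 * A * j) * (ENNReal.ofReal (((2:ℝ) ^ i) ^ n) *
              ((wt (A:ℝ) (z - z0) * wt A (((2:ℝ)^i) • (z - x))) * ‖ut Φ ((2:ℝ)⁻¹ ^ (i + j)) f x‖ₑ))) := by
                ring
            _ ≤ _ := by gcongr
      _ ≤ ENNReal.ofReal C * (2 * (m ^ (1 - r) * I)) := by
          rw [ENNReal.tsum_mul_right]
          gcongr
          exact tsum_half_le A hA1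
      _ = _ := by
          rw [ENNReal.ofReal_mul hC.le]
          simp only [ENNReal.ofReal_ofNat]
          ring
  have h0 : ‖ut Φ 1 f z0‖ₑ ≤ m := by
    have := hle 0 z0
    simpa [wt] using this
  refine (ENNReal.rpow_le_rpow h0 hr.le).trans ?_
  rcases eq_or_ne m 0 with hm0 | hm0
  · rw [hm0, ENNReal.zero_rpow_of_pos hr]; exact zero_le
  · have e1 : m ^ (1 - r) ≠ 0 := by
      rw [Ne, ENNReal.rpow_eq_zero_iff]
      push Not
      exact ⟨fun h => absurd h hm0, fun h => absurd h hmt.ne⟩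
    have e2 : m ^ (1 - r) ≠ ⊤ := ENNReal.rpow_ne_top_of_nonneg (by linarith) hmt.ne
    rw [← ENNReal.mul_le_mul_iff_right e1 e2]
    refine le_trans (le_of_eq ?_) key
    rw [← ENNReal.rpow_add_of_nonneg _ _ (by linarith) hr.le]
    simp
end

noncomputable section
open MeasureTheory Real Set
open scoped ENNReal NNReal FourierTransform ContDiff

lemma sup_trick {ι : Type*} {r : ℝ} (hr : 0 < r) (c μ : ι → ℝ≥0∞) :
    (∑' j, c j * (μ j * μ j)) ^ (1 / r) ≤
      (∑' j, μ j) ^ (1 / r) * ∑' j, (c j) ^ (1 / r) * (μ j) ^ (1 / r) := by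
  have h1r : 0 < 1 / r := by positivity
  set S := ∑' j, (c j) ^ (1 / r) * (μ j) ^ (1 / r) with hS
  have h1 : ∀ j, c j * μ j ≤ S ^ r := by
    intro j
    have h2 : (c j) ^ (1 / r) * (μ j) ^ (1 / r) ≤ S :=
      ENNReal.le_tsum (f := fun j => (c j) ^ (1 / r) * (μ j) ^ (1 / r)) j
    have h3 := ENNReal.rpow_le_rpow h2 hr.le
    rwa [← ENNReal.mul_rpow_of_nonneg _ _ h1r.le, ← ENNReal.rpow_mul, one_div_mul_cancel hr.ne',
      ENNReal.rpow_one] at h3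
  have h2 : ∑' j, c j * (μ j * μ j) ≤ (∑' j, μ j) * S ^ r := by
    rw [← ENNReal.tsum_mul_right]
    apply ENNReal.tsum_le_tsum
    intro j
    rw [← mul_assoc, mul_comm]
    gcongr
    exact h1 j
  calc _ ≤ ((∑' j, μ j) * S ^ r) ^ (1 / r) := ENNReal.rpow_le_rpow h2 h1r.le
    _ = _ := by
      rw [ENNReal.mul_rpow_of_nonneg _ _ h1r.le, ← ENNReal.rpow_mul, mul_one_div_cancel hr.ne',
        ENNReal.rpow_one]

lemma lemU {n : ℕ} (Φ : Sw n) (hΦ : ∀ ξ, ‖ξ‖ ≤ 2 → 𝓕 Φ ξ ≠ 0) {r : ℝ} (hr : 0 < r) (hr1 : r < 1)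
    {A : ℕ} (hA1 : 1 ≤ A) (hA : (n:ℝ) < A * r / 2) :
    ∃ C : ℝ, 0 < C ∧ ∀ (f : Sw n) (z : En n), ‖ut Φ 1 f z‖ₑ ≤ ENNReal.ofReal C *
      ∑' j, bavg r (radMax n Φ f) j * wt ((A:ℝ) / 2) (z - lat j) := by
  have hn0 : (0:ℝ) ≤ n := by positivity
  obtain ⟨C, hC, h⟩ := lemD Φ hΦ hr hr1 hA1 (by linarith)
  have hI : ∫⁻ x : En n, wt (A * r / 2) x < ⊤ := lintegral_wt_lt_top hA
  set K : ℝ≥0∞ := ENNReal.ofReal C * ENNReal.ofReal ((1 + n) ^ ((A:ℝ) * r)) *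
    (ENNReal.ofReal ((1 + n) ^ ((A:ℝ) * r / 2)) * ∫⁻ x : En n, wt (A * r / 2) x) with hK
  have hKt : K ^ (1 / r) < ⊤ := by
    apply ENNReal.rpow_lt_top_of_nonneg (by positivity)
    rw [hK]
    finiteness
  refine ⟨(K ^ (1 / r)).toReal + 1, by positivity, fun f z => ?_⟩
  have hle : K ^ (1 / r) ≤ ENNReal.ofReal ((K ^ (1 / r)).toReal + 1) := by
    rw [← ENNReal.ofReal_toReal hKt.ne, ENNReal.toReal_ofReal ENNReal.toReal_nonneg]
    exact ENNReal.ofReal_le_ofReal (by linarith)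
  set c : (Fin n → ℤ) → ℝ≥0∞ := fun j => ∫⁻ x in cube j, radMax n Φ f x ^ r with hc
  set μ : (Fin n → ℤ) → ℝ≥0∞ := fun j => wt (A * r / 2) (z - lat j) with hμ
  have h1 : ∫⁻ x, wt (A * r) (x - z) * radMax n Φ f x ^ r ≤
      ENNReal.ofReal ((1 + n) ^ ((A:ℝ) * r)) * ∑' j, c j * (μ j * μ j) := by
    rw [← tsum_cube, ← ENNReal.tsum_mul_left]
    apply ENNReal.tsum_le_tsum
    intro j
    have h2 : ∀ x ∈ cube j, wt (A * r) (x - z) * radMax n Φ f x ^ r ≤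
        (ENNReal.ofReal ((1 + n) ^ ((A:ℝ) * r)) * (μ j * μ j)) * radMax n Φ f x ^ r := by
      intro x hx
      gcongr
      rw [hμ, wt_mul, add_halves, wt_sub_comm]
      exact wt_cube' (by positivity) hx
    refine (setLIntegral_mono' (measurableSet_cube j) h2).trans (le_of_eq ?_)
    have hne : μ j ≠ ⊤ := (wt_lt_top _ _).ne
    rw [lintegral_const_mul' _ _ (by finiteness)]
    simp only [hc]
    ring
  have h3 : ∑' j, μ j ≤ ENNReal.ofReal ((1 + n) ^ ((A:ℝ) * r / 2)) * ∫⁻ x : En n, wt (A * r / 2) x := by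
    have := tsum_wt_le (γ := A * r / 2) (by positivity) one_pos le_rfl z
    simpa using this
  have h1r : 0 < 1 / r := by positivity
  have h4 := h f z
  have h5 := ENNReal.rpow_le_rpow h4 h1r.le
  rw [← ENNReal.rpow_mul, mul_one_div_cancel hr.ne', ENNReal.rpow_one] at h5
  refine h5.trans ?_
  calc _ ≤ (ENNReal.ofReal C * (ENNReal.ofReal ((1 + n) ^ ((A:ℝ) * r)) * ∑' j, c j * (μ j * μ j))) ^ (1 / r) := by
        gcongr
    _ = (ENNReal.ofReal C * ENNReal.ofReal ((1 + n) ^ ((A:ℝ) * r))) ^ (1 / r) *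
        (∑' j, c j * (μ j * μ j)) ^ (1 / r) := by
        rw [← mul_assoc, ENNReal.mul_rpow_of_nonneg _ _ h1r.le]
    _ ≤ (ENNReal.ofReal C * ENNReal.ofReal ((1 + n) ^ ((A:ℝ) * r))) ^ (1 / r) *
        ((∑' j, μ j) ^ (1 / r) * ∑' j, (c j) ^ (1 / r) * (μ j) ^ (1 / r)) := by
        gcongr
        exact sup_trick hr c μ
    _ ≤ (ENNReal.ofReal C * ENNReal.ofReal ((1 + n) ^ ((A:ℝ) * r))) ^ (1 / r) *
        ((ENNReal.ofReal ((1 + n) ^ ((A:ℝ) * r / 2)) * ∫⁻ x : En n, wt (A * r / 2) x) ^ (1 / r) *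
          ∑' j, (c j) ^ (1 / r) * (μ j) ^ (1 / r)) := by
        gcongr
    _ = K ^ (1 / r) * ∑' j, bavg r (radMax n Φ f) j * wt ((A:ℝ) / 2) (z - lat j) := by
        rw [← mul_assoc, ← ENNReal.mul_rpow_of_nonneg _ _ h1r.le]
        congr 1
        apply tsum_congr
        intro j
        simp only [hμ, hc, bavg]
        rw [wt_rpow _ h1r.le]
        congr 2
        field_simp
    _ ≤ _ := by gcongr

lemma conv_sum {n : ℕ} {κ L : ℝ} (hκ : 0 ≤ κ) (hL : κ + (n + 1) ≤ L) (b : (Fin n → ℤ) → ℝ≥0∞) (y : En n) :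
    ∫⁻ z, wt κ (y - z) * ∑' j, b j * wt L (z - lat j) ≤
      (∫⁻ x : En n, wt ((n:ℝ) + 1) x) * ∑' j, b j * wt κ (y - lat j) := by
  have hm : ∀ (γ : ℝ) (a : En n), Measurable fun z => wt γ (z - a) := fun γ a =>
    (measurable_wt γ).comp (by fun_prop)
  have hm2 : Measurable fun z => wt κ (y - z) := (measurable_wt κ).comp (by fun_prop)
  simp only [← ENNReal.tsum_mul_left]
  have hmm : ∀ j, Measurable fun z => wt κ (y - z) * (b j * wt L (z - lat j)) :=
    fun j => hm2.mul ((hm L (lat j)).const_mul (b j))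
  rw [lintegral_tsum (fun j => (hmm j).aemeasurable)]
  apply ENNReal.tsum_le_tsum
  intro j
  calc _ ≤ ∫⁻ z, (b j * wt κ (y - lat j)) * wt ((n:ℝ) + 1) (z - lat j) := by
        apply lintegral_mono
        intro z
        dsimp only
        have h1 : wt L (z - lat j) ≤ wt κ (z - lat j) * wt ((n:ℝ) + 1) (z - lat j) := by
          rw [wt_mul]; exact wt_anti hL _
        have h2 := wt_peetre hκ (y - z) (z - lat j)
        rw [sub_add_sub_cancel] at h2
        calc _ ≤ wt κ (y - z) * (b j * (wt κ (z - lat j) * wt ((n:ℝ) + 1) (z - lat j))) := by gcongr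
          _ = b j * (wt κ (y - z) * wt κ (z - lat j)) * wt ((n:ℝ) + 1) (z - lat j) := by ring
          _ ≤ _ := by gcongr
    _ = _ := by
        rw [lintegral_const_mul _ (hm _ _), lintegral_sub_right_eq_self (fun x => wt ((n:ℝ) + 1) x)]
        ring

lemma brE_sub {n : ℕ} (x y ξ : En n) : brE n (x - y) ξ =
    brE n x ξ * Complex.exp (↑(-2 * π * inner ℝ y (-ξ)) * Complex.I) := by
  rw [brE_inner, brE_inner, ← Complex.exp_add, inner_sub_left, inner_neg_right]
  congr 1
  push_cast
  ring

lemma br_fourier {n : ℕ} {δ : ℝ} (hδ : 0 < δ) (f : Sw n) (x : En n) :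
    ∫ y, f y * brKernel n δ (x - y) = ∫ ξ, (brM n δ ξ : ℂ) * (brE n x ξ * 𝓕 f (-ξ)) := by
  simp only [brKernel_eq, ← integral_const_mul]
  rw [integral_integral_swap]
  · congr 1
    funext ξ
    simp only [brE_sub]
    rw [SchwartzMap.fourier_coe, Real.fourier_eq', ← integral_const_mul, ← integral_const_mul]
    congr 1
    funext y
    rw [smul_eq_mul]
    ring
  · have h1 : Integrable (fun q : En n × En n => f q.1 * ((brM n δ q.2 : ℝ) : ℂ)) (volume.prod volume) :=
      Integrable.mul_prod f.integrable (brM_int hδ).ofReal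
    refine h1.mono ?_ (Filter.Eventually.of_forall fun q => ?_)
    · apply Continuous.aestronglyMeasurable
      have c1 : Continuous fun q : En n × En n => f q.1 := f.continuous.comp continuous_fst
      have c2 : Continuous fun q : En n × En n => ((brM n δ q.2 : ℝ) : ℂ) :=
        Complex.continuous_ofReal.comp ((brM_cont hδ).comp continuous_snd)
      have c3 : Continuous fun q : En n × En n => brE n (x - q.1) q.2 :=
        brE_cont.comp (by fun_prop : Continuous fun q : En n × En n => (x - q.1, q.2))
      exact c1.mul (c2.mul c3)
    · simp only [Function.uncurry, norm_mul, norm_brE, mul_one]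
      exact le_rfl

lemma key_pointwise {n : ℕ} (hn : 1 ≤ n) {δ : ℝ} (hδ : 0 < δ) (Φ : Sw n)
    (hΦ : ∀ ξ, ‖ξ‖ ≤ 2 → 𝓕 Φ ξ ≠ 0) {r : ℝ} (hr : 0 < r) (hr1 : r < 1) :
    ∃ C : ℝ, 0 < C ∧ ∀ (f : Sw n) (x : En n), ‖∫ y, f y * brKernel n δ (x - y)‖ₑ ≤ ENNReal.ofReal C *
      ∑' j, bavg r (radMax n Φ f) j * wt (((n:ℝ)+1)/2 + δ) (x - lat j) := by
  set κ : ℝ := ((n:ℝ)+1)/2 + δ with hκ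
  have hκ0 : 0 ≤ κ := by positivity
  set L : ℝ := κ + (n + 1) with hL
  have hL0 : 0 ≤ L := by positivity
  obtain ⟨A, hA⟩ := exists_nat_ge (max (2 * (L + (n + 1))) (2 * (n + 1) / r))
  have hA2 : L + (n + 1) ≤ (A:ℝ) / 2 := by linarith [(le_max_left _ _).trans hA]
  have hA3 : (n:ℝ) < A * r / 2 := by
    have := (le_max_right _ _).trans hA
    rw [div_le_iff₀ hr] at this
    linarith
  have hA1 : 1 ≤ A := by
    have : (1:ℝ) ≤ A := by
      have : (0:ℝ) ≤ n := by positivity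
      linarith
    exact_mod_cast this
  obtain ⟨CU, hCU, hU⟩ := lemU Φ hΦ hr hr1 hA1 hA3
  obtain ⟨CK, hCK, hK⟩ := brKernel_decay hn hδ
  obtain ⟨χ, hχ, hχc, hχ1, -, -, hχ2⟩ := exists_bump n
  obtain ⟨Ω, hΩF⟩ := sw_div (a := χ) (b := fun ξ => 𝓕 Φ ξ) hχ ((𝓕 Φ).smooth ⊤) hχc
    (fun ξ hξ => hΦ _ (hχ2 ξ hξ))
  obtain ⟨CO, hCO, hΩ⟩ := sw_decay Ω L
  have hI : ∫⁻ x : En n, wt ((n:ℝ) + 1) x < ⊤ := lintegral_wt_lt_top (by linarith)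
  set I := ∫⁻ x : En n, wt ((n:ℝ) + 1) x with hIdef
  set K := ENNReal.ofReal CK * ENNReal.ofReal CO * ENNReal.ofReal CU * I * I with hKdef
  have hKt : K < ⊤ := by rw [hKdef]; finiteness
  refine ⟨K.toReal + 1, by positivity, fun f x => ?_⟩
  have hle : K ≤ ENNReal.ofReal (K.toReal + 1) := by
    rw [← ENNReal.ofReal_toReal hKt.ne, ENNReal.toReal_ofReal ENNReal.toReal_nonneg]
    exact ENNReal.ofReal_le_ofReal (by linarith)
  obtain ⟨G, hG, hGF⟩ := ut_sw Φ f one_pos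
  obtain ⟨g, hg, hgF⟩ := sw_conv Ω G
  have e1 : ∫ y, f y * brKernel n δ (x - y) = ∫ y, g y * brKernel n δ (x - y) := by
    rw [br_fourier hδ, br_fourier hδ]
    congr 1
    funext ξ
    rcases le_or_gt 1 ‖ξ‖ with h | h
    · rw [brM_zero hδ h]; simp
    · rw [hgF, hΩF, hGF, one_smul, hχ1 _ (by rw [norm_neg]; exact h.le), ← mul_assoc (1 / _),
        one_div_mul_cancel (hΦ _ (by rw [norm_neg]; linarith)), one_mul]
  rw [e1]
  set b := bavg r (radMax n Φ f) with hb
  have hgb : ∀ y, ‖g y‖ₑ ≤ ENNReal.ofReal CO * ENNReal.ofReal CU * I * ∑' j, b j * wt L (y - lat j) := by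
    intro y
    rw [hg]
    refine (enorm_integral_le_lintegral_enorm _).trans ?_
    calc _ ≤ ∫⁻ z, (ENNReal.ofReal CO * ENNReal.ofReal CU) *
          (wt L (y - z) * ∑' j, b j * wt ((A:ℝ) / 2) (z - lat j)) := by
          apply lintegral_mono
          intro z
          simp only
          rw [enorm_mul, hG]
          calc _ ≤ (ENNReal.ofReal CO * wt L (y - z)) * (ENNReal.ofReal CU *
                ∑' j, b j * wt ((A:ℝ) / 2) (z - lat j)) := by
                gcongr
                · exact hΩ _
                · exact hU f z
            _ = _ := by ring
      _ ≤ _ := by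
          rw [lintegral_const_mul' _ _ (by finiteness), mul_assoc (ENNReal.ofReal CO * _) I]
          gcongr
          exact conv_sum hL0 hA2 b y
  refine (enorm_integral_le_lintegral_enorm _).trans ?_
  calc _ ≤ ∫⁻ y, (ENNReal.ofReal CK * (ENNReal.ofReal CO * ENNReal.ofReal CU * I)) *
        (wt κ (x - y) * ∑' j, b j * wt L (y - lat j)) := by
        apply lintegral_mono
        intro y
        simp only
        rw [enorm_mul]
        calc _ ≤ (ENNReal.ofReal CO * ENNReal.ofReal CU * I * ∑' j, b j * wt L (y - lat j)) *
              (ENNReal.ofReal CK * wt κ (x - y)) := by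
              gcongr
              · exact hgb y
              · exact hK _
          _ = _ := by ring
    _ ≤ (ENNReal.ofReal CK * (ENNReal.ofReal CO * ENNReal.ofReal CU * I)) *
        (I * ∑' j, b j * wt κ (x - lat j)) := by
        rw [lintegral_const_mul' _ _ (by finiteness)]
        gcongr
        exact conv_sum hκ0 le_rfl b x
    _ = K * ∑' j, b j * wt κ (x - lat j) := by rw [hKdef]; ring
    _ ≤ _ := by gcongr
end

noncomputable section
open MeasureTheory Real Set
open scoped ENNReal NNReal FourierTransform ContDiff

lemma exists_rescale {n : ℕ} (Φ : Sw n) (hΦ : (∫ x, Φ x) ≠ 0) :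
    ∃ Ψ : Sw n, (∀ ξ, ‖ξ‖ ≤ 2 → 𝓕 Ψ ξ ≠ 0) ∧ ∀ (f : Sw n) x, radMax n Ψ f x ≤ radMax n Φ f x := by
  have h0 : 𝓕 Φ 0 ≠ 0 := by
    rw [SchwartzMap.fourier_coe, Real.fourier_eq']
    simpa using hΦ
  have hev := ((𝓕 Φ : Sw n).continuous.continuousAt (x := 0)).eventually_ne h0
  obtain ⟨r, hr, hball⟩ := Metric.eventually_nhds_iff.1 hev
  have ht : 0 < r / 3 := by positivity
  obtain ⟨Ψ, hΨ, hΨF⟩ := sw_dil Φ ht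
  refine ⟨Ψ, fun ξ hξ => ?_, fun f x => ?_⟩
  · rw [hΨF]
    apply hball
    rw [dist_zero_right, norm_smul, Real.norm_of_nonneg ht.le]
    nlinarith
  · unfold radMax
    apply iSup₂_le
    intro t htt
    refine le_iSup₂_of_le (f := fun (t : ℝ) (_ : 0 < t) =>
      (‖∫ y, (t ^ n)⁻¹ • Φ (t⁻¹ • (x - y)) * f y‖₊ : ℝ≥0∞)) (r / 3 * t) (by positivity) ?_
    apply le_of_eq
    congr 3
    funext y
    rw [hΨ, smul_smul, smul_smul, mul_pow, mul_inv, mul_inv, mul_comm ((t ^ n)⁻¹)]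

lemma radMax_scale {n : ℕ} (Φ f g : Sw n) {s : ℝ} (hs : 0 < s) (hg : ∀ x, g x = f (s • x)) (x : En n) :
    radMax n Φ g x ≤ radMax n Φ f (s • x) := by
  have h : radMax n Φ g x = ⨆ (t : ℝ) (_ : 0 < t), ‖ut Φ t g x‖ₑ := rfl
  rw [h]
  apply iSup₂_le
  intro t ht
  rw [ut_scale Φ f g hs hg ht]
  exact ut_le_radMax Φ f (by positivity) _

lemma brMeans_scale {n : ℕ} (δ : ℝ) (f g : Sw n) {s : ℝ} (hs : 0 < s) (hg : ∀ x, g x = f (s • x))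
    (x : En n) : brMeans n δ s f (s • x) = ∫ y, g y * brKernel n δ (x - y) := by
  unfold brMeans brKernelDil
  have := Measure.integral_comp_smul (volume : Measure (En n))
    (fun y => f y * brKernel n δ (x - s⁻¹ • y)) s
  simp only [smul_smul, inv_mul_cancel₀ hs.ne', one_smul, ← hg] at this
  rw [this, finrank_euclideanSpace_fin, abs_of_nonneg (by positivity), ← integral_smul]
  congr 1
  funext y
  rw [smul_sub, smul_smul, inv_mul_cancel₀ hs.ne', one_smul, mul_smul_comm]

lemma one_le_tsum_min {ι : Type*} (a : ι → ℝ≥0∞) (h : 1 ≤ ∑' j, a j) : 1 ≤ ∑' j, min 1 (a j) := by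
  by_cases hj : ∃ j, 1 ≤ a j
  · obtain ⟨j, hj⟩ := hj
    calc (1:ℝ≥0∞) = min 1 (a j) := (min_eq_left hj).symm
      _ ≤ _ := ENNReal.le_tsum j
  · push Not at hj
    refine h.trans (le_of_eq (tsum_congr fun j => (min_eq_right (hj j).le).symm))

lemma bavg_mono {n : ℕ} {p0 : ℝ} (hp0 : 0 < p0) {U V : En n → ℝ≥0∞} (h : ∀ x, U x ≤ V x) (j : Fin n → ℤ) :
    bavg p0 U j ≤ bavg p0 V j := by
  unfold bavg
  have h2 : ∀ x, U x ^ p0 ≤ V x ^ p0 := fun x => ENNReal.rpow_le_rpow (h x) hp0.le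
  exact ENNReal.rpow_le_rpow (lintegral_mono h2) (by positivity)

lemma bavg_div {n : ℕ} {p0 : ℝ} (hp0 : 0 < p0) (U : En n → ℝ≥0∞) {l : ℝ≥0∞} (hl : l ≠ 0) (hl2 : l ≠ ⊤)
    (j : Fin n → ℤ) : bavg p0 (fun x => U x / l) j = bavg p0 U j / l := by
  unfold bavg
  have : ∀ x, (U x / l) ^ p0 = U x ^ p0 * (l⁻¹) ^ p0 := fun x => by
    rw [div_eq_mul_inv, ENNReal.mul_rpow_of_nonneg _ _ hp0.le]
  simp only [this]
  rw [lintegral_mul_const' _ _ (ENNReal.rpow_ne_top_of_nonneg hp0.le (ENNReal.inv_ne_top.2 hl)),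
    ENNReal.mul_rpow_of_nonneg _ _ (by positivity), ← ENNReal.rpow_mul, mul_one_div_cancel hp0.ne',
    ENNReal.rpow_one, ENNReal.div_eq_inv_mul, mul_comm]

lemma LH_of {n : ℕ} {C0 pinf p0 : ℝ} {p : En n → ℝ} (hp : ∀ x, p x ≤ 1) (hp1 : p0 ≤ 1)
    (h1 : ∀ x y : En n, x ≠ y → |p x - p y| ≤ C0 / Real.log (Real.exp 1 + 1 / ‖x - y‖))
    (h2 : ∀ x : En n, |p x - pinf| ≤ C0 / Real.log (Real.exp 1 + ‖x‖)) {ε : ℝ} (hε : 0 < ε) :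
    LH n C0 (max pinf p0) p0 ε (fun x => max (p (ε • x)) p0) := by
  refine ⟨fun x => le_max_right _ _, fun x => max_le (hp _) hp1, fun x y hxy => ?_, fun x => ?_⟩
  · refine (abs_max_sub_max_le_abs _ _ _).trans ?_
    have := h1 (ε • x) (ε • y) (fun h => hxy (smul_right_injective _ hε.ne' h))
    rwa [← smul_sub, norm_smul, Real.norm_of_nonneg hε.le] at this
  · refine (abs_max_sub_max_le_abs _ _ _).trans ?_
    have := h2 (ε • x)
    rwa [norm_smul, Real.norm_of_nonneg hε.le] at this

lemma vlQ_congr {n : ℕ} {p q : En n → ℝ} (h : p =ᵐ[volume] q) (g : En n → ℝ≥0∞) :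
    vlQ n p g = vlQ n q g := by
  unfold vlQ
  have : ∀ l : ℝ≥0∞, ∫⁻ x, (g x / l) ^ (p x) = ∫⁻ x, (g x / l) ^ (q x) := fun l =>
    lintegral_congr_ae (h.mono fun x hx => by simp only [hx])
  simp only [this]

lemma main_bound {n : ℕ} {κ p0 c C' : ℝ} (hp0 : 0 < p0) (hc : 0 < c) (hC' : 1 ≤ C')
    {ε : ℝ} (hε : 0 < ε) {q : En n → ℝ} (hq : Measurable q) (hqlo : ∀ x, p0 ≤ q x)
    (G : En n → ℝ≥0∞) (b : (Fin n → ℤ) → ℝ≥0∞)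
    (hG : ∀ x, G (ε • x) ≤ ENNReal.ofReal c * ∑' j, b j * wt κ (x - lat j))
    (l : ℝ) (hl : 0 < l)
    (hB : ∀ β : ℝ, 0 < β → ENNReal.ofReal (ε ^ n) * ∑' j, ∫⁻ x, ENNReal.ofReal (β ^ q (ε • x)) *
        min 1 (b j / ENNReal.ofReal l / ENNReal.ofReal β * wt κ (x - lat j)) ≤ ENNReal.ofReal C')
    (β : ℝ≥0) (hβ : 0 < β) :
    (β : ℝ≥0∞) * vlQ n q ({x | (β : ℝ≥0∞) < G x}.indicator 1) ≤
      ENNReal.ofReal (C' ^ (1 / p0) * c) * ENNReal.ofReal l := by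
  set K := C' ^ (1 / p0) with hK
  have hC0 : 0 < C' := by linarith
  have hKp : 0 < K := by positivity
  have hβ' : (0:ℝ) < β := hβ
  set t : ℝ := β / (c * l) with ht
  have htp : 0 < t := by positivity
  have key : vlQ n q ({x | (β : ℝ≥0∞) < G x}.indicator 1) ≤ ENNReal.ofReal (K / t) := by
    apply sInf_le
    refine ⟨by rw [ENNReal.ofReal_pos]; positivity, ENNReal.ofReal_lt_top, ?_⟩
    rw [← lintegral_smul hε]
    set S : En n → ℝ≥0∞ := fun x => ∑' j, ENNReal.ofReal (t ^ q (ε • x)) *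
        min 1 (b j / ENNReal.ofReal l / ENNReal.ofReal t * wt κ (x - lat j)) with hS
    have hpt : ∀ x, (({x | (β : ℝ≥0∞) < G x}.indicator 1 (ε • x) : ℝ≥0∞) / ENNReal.ofReal (K / t)) ^ q (ε • x) ≤
        ENNReal.ofReal C'⁻¹ * S x := by
      intro x
      have hqp : 0 < q (ε • x) := hp0.trans_le (hqlo _)
      by_cases hx : (β : ℝ≥0∞) < G (ε • x)
      · rw [indicator_of_mem (by exact hx), Pi.one_apply, one_div, ← ENNReal.ofReal_inv_of_pos (by positivity),
          ENNReal.ofReal_rpow_of_pos (by positivity)]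
        have e1 : (K / t)⁻¹ ^ q (ε • x) ≤ C'⁻¹ * t ^ q (ε • x) := by
          rw [inv_div, Real.div_rpow htp.le hKp.le, div_eq_inv_mul]
          gcongr
          rw [hK, ← Real.rpow_mul hC0.le]
          nth_rw 1 [← Real.rpow_one C']
          apply Real.rpow_le_rpow_of_exponent_le hC'
          rw [one_div, ← div_eq_inv_mul, le_div_iff₀ hp0, one_mul]
          exact hqlo _
        have e2 : (1:ℝ≥0∞) ≤ ∑' j, min 1 (b j / ENNReal.ofReal l / ENNReal.ofReal t * wt κ (x - lat j)) := by
          apply one_le_tsum_min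
          have h3 : ∀ j, b j / ENNReal.ofReal l / ENNReal.ofReal t * wt κ (x - lat j) =
              ((ENNReal.ofReal l)⁻¹ * (ENNReal.ofReal t)⁻¹) * (b j * wt κ (x - lat j)) := fun j => by
            rw [div_eq_mul_inv, div_eq_mul_inv]; ring
          simp only [h3]
          rw [ENNReal.tsum_mul_left]
          have h4 := hx.le.trans (hG x)
          have h5 : (ENNReal.ofReal l)⁻¹ * (ENNReal.ofReal t)⁻¹ = (β:ℝ≥0∞)⁻¹ * ENNReal.ofReal c := by
            rw [← ENNReal.ofReal_inv_of_pos hl, ← ENNReal.ofReal_inv_of_pos htp,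
              ← ENNReal.ofReal_mul (by positivity), ← ENNReal.ofReal_coe_nnreal,
              ← ENNReal.ofReal_inv_of_pos hβ', ← ENNReal.ofReal_mul (by positivity), ht]
            congr 1
            field_simp
          rw [h5, mul_assoc]
          calc (1:ℝ≥0∞) = (β:ℝ≥0∞)⁻¹ * β := (ENNReal.inv_mul_cancel (by exact_mod_cast hβ.ne') (by simp)).symm
            _ ≤ _ := by gcongr
        rw [hS]
        dsimp only
        rw [ENNReal.tsum_mul_left, ← mul_assoc, ← ENNReal.ofReal_mul (by positivity)]
        calc ENNReal.ofReal ((K / t)⁻¹ ^ q (ε • x)) ≤ ENNReal.ofReal (C'⁻¹ * t ^ q (ε • x)) * 1 := by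
              rw [mul_one]; exact ENNReal.ofReal_le_ofReal e1
          _ ≤ _ := by gcongr
      · rw [indicator_of_notMem (by exact hx), ENNReal.zero_div, ENNReal.zero_rpow_of_pos hqp]
        exact zero_le
    have hmeas : ∀ j, Measurable fun x => ENNReal.ofReal (t ^ q (ε • x)) *
        min 1 (b j / ENNReal.ofReal l / ENNReal.ofReal t * wt κ (x - lat j)) := by
      intro j
      have h1 : Measurable fun x : En n => wt κ (x - lat j) := (measurable_wt κ).comp (by fun_prop)
      have h2 : Measurable fun x : En n => q (ε • x) := hq.comp (by fun_prop)
      have h3 : Measurable fun x : En n => ENNReal.ofReal (t ^ q (ε • x)) := by fun_prop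
      exact h3.mul (measurable_const.min (h1.const_mul _))
    calc _ ≤ ENNReal.ofReal (ε ^ n) * ∫⁻ x, ENNReal.ofReal C'⁻¹ * S x := by
          gcongr with x
          exact hpt x
      _ = ENNReal.ofReal C'⁻¹ * (ENNReal.ofReal (ε ^ n) * ∫⁻ x, S x) := by
          rw [lintegral_const_mul' _ _ ENNReal.ofReal_ne_top]; ring
      _ ≤ ENNReal.ofReal C'⁻¹ * ENNReal.ofReal C' := by
          gcongr
          rw [hS, lintegral_tsum (fun j => (hmeas j).aemeasurable)]
          exact hB t htp
      _ = 1 := by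
          rw [← ENNReal.ofReal_mul (by positivity), inv_mul_cancel₀ hC0.ne', ENNReal.ofReal_one]
  calc _ ≤ (β:ℝ≥0∞) * ENNReal.ofReal (K / t) := by gcongr
    _ = _ := by
      rw [← ENNReal.ofReal_coe_nnreal, ← ENNReal.ofReal_mul (by positivity), ← ENNReal.ofReal_mul (by positivity), ht]
      congr 1
      field_simp

theorem main_thm {n : ℕ} (hn : 1 ≤ n) (δ : ℝ)
    (hδ : ((n : ℝ) - 1) / 2 < δ)
    (p : En n → ℝ) (hpmeas : Measurable p)
    (hp : ∀ x, 0 < p x ∧ p x ≤ 1)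
    (hlogH : GlobalLogHolder n p)
    (hlow : 2 * (n : ℝ) / ((n : ℝ) + 1 + 2 * δ) ≤ essInf p volume)
    (Φ : SchwartzMap (En n) ℂ) (hΦ : (∫ x, Φ x) ≠ 0) :
    ∃ C : ℝ≥0, 0 < C ∧ ∀ (f : SchwartzMap (En n) ℂ) (ε : ℝ), 0 < ε →
      vlWQ n p (fun x => (‖brMeans n δ ε (⇑f) x‖₊ : ℝ≥0∞)) ≤
        (C : ℝ≥0∞) * vlQ n p (radMax n (⇑Φ) (⇑f)) := by
  have hn' : (1:ℝ) ≤ n := by exact_mod_cast hn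
  have hδ0 : 0 < δ := by linarith
  have hden : 0 < (n : ℝ) + 1 + 2 * δ := by linarith
  set p0 : ℝ := 2 * (n : ℝ) / ((n : ℝ) + 1 + 2 * δ) with hp0d
  have hp0 : 0 < p0 := by positivity
  have hp1 : p0 < 1 := by
    rw [hp0d, div_lt_one hden]; linarith
  have hκ : ((n:ℝ)+1)/2+δ = (n:ℝ)/p0 := by
    rw [hp0d]; field_simp
  obtain ⟨C0, pinf, hC0, hlh1, hlh2⟩ := hlogH
  obtain ⟨Ψ, hΨF, hΨ⟩ := exists_rescale Φ hΦ
  obtain ⟨c, hc, hkey⟩ := key_pointwise hn hδ0 Ψ hΨF hp0 hp1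
  obtain ⟨C', hC', hB2⟩ := exists_B2 hn (pinf := max pinf p0) hC0 hp0 hp1
  set q : En n → ℝ := fun x => max (p x) p0 with hq
  have hqm : Measurable q := hpmeas.max measurable_const
  have hpq : p =ᵐ[volume] q := by
    have hbdd : Filter.IsBoundedUnder (· ≥ ·) (ae (volume : Measure (En n))) p :=
      ⟨0, Filter.eventually_map.2 (Filter.Eventually.of_forall fun x => (hp x).1.le)⟩
    filter_upwards [ae_essInf_le hbdd] with x hx
    exact (max_eq_left (hlow.trans hx)).symm
  set K : ℝ := C' ^ (1 / p0) * c with hKd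
  have hK : 0 < K := by
    have : 0 < C' := by linarith
    positivity
  refine ⟨K.toNNReal, by simpa using hK, fun f ε hε => ?_⟩
  have hKe : ((K.toNNReal : ℝ≥0) : ℝ≥0∞) = ENNReal.ofReal K := rfl
  rw [hKe]
  obtain ⟨g, hg⟩ := sw_smul f hε
  unfold vlWQ
  apply iSup₂_le
  intro β hβ
  rw [vlQ_congr hpq, vlQ_congr hpq]
  have hK0 : ENNReal.ofReal K ≠ 0 := by simpa using hK
  rw [← ENNReal.div_le_iff' hK0 ENNReal.ofReal_ne_top]
  apply le_sInf
  rintro lam ⟨hl0, hlt, hmod⟩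
  rw [ENNReal.div_le_iff' hK0 ENNReal.ofReal_ne_top]
  have hlr : lam = ENNReal.ofReal lam.toReal := (ENNReal.ofReal_toReal hlt.ne).symm
  have hlp : 0 < lam.toReal := ENNReal.toReal_pos hl0.ne' hlt.ne
  rw [hlr]
  refine main_bound (κ := (n:ℝ)/p0) hp0 hc hC' hε hqm (fun x => le_max_right _ _) _
    (bavg p0 (radMax n Ψ g)) (fun x => ?_) lam.toReal hlp (fun s hs => ?_) β hβ
  · rw [brMeans_scale δ f g hε hg, ← hκ]
    exact hkey g x
  · have hLH := LH_of (fun x => (hp x).2) hp1.le hlh1 hlh2 hε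
    have := hB2 ε _ hε hLH (hqm.comp (by fun_prop : Measurable fun x : En n => ε • x))
      (fun x => radMax n Ψ g x / lam) ?_ s hs
    · simp only [bavg_div hp0 _ hl0.ne' hlt.ne] at this
      rw [← hlr]
      exact this
    · refine le_trans ?_ hmod
      rw [← lintegral_smul (f := fun x => (radMax n Φ f x / lam) ^ q x) hε]
      refine mul_le_mul_right (lintegral_mono fun x => ?_) _
      exact ENNReal.rpow_le_rpow (ENNReal.div_le_div_right
        ((radMax_scale Ψ f g hε hg x).trans (hΨ f _)) _) (hp0.le.trans (le_max_right _ _))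
end

theorem bochnerRiesz_variableHardy_to_weakVariableLebesgue {n : ℕ} (hn : 1 ≤ n) (δ : ℝ)
    (hδ : ((n : ℝ) - 1) / 2 < δ)
    (p : En n → ℝ) (hpmeas : Measurable p)
    (hp : ∀ x, 0 < p x ∧ p x ≤ 1)
    (hlogH : GlobalLogHolder n p)
    (hlow : 2 * (n : ℝ) / ((n : ℝ) + 1 + 2 * δ) ≤ essInf p volume)
    (Φ : SchwartzMap (En n) ℂ) (hΦ : (∫ x, Φ x) ≠ 0) :
    ∃ C : ℝ≥0, 0 < C ∧ ∀ (f : SchwartzMap (En n) ℂ) (ε : ℝ), 0 < ε →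
      vlWQ n p (fun x => (‖brMeans n δ ε (⇑f) x‖₊ : ℝ≥0∞)) ≤
        (C : ℝ≥0∞) * vlQ n p (radMax n (⇑Φ) (⇑f)) := main_thm hn δ hδ p hpmeas hp hlogH hlow Φ hΦ
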